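/- Let f, g ∈ ℂ[z], let G be the monodromy group of the deformation f + εg, and for fixed ε let G_ε be the monodromy group of the polynomial f(z) + εg(z). Then: (i) for every ε with c(ε) ≠ 0, G_ε is a subgroup of G up to conjugation; (ii) for every ε ∉ p₂(Σ₀), G_ε equals G up to conjugation; and (iii) G is the Galois group of the Galois extension of ℂ(t,ε) generated by the n preimages z_1(t,ε),…,z_n(t,ε) of t under f + εg, i.e. G = Aut_{ℂ(t,ε)} ℂ(z_1(t,ε),…,z_n(t,ε)). -/

import Mathlib

open Polynomial OnePoint

noncomputable section

/-- The degree `n` in `z` of the deformation `f + ε g`. -/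
def defDeg (f g : Polynomial ℂ) : ℕ := max f.natDegree g.natDegree

/-- `c(ε)`: the leading coefficient of `f + ε g` as a polynomial in `z`. -/
def leadC (f g : Polynomial ℂ) (ε : ℂ) : ℂ :=
  f.coeff (defDeg f g) + ε * g.coeff (defDeg f g)

/-- The finite part of `Σ`: the set of `(t, ε) ∈ ℂ²` with `c(ε) D(t,ε) = 0`,
`D` being the discriminant of `f + ε g - t` in `z`; equivalently, `c(ε) = 0` or
`f + ε g - t` has a multiple root. -/
def sigmaFin (f g : Polynomial ℂ) : Set (ℂ × ℂ) :=
  {p | leadC f g p.2 = 0 ∨ ∃ w : ℂ,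
    f.eval w + p.2 * g.eval w = p.1 ∧
    f.derivative.eval w + p.2 * g.derivative.eval w = 0}

/-- `Σ = {(t,ε) : c(ε)D(t,ε) = 0} ∪ {∞} × ℂ ⊆ ℂP¹ × ℂ`. -/
def sigmaSet (f g : Polynomial ℂ) : Set (OnePoint ℂ × ℂ) :=
  {p | p.1 = ∞ ∨ ∃ t : ℂ, p.1 = (t : OnePoint ℂ) ∧ (t, p.2) ∈ sigmaFin f g}

/-- The fiber of `H(z,ε) = (f(z) + ε g(z), ε)` over `(t₀, ε₀)`. -/
abbrev theFiber (f g : Polynomial ℂ) (t₀ ε₀ : ℂ) : Type :=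
  {w : ℂ // f.eval w + ε₀ * g.eval w = t₀}

/-- A permutation of the fiber over `(t₀,ε₀)` is a monodromy permutation if it is
realized by lifting some closed path in `(ℂP¹ × ℂ) \ Σ` based at `(t₀,ε₀)`. -/
def IsMonodromyPerm (f g : Polynomial ℂ) (t₀ ε₀ : ℂ)
    (σ : Equiv.Perm (theFiber f g t₀ ε₀)) : Prop :=
  ∃ γ : ℝ → OnePoint ℂ × ℂ,
    ContinuousOn γ (Set.Icc 0 1) ∧ γ 0 = ((t₀ : OnePoint ℂ), ε₀) ∧
    γ 1 = ((t₀ : OnePoint ℂ), ε₀) ∧ (∀ s ∈ Set.Icc (0 : ℝ) 1, γ s ∉ sigmaSet f g) ∧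
    ∀ x : theFiber f g t₀ ε₀, ∃ l : ℝ → ℂ,
      ContinuousOn l (Set.Icc 0 1) ∧ l 0 = x.1 ∧ l 1 = (σ x).1 ∧
      ∀ s ∈ Set.Icc (0 : ℝ) 1,
        ((f.eval (l s) + (γ s).2 * g.eval (l s) : ℂ) : OnePoint ℂ) = (γ s).1

/-- The monodromy group `G` of the deformation `f + ε g`: the subgroup of the
symmetric group of the fiber generated by all monodromy permutations. -/
def MonodromyGroup (f g : Polynomial ℂ) (t₀ ε₀ : ℂ) :
    Subgroup (Equiv.Perm (theFiber f g t₀ ε₀)) :=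
  Subgroup.closure {σ | IsMonodromyPerm f g t₀ ε₀ σ}

/-- The set of critical values of a polynomial `P`. -/
def polyCrit (P : Polynomial ℂ) : Set ℂ :=
  {t | ∃ w : ℂ, P.eval w = t ∧ P.derivative.eval w = 0}

/-- The fiber `P⁻¹(t)` of a polynomial `P`. -/
abbrev polyFiber (P : Polynomial ℂ) (t : ℂ) : Type := {w : ℂ // P.eval w = t}

/-- Monodromy permutations of a single polynomial `P`: permutations of the fiber
`P⁻¹(t₁)` realized by lifting closed paths in `ℂ \ {critical values}`. -/
def IsPolyMonodromyPerm (P : Polynomial ℂ) (t₁ : ℂ)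
    (σ : Equiv.Perm (polyFiber P t₁)) : Prop :=
  ∃ γ : ℝ → ℂ, ContinuousOn γ (Set.Icc 0 1) ∧ γ 0 = t₁ ∧ γ 1 = t₁ ∧
    (∀ s ∈ Set.Icc (0 : ℝ) 1, γ s ∉ polyCrit P) ∧
    ∀ x : polyFiber P t₁, ∃ l : ℝ → ℂ, ContinuousOn l (Set.Icc 0 1) ∧
      l 0 = x.1 ∧ l 1 = (σ x).1 ∧ ∀ s ∈ Set.Icc (0 : ℝ) 1, P.eval (l s) = γ s

/-- The monodromy group of a single polynomial `P`, based at `t₁`. -/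
def PolyMonodromyGroup (P : Polynomial ℂ) (t₁ : ℂ) :
    Subgroup (Equiv.Perm (polyFiber P t₁)) :=
  Subgroup.closure {σ | IsPolyMonodromyPerm P t₁ σ}

/-- The group homomorphism `Perm X →* Perm Y` induced by a bijection `e : X ≃ Y`. -/
def permMapHom {X Y : Type*} (e : X ≃ Y) : Equiv.Perm X →* Equiv.Perm Y where
  toFun σ := (e.symm.trans σ).trans e
  map_one' := by ext y; simp
  map_mul' σ τ := by ext y; simp [Equiv.Perm.mul_apply]

/-- Two permutation groups are permutationally isomorphic if some bijection of the
underlying sets conjugates one onto the other. -/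
def PermIsoOn {X Y : Type*} (G : Subgroup (Equiv.Perm X))
    (H : Subgroup (Equiv.Perm Y)) : Prop :=
  ∃ e : X ≃ Y, G.map (permMapHom e) = H

/-- A permutation group `G ≤ Perm X` is two-transitive if it acts transitively on
ordered pairs of distinct points. -/
def IsTwoTransitive {X : Type*} (G : Subgroup (Equiv.Perm X)) : Prop :=
  ∀ x₁ x₂ y₁ y₂ : X, x₁ ≠ x₂ → y₁ ≠ y₂ → ∃ σ ∈ G, σ x₁ = y₁ ∧ σ x₂ = y₂

/-- A permutation group `G ≤ Perm X` is imprimitive if there is a proper subset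
`B ⊆ X` with more than one element such that every `σ ∈ G` satisfies
`σ(B) ∩ B = ∅` or `σ(B) = B`. -/
def IsImprimitive {X : Type*} (G : Subgroup (Equiv.Perm X)) : Prop :=
  ∃ B : Set X, (∃ x ∈ B, ∃ y ∈ B, x ≠ y) ∧ B ≠ Set.univ ∧
    ∀ σ ∈ G, ((fun x => σ x) '' B) ∩ B = ∅ ∨ (fun x => σ x) '' B = B



/-- `Σ₀ ⊆ Σ`: the points of (the finite part of) `Σ` at which the differential of
the projection `p₂(t,ε) = ε` restricted to `Σ` vanishes, i.e. at which `Σ` is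
*not* locally the graph of an analytic function `ε ↦ t(ε)`. -/
def sigmaZero (f g : Polynomial ℂ) : Set (ℂ × ℂ) :=
  {p | p ∈ sigmaFin f g ∧
    ¬ ∃ (V : Set ℂ) (φ : ℂ → ℂ) (U : Set (ℂ × ℂ)),
        IsOpen V ∧ p.2 ∈ V ∧ (∀ x ∈ V, AnalyticAt ℂ φ x) ∧ φ p.2 = p.1 ∧
        IsOpen U ∧ p ∈ U ∧
        sigmaFin f g ∩ U = {q : ℂ × ℂ | q.2 ∈ V ∧ q.1 = φ q.2} ∩ U}

/-- The monodromy group `G_ε` of the single polynomial `f + ε₁ g` (monodromy in `t`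
with `ε = ε₁` fixed), based at a regular value `t₁`. -/
def IsSliceMonodromyPerm (f g : Polynomial ℂ) (ε₁ t₁ : ℂ)
    (σ : Equiv.Perm (theFiber f g t₁ ε₁)) : Prop :=
  ∃ γ : ℝ → ℂ, ContinuousOn γ (Set.Icc 0 1) ∧ γ 0 = t₁ ∧ γ 1 = t₁ ∧
    (∀ s ∈ Set.Icc (0 : ℝ) 1, γ s ∉ polyCrit (f + C ε₁ * g)) ∧
    ∀ x : theFiber f g t₁ ε₁, ∃ l : ℝ → ℂ, ContinuousOn l (Set.Icc 0 1) ∧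
      l 0 = x.1 ∧ l 1 = (σ x).1 ∧
      ∀ s ∈ Set.Icc (0 : ℝ) 1, f.eval (l s) + ε₁ * g.eval (l s) = γ s

def SliceMonodromyGroup (f g : Polynomial ℂ) (ε₁ t₁ : ℂ) :
    Subgroup (Equiv.Perm (theFiber f g t₁ ε₁)) :=
  Subgroup.closure {σ | IsSliceMonodromyPerm f g ε₁ t₁ σ}

/-- The field `ℂ(t,ε)` of rational functions in the two variables `t`, `ε`. -/
abbrev Kte : Type := FractionRing (MvPolynomial (Fin 2) ℂ)

/-- The variable `t` viewed inside `ℂ(t,ε)`. -/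
def tVar : Kte := algebraMap (MvPolynomial (Fin 2) ℂ) Kte (MvPolynomial.X 0)

/-- The variable `ε` viewed inside `ℂ(t,ε)`. -/
def eVar : Kte := algebraMap (MvPolynomial (Fin 2) ℂ) Kte (MvPolynomial.X 1)

/-- The embedding `ℂ → ℂ(t,ε)`. -/
def cEmb : ℂ →+* Kte :=
  (algebraMap (MvPolynomial (Fin 2) ℂ) Kte).comp (MvPolynomial.C)

/-- The polynomial `f(z) + ε g(z) - t` viewed over the field `ℂ(t,ε)`;
its splitting field is `ℂ(t,ε)(z₁,…,zₙ)`, generated by the `n` preimages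
`z₁(t,ε),…,zₙ(t,ε)` of `t` under `f + ε g`. -/
def defPoly (f g : Polynomial ℂ) : Polynomial Kte :=
  f.map cEmb + C eVar * g.map cEmb - C tVar

set_option linter.unusedSectionVars false

/-- If averaging polynomial functions of `z` over a finite set `S` of permutations always gives
something invariant under a permutation `τ`, then `S` is stable under `τ`. -/
theorem mul_mem_of_sum_invariant {ι L : Type*} [Finite ι] [Field L] [Algebra ℂ L]
    (z : ι → L) (hz : Function.Injective z) (S : Finset (Equiv.Perm ι)) (τ : Equiv.Perm ι)
    (h : ∀ H : MvPolynomial ι ℂ, ∑ σ ∈ S, MvPolynomial.aeval (fun i => z (σ i)) H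
      = ∑ σ ∈ S, MvPolynomial.aeval (fun i => z (τ (σ i))) H) : ∀ σ ∈ S, τ * σ ∈ S := by
  classical
  have := Fintype.ofFinite ι
  let ev : Equiv.Perm ι → (MvPolynomial ι ℂ →* L) := fun σ =>
    ((MvPolynomial.aeval (R := ℂ) (fun i => z (σ i))) : MvPolynomial ι ℂ →+* L).toMonoidHom
  have hev : Function.Injective ev := by
    intro σ σ' hσ
    ext i
    have := DFunLike.congr_fun hσ (MvPolynomial.X i)
    simp only [ev] at this
    exact hz (by simpa using this)
  have hli := (linearIndependent_monoidHom (MvPolynomial ι ℂ) L).comp ev hev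
  rw [Fintype.linearIndependent_iff] at hli
  intro σ₀ hσ₀
  by_contra hτ
  have key := hli (fun σ => (if σ ∈ S then 1 else 0) - (if σ ∈ S.image (τ * ·) then 1 else 0))
    ?_ (τ * σ₀)
  · simp [hτ, hσ₀] at key
  · ext H
    have hH := h H
    simp only [Finset.sum_apply, Pi.smul_apply, smul_eq_mul, sub_mul, Function.comp,
      Finset.sum_sub_distrib, ite_mul, one_mul, zero_mul, Pi.zero_apply]
    rw [Finset.sum_ite_mem, Finset.sum_ite_mem, Finset.univ_inter, Finset.univ_inter, sub_eq_zero,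
      Finset.sum_image (fun _ _ _ _ hab => mul_left_cancel hab)]
    exact hH

/-- The permutations of the family `y` induced by `K`-automorphisms of `E`. -/
def autPerm (K : Type*) {E ι : Type*} [CommSemiring K] [Semiring E] [Algebra K E] (y : ι → E) :
    Subgroup (Equiv.Perm ι) where
  carrier := {σ | ∃ φ : E ≃ₐ[K] E, ∀ i, φ (y i) = y (σ i)}
  one_mem' := ⟨1, fun i => rfl⟩
  mul_mem' := by
    rintro σ τ ⟨φ, hφ⟩ ⟨ψ, hψ⟩
    exact ⟨φ * ψ, fun i => by simp [AlgEquiv.mul_apply, hψ, hφ]⟩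
  inv_mem' := by
    rintro σ ⟨φ, hφ⟩
    refine ⟨φ⁻¹, fun i => ?_⟩
    have h := hφ (σ⁻¹ i)
    rw [show σ (σ⁻¹ i) = i from σ.apply_symm_apply i] at h
    rw [← h]
    exact φ.symm_apply_apply _

/-- The action of automorphisms on a family stable under them and generating the extension. -/
theorem exists_autPerm_equiv {K E ι : Type*} [Field K] [Field E] [Algebra K E] [Finite ι]
    (y : ι → E) (hy : Function.Injective y) (hgen : Algebra.adjoin K (Set.range y) = ⊤)
    (q : K[X]) (hq : ∀ x : E, aeval x q = 0 ↔ x ∈ Set.range y) :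
    Nonempty (autPerm K y ≃* (E ≃ₐ[K] E)) := by
  have hex : ∀ σ : autPerm K y, ∃ φ : E ≃ₐ[K] E, ∀ i, φ (y i) = y (σ.1 i) := fun σ => σ.2
  choose F hF using hex
  have huniq : ∀ φ ψ : E ≃ₐ[K] E, (∀ i, φ (y i) = ψ (y i)) → φ = ψ := by
    intro φ ψ h
    have : (φ : E →ₐ[K] E) = ψ := by
      apply AlgHom.ext_of_adjoin_eq_top hgen
      rintro _ ⟨i, rfl⟩
      exact h i
    ext x
    exact DFunLike.congr_fun this x
  let θ : autPerm K y →* (E ≃ₐ[K] E) :=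
    { toFun := F
      map_one' := huniq _ _ (fun i => by simp [hF])
      map_mul' := fun σ τ => huniq _ _ (fun i => by simp [hF, AlgEquiv.mul_apply]) }
  refine ⟨MulEquiv.ofBijective θ ⟨?_, ?_⟩⟩
  · intro σ τ h
    ext i
    apply hy
    rw [← hF, ← hF]
    exact DFunLike.congr_fun h (y i)
  · intro φ
    have hφ : ∀ i, ∃ j, y j = φ (y i) := by
      intro i
      apply (hq _).1
      have : aeval (y i) q = 0 := (hq _).2 ⟨i, rfl⟩
      rw [show φ (y i) = (φ : E →ₐ[K] E) (y i) from rfl, aeval_algHom_apply, this, map_zero]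
    choose s hs using hφ
    have hsinj : Function.Injective s := by
      intro i j hij
      apply hy
      apply φ.injective
      rw [← hs, ← hs, hij]
    let σ : Equiv.Perm ι := Equiv.ofBijective s (Finite.injective_iff_bijective.1 hsinj)
    refine ⟨⟨σ, φ, fun i => (hs i).symm⟩, ?_⟩
    apply huniq
    intro i
    exact (hF _ i).trans (hs i)

section Package

variable {R K E ι : Type*} [CommRing R] [Field K] [Algebra R K] [Field E]
  [Algebra K E] [Algebra R E] [IsScalarTower R K E]

/-- A fixed integral element of a Galois extension of the fraction field lies in the base ring. -/
theorem exists_eq_algebraMap_of_fixed [IsIntegrallyClosed R] [IsFractionRing R K]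
    [FiniteDimensional K E] [IsGalois K E]
    (x : E) (hx : IsIntegral R x)
    (hfix : ∀ φ : E ≃ₐ[K] E, φ x = x) : ∃ r : R, algebraMap R E r = x := by
  have : x ∈ (⊥ : IntermediateField K E) := by
    exact (IsGalois.mem_bot_iff_fixed x).2 hfix
  obtain ⟨k, rfl⟩ := IntermediateField.mem_bot.1 this
  have hk : IsIntegral R k := by
    exact (isIntegral_algHom_iff (IsScalarTower.toAlgHom R K E)
      (algebraMap K E).injective).1 hx
  obtain ⟨r, rfl⟩ := IsIntegrallyClosed.isIntegral_iff.1 hk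
  exact ⟨r, IsScalarTower.algebraMap_apply R K E r⟩

/-- `μ` satisfies, over the point `b`, all the algebraic relations satisfied by `y` over `R`. -/
def IsSpec (b : R →+* ℂ) (y : ι → E) (μ : ι → ℂ) : Prop :=
  ∀ Q : MvPolynomial ι R, MvPolynomial.aeval y Q = 0 → MvPolynomial.eval₂ b μ Q = 0

theorem exists_ringHom_of_isIntegral {O : Type*} [CommRing O] [Algebra R O]
    [Algebra.IsIntegral R O] (hinj : Function.Injective (algebraMap R O))
    (b : R →+* ℂ) (hb : Function.Surjective b) :
    ∃ ψ : O →+* ℂ, ∀ r, ψ (algebraMap R O r) = b r := by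
  have hmax : (RingHom.ker b).IsMaximal := RingHom.ker_isMaximal_of_surjective b hb
  obtain ⟨M, hM, hMc⟩ := Ideal.exists_ideal_over_maximal_of_isIntegral (S := O) (RingHom.ker b)
    (by rw [(RingHom.injective_iff_ker_eq_bot _).1 hinj]; exact bot_le)
  let _ : Field (O ⧸ M) := Ideal.Quotient.field M
  let g : R →+* O ⧸ M := (Ideal.Quotient.mk M).comp (algebraMap R O)
  have hker : ∀ r, b r = 0 → g r = 0 := by
    intro r hr
    have : r ∈ M.comap (algebraMap R O) := by rw [hMc]; exact hr
    exact Ideal.Quotient.eq_zero_iff_mem.2 this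
  let f : ℂ →+* O ⧸ M := RingHom.liftOfSurjective b hb ⟨g, fun r hr => hker r hr⟩
  have hf : ∀ r, f (b r) = g r := fun r => RingHom.liftOfRightInverse_comp_apply b _ _ _ r
  have hfint : f.IsIntegral := by
    intro x
    obtain ⟨o, rfl⟩ := Ideal.Quotient.mk_surjective x
    obtain ⟨p, hp, hpo⟩ := Algebra.IsIntegral.isIntegral (R := R) o
    refine ⟨p.map b, hp.map b, ?_⟩
    rw [eval₂_map]
    have : f.comp b = (Ideal.Quotient.mk M).comp (algebraMap R O) := RingHom.ext hf
    rw [this, ← hom_eval₂, hpo, map_zero]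
  have hbij := IsAlgClosed.ringHom_bijective_of_isIntegral f hfint
  let e := RingEquiv.ofBijective f hbij
  refine ⟨(e.symm : O ⧸ M →+* ℂ).comp (Ideal.Quotient.mk M), fun r => ?_⟩
  change e.symm (g r) = b r
  rw [← hf]
  exact e.symm_apply_apply _

variable (y : ι → E)

theorem exists_isSpec (hinj : Function.Injective (algebraMap R E))
    (h_int : ∀ i, IsIntegral R (y i)) (b : R →+* ℂ)
    (hb : Function.Surjective b) : ∃ μ : ι → ℂ, IsSpec b y μ := by
  obtain ⟨ψ, hψ⟩ := exists_ringHom_of_isIntegral (O := integralClosure R E)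
    (by
      intro a a' h
      exact hinj (congrArg Subtype.val h)) b hb
  refine ⟨fun i => ψ ⟨y i, h_int i⟩, fun Q hQ => ?_⟩
  have h1 : MvPolynomial.aeval (R := R) (fun i => (⟨y i, h_int i⟩ : integralClosure R E)) Q = 0 := by
    apply Subtype.val_injective
    have := MvPolynomial.map_aeval (R := R) (fun i => (⟨y i, h_int i⟩ : integralClosure R E))
      ((integralClosure R E).val : integralClosure R E →+* E) Q
    rw [ZeroMemClass.coe_zero, ← hQ]
    rw [MvPolynomial.aeval_def, ← MvPolynomial.coe_eval₂Hom]
    exact this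
  have h2 := MvPolynomial.map_aeval (R := R) (fun i => (⟨y i, h_int i⟩ : integralClosure R E))
      ψ Q
  rw [h1, map_zero] at h2
  rw [← MvPolynomial.coe_eval₂Hom, h2]
  congr 2
  ext r
  exact (hψ r).symm

variable {y}

theorem aeval_comp_perm {τ : Equiv.Perm ι} {φ : E ≃ₐ[K] E} (hφ : ∀ i, φ (y i) = y (τ i))
    (Q : MvPolynomial ι R) :
    MvPolynomial.aeval (fun i => y (τ i)) Q = φ (MvPolynomial.aeval y Q) := by
  have h := MvPolynomial.map_aeval (R := R) y ((φ : E →ₐ[K] E).restrictScalars R : E →+* E) Q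
  have h2 : ((φ : E →ₐ[K] E).restrictScalars R : E →+* E).comp (algebraMap R E)
      = algebraMap R E := by
    ext r
    exact ((φ : E →ₐ[K] E).restrictScalars R).commutes r
  rw [h2] at h
  refine Eq.trans ?_ h.symm
  rw [MvPolynomial.aeval_def, MvPolynomial.coe_eval₂Hom]
  congr 1
  ext i
  exact (hφ i).symm

theorem IsSpec.comp_perm {b : R →+* ℂ} {μ : ι → ℂ} (h : IsSpec b y μ) {τ : Equiv.Perm ι}
    (hτ : τ ∈ autPerm K y) : IsSpec b y (fun i => μ (τ i)) := by
  obtain ⟨φ, hφ⟩ := hτ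
  intro Q hQ
  have h1 := h (MvPolynomial.rename τ Q) (by
    rw [MvPolynomial.aeval_rename]
    have := aeval_comp_perm hφ Q
    rw [hQ, map_zero] at this
    exact this)
  rw [MvPolynomial.eval₂_rename] at h1
  exact h1

section Galois
variable [Finite ι]

theorem exists_autPerm_of_algEquiv
    (hy : Function.Injective y) (hstab : ∀ (φ : E ≃ₐ[K] E) i, ∃ j, φ (y i) = y j)
    (φ : E ≃ₐ[K] E) :
    ∃ σ ∈ autPerm K y, ∀ i, φ (y i) = y (σ i) := by
  choose s hs using hstab φ
  have hsinj : Function.Injective s := by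
    intro i j hij
    apply hy
    apply φ.injective
    rw [hs, hs, hij]
  exact ⟨Equiv.ofBijective s (Finite.injective_iff_bijective.1 hsinj), ⟨φ, hs⟩, hs⟩

theorem isIntegral_aeval
    (h_int : ∀ i, IsIntegral R (y i))
    (Q : MvPolynomial ι R) (f : ι → ι) :
    IsIntegral R (MvPolynomial.aeval (fun i => y (f i)) Q) := by
  rw [MvPolynomial.aeval_def]
  induction Q using MvPolynomial.induction_on with
  | C r =>
    rw [MvPolynomial.eval₂_C]
    exact isIntegral_algebraMap
  | add p q hp hq =>
    rw [MvPolynomial.eval₂_add]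
    exact hp.add hq
  | mul_X p i hp =>
    rw [MvPolynomial.eval₂_mul, MvPolynomial.eval₂_X]
    exact hp.mul (h_int _)

theorem autPerm_le_of_sum_mem_range [Algebra ℂ E]
    (hy : Function.Injective y)
    (G' : Subgroup (Equiv.Perm ι))
    (S : Finset (Equiv.Perm ι)) (hS : ∀ σ, σ ∈ S ↔ σ ∈ G')
    (hC : ∀ (φ : E ≃ₐ[K] E) (a : ℂ), φ (algebraMap ℂ E a) = algebraMap ℂ E a)
    (h : ∀ H : MvPolynomial ι ℂ, ∃ k : K,
      algebraMap K E k = ∑ σ ∈ S, MvPolynomial.aeval (fun i => y (σ i)) H) :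
    autPerm K y ≤ G' := by
  rintro τ ⟨φ, hφ⟩
  have := mul_mem_of_sum_invariant y hy S τ ?_ 1 ((hS _).2 (one_mem _))
  · rwa [mul_one, hS] at this
  intro H
  obtain ⟨k, hk⟩ := h H
  rw [← hk, ← φ.commutes k, hk, map_sum]
  refine Finset.sum_congr rfl fun σ _ => ?_
  have h := MvPolynomial.map_aeval (R := ℂ) (fun i => y (σ i)) (φ : E →+* E) H
  have h2 : (φ : E →+* E).comp (algebraMap ℂ E) = algebraMap ℂ E := RingHom.ext (hC φ)
  rw [h2] at h
  refine Eq.trans h ?_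
  rw [MvPolynomial.aeval_def, MvPolynomial.coe_eval₂Hom]
  congr 1
  ext i
  exact hφ _

variable [IsIntegrallyClosed R] [IsFractionRing R K] [FiniteDimensional K E] [IsGalois K E]

open Classical in
theorem exists_sum_eq
    (hy : Function.Injective y) (h_int : ∀ i, IsIntegral R (y i))
    (hstab : ∀ (φ : E ≃ₐ[K] E) i, ∃ j, φ (y i) = y j)
    (S : Finset (Equiv.Perm ι)) (hS : ∀ σ, σ ∈ S ↔ σ ∈ autPerm K y)
    (Q : MvPolynomial ι R) :
    ∃ r : R, algebraMap R E r = ∑ τ ∈ S, MvPolynomial.aeval (fun i => y (τ i)) Q := by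
  apply exists_eq_algebraMap_of_fixed (K := K)
  · exact IsIntegral.sum _ fun τ _ => isIntegral_aeval h_int Q τ
  · intro φ
    obtain ⟨σ, hσ, hφ⟩ := exists_autPerm_of_algEquiv hy hstab φ
    rw [map_sum]
    refine Finset.sum_bij (fun τ _ => σ * τ) ?_ ?_ ?_ ?_
    · intro τ hτ
      exact (hS _).2 (mul_mem hσ ((hS _).1 hτ))
    · intro a _ b _ hab
      exact mul_left_cancel hab
    · intro τ hτ
      exact ⟨σ⁻¹ * τ, (hS _).2 (mul_mem (inv_mem hσ) ((hS _).1 hτ)), by simp⟩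
    · intro τ hτ
      have h1 := aeval_comp_perm hφ (MvPolynomial.rename τ Q)
      rw [MvPolynomial.aeval_rename, MvPolynomial.aeval_rename] at h1
      exact h1.symm

open Classical in
theorem exists_prod_eq
    (hy : Function.Injective y) (h_int : ∀ i, IsIntegral R (y i))
    (hstab : ∀ (φ : E ≃ₐ[K] E) i, ∃ j, φ (y i) = y j)
    (S : Finset (Equiv.Perm ι)) (hS : ∀ σ, σ ∈ S ↔ σ ∈ autPerm K y)
    (Q : MvPolynomial ι R) :
    ∃ r : R, algebraMap R E r = ∏ τ ∈ S, MvPolynomial.aeval (fun i => y (τ i)) Q := by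
  apply exists_eq_algebraMap_of_fixed (K := K)
  · exact IsIntegral.prod _ fun τ _ => isIntegral_aeval h_int Q τ
  · intro φ
    obtain ⟨σ, hσ, hφ⟩ := exists_autPerm_of_algEquiv hy hstab φ
    rw [map_prod]
    refine Finset.prod_bij (fun τ _ => σ * τ) ?_ ?_ ?_ ?_
    · intro τ hτ
      exact (hS _).2 (mul_mem hσ ((hS _).1 hτ))
    · intro a _ b _ hab
      exact mul_left_cancel hab
    · intro τ hτ
      exact ⟨σ⁻¹ * τ, (hS _).2 (mul_mem (inv_mem hσ) ((hS _).1 hτ)), by simp⟩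
    · intro τ hτ
      have h1 := aeval_comp_perm hφ (MvPolynomial.rename τ Q)
      rw [MvPolynomial.aeval_rename, MvPolynomial.aeval_rename] at h1
      exact h1.symm

/-- A relation that specializes to zero at sufficiently many points holds. -/
theorem aeval_eq_zero_of_isSpec
    (hy : Function.Injective y) (h_int : ∀ i, IsIntegral R (y i))
    (hstab : ∀ (φ : E ≃ₐ[K] E) i, ∃ j, φ (y i) = y j)
    (Q : MvPolynomial ι R) (B : Set (R →+* ℂ))
    (hB : ∀ r : R, (∀ b ∈ B, b r = 0) → r = 0)
    (h : ∀ b ∈ B, ∃ μ, IsSpec b y μ ∧ MvPolynomial.eval₂ b μ Q = 0) :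
    MvPolynomial.aeval y Q = 0 := by
  classical
  have := Fintype.ofFinite ι
  let S : Finset (Equiv.Perm ι) := Finset.univ.filter (· ∈ autPerm K y)
  have hS : ∀ σ, σ ∈ S ↔ σ ∈ autPerm K y := fun σ => by simp [S]
  obtain ⟨r, hr⟩ := exists_prod_eq hy h_int hstab S hS Q
  have hr0 : r = 0 := by
    apply hB
    intro b hb
    obtain ⟨μ, hμ, hQ⟩ := h b hb
    have := hμ (MvPolynomial.C r - ∏ τ ∈ S, MvPolynomial.rename τ Q) (by
      rw [map_sub, map_prod, MvPolynomial.algHom_C, hr, sub_eq_zero]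
      refine Finset.prod_congr rfl fun τ _ => ?_
      rw [MvPolynomial.aeval_rename]
      rfl)
    rw [MvPolynomial.eval₂_sub, MvPolynomial.eval₂_C, MvPolynomial.eval₂_prod,
      Finset.prod_eq_zero (i := 1) ((hS 1).2 (one_mem _)), sub_zero] at this
    · exact this
    · simpa using hQ
  rw [hr0, map_zero, eq_comm, Finset.prod_eq_zero_iff] at hr
  obtain ⟨τ, hτ, h0⟩ := hr
  obtain ⟨φ, hφ⟩ := (hS τ).1 hτ
  rw [aeval_comp_perm hφ] at h0
  exact (map_eq_zero_iff φ φ.injective).1 h0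

/-- Two injective specializations over the same point differ by a Galois permutation. -/
theorem mem_autPerm_of_isSpec [Algebra ℂ R]
    (hy : Function.Injective y) (h_int : ∀ i, IsIntegral R (y i))
    (hstab : ∀ (φ : E ≃ₐ[K] E) i, ∃ j, φ (y i) = y j)
    (b : R →ₐ[ℂ] ℂ) (μ : ι → ℂ)
    (hμ : Function.Injective μ) (σ : Equiv.Perm ι) (h1 : IsSpec (b : R →+* ℂ) y μ)
    (h2 : IsSpec (b : R →+* ℂ) y (fun i => μ (σ i))) : σ ∈ autPerm K y := by
  classical
  have := Fintype.ofFinite ι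
  let S : Finset (Equiv.Perm ι) := Finset.univ.filter (· ∈ autPerm K y)
  have hS : ∀ σ, σ ∈ S ↔ σ ∈ autPerm K y := fun σ => by simp [S]
  have key := mul_mem_of_sum_invariant μ hμ S σ ?_ 1 ((hS _).2 (one_mem _))
  · rw [mul_one, hS] at key
    exact key
  intro H
  obtain ⟨r, hr⟩ := exists_sum_eq hy h_int hstab S hS (MvPolynomial.map (algebraMap ℂ R) H)
  have hrel : MvPolynomial.aeval y (MvPolynomial.C r - ∑ τ ∈ S, MvPolynomial.rename τ
      (MvPolynomial.map (algebraMap ℂ R) H)) = 0 := by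
    rw [map_sub, map_sum, MvPolynomial.algHom_C, hr, sub_eq_zero]
    refine Finset.sum_congr rfl fun τ _ => ?_
    rw [MvPolynomial.aeval_rename]
    rfl
  have key : ∀ ν : ι → ℂ, IsSpec (b : R →+* ℂ) y ν →
      ∑ τ ∈ S, MvPolynomial.aeval (fun i => ν (τ i)) H = b r := by
    intro ν hν
    have := hν _ hrel
    rw [MvPolynomial.eval₂_sub, MvPolynomial.eval₂_C, MvPolynomial.eval₂_sum, sub_eq_zero] at this
    refine Eq.trans ?_ this.symm
    refine Finset.sum_congr rfl fun τ _ => ?_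
    rw [MvPolynomial.eval₂_rename, MvPolynomial.eval₂_map, MvPolynomial.aeval_def]
    congr 1
    ext x
    exact (b.commutes x).symm
  rw [key _ h1]
  exact (key _ h2).symm

/-- Specializations persist along continuous families of injective labelings. -/
theorem isSpec_of_path [Algebra ℂ R]
    (hy : Function.Injective y) (h_int : ∀ i, IsIntegral R (y i))
    (hstab : ∀ (φ : E ≃ₐ[K] E) i, ∃ j, φ (y i) = y j)
    {I : Type*} [TopologicalSpace I] [PreconnectedSpace I]
    (b : I → (R →ₐ[ℂ] ℂ)) (hb : ∀ r, Continuous fun s => b s r)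
    (μ : I → ι → ℂ) (hμ : Continuous μ) (hinj : ∀ s, Function.Injective (μ s))
    (hex : ∀ s, ∃ τ : Equiv.Perm ι, IsSpec (b s : R →+* ℂ) y (fun i => μ s (τ i)))
    (s₀ s₁ : I) (h0 : IsSpec (b s₀ : R →+* ℂ) y (μ s₀)) : IsSpec (b s₁ : R →+* ℂ) y (μ s₁) := by
  classical
  have := Fintype.ofFinite ι
  have hclosed : ∀ τ : Equiv.Perm ι,
      IsClosed {s | IsSpec (b s : R →+* ℂ) y (fun i => μ s (τ i))} := by
    intro τ
    simp only [IsSpec, Set.ofPred_forall]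
    refine isClosed_iInter fun Q => isClosed_iInter fun _ => ?_
    refine isClosed_eq ?_ continuous_const
    simp only [MvPolynomial.eval₂_eq]
    refine continuous_finsetSum _ fun d _ => (hb _).mul ?_
    refine continuous_finsetProd _ fun i _ => Continuous.pow ?_ _
    exact (continuous_apply (τ i)).comp hμ
  have hc1 := hclosed 1
  have hcompl : {s | IsSpec (b s : R →+* ℂ) y (fun i => μ s ((1 : Equiv.Perm ι) i))}ᶜ =
      ⋃ τ ∈ {τ : Equiv.Perm ι | τ ∉ autPerm K y},
        {s | IsSpec (b s : R →+* ℂ) y (fun i => μ s (τ i))} := by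
    ext s
    simp only [Set.mem_compl_iff, Set.mem_ofPred_eq, Set.mem_iUnion, exists_prop]
    constructor
    · intro hs
      obtain ⟨τ, hτ⟩ := hex s
      refine ⟨τ, fun hmem => hs ?_, hτ⟩
      have := hτ.comp_perm (inv_mem hmem)
      simpa using this
    · rintro ⟨τ, hτ, hs⟩ h1
      exact hτ (mem_autPerm_of_isSpec hy h_int hstab (b s) (μ s) (hinj s) τ h1 hs)
  have hopen : IsOpen {s | IsSpec (b s : R →+* ℂ) y (fun i => μ s ((1 : Equiv.Perm ι) i))} := by
    rw [← isClosed_compl_iff, hcompl]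
    exact Set.Finite.isClosed_biUnion (Set.toFinite _) fun τ _ => hclosed τ
  have huniv := IsClopen.eq_univ ⟨hc1, hopen⟩ ⟨s₀, h0⟩
  have : s₁ ∈ {s | IsSpec (b s : R →+* ℂ) y (fun i => μ s ((1 : Equiv.Perm ι) i))} := by
    rw [huniv]; trivial
  exact this

end Galois

/-- A specialization of the roots of `q` enumerates the roots of the specialization of `q`. -/
theorem IsSpec.map_eq_prod [Fintype ι] {b : R →+* ℂ} {μ : ι → ℂ} (h : IsSpec b y μ) (q : R[X])
    (hq : q.map (algebraMap R E) = ∏ i, (X - C (y i))) : q.map b = ∏ i, (X - C (μ i)) := by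
  let N : (MvPolynomial ι R)[X] := ∏ i, (X - C (MvPolynomial.X i))
  have h1 : N.map (MvPolynomial.aeval (R := R) y : MvPolynomial ι R →+* E)
      = ∏ i, (X - C (y i)) := by
    simp [N, Polynomial.map_prod]
  have h2 : N.map (MvPolynomial.eval₂Hom b μ) = ∏ i, (X - C (μ i)) := by
    simp [N, Polynomial.map_prod]
  ext k
  have := h (N.coeff k - MvPolynomial.C (q.coeff k)) (by
    rw [map_sub, MvPolynomial.algHom_C, sub_eq_zero]
    have := congrArg (fun p => p.coeff k) (h1.trans hq.symm)
    simpa [Polynomial.coeff_map] using this)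
  rw [MvPolynomial.eval₂_sub, MvPolynomial.eval₂_C, sub_eq_zero] at this
  rw [← h2, coeff_map, coeff_map, ← this]
  rfl

end Package

section Series
variable {A : Type*} [CommRing A] [IsDomain A] [Algebra ℂ A]

/-- Near `z = ∞` the solutions of `P(z) = s⁻ⁿ` are given by power series `u / s`. -/
theorem exists_series_roots (P : A[X]) (hP : P.Monic) (n : ℕ) (hn : P.natDegree = n) (hn0 : n ≠ 0) :
    ∃ u : Fin n → PowerSeries A,
      (∀ i j, PowerSeries.constantCoeff (u i) = PowerSeries.constantCoeff (u j) → i = j) ∧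
      (∀ i, ∃ ω : ℂ, PowerSeries.constantCoeff (u i) = algebraMap ℂ A ω) ∧
      ∀ i, ∑ k ∈ Finset.range (n + 1),
        PowerSeries.C (P.coeff k) * PowerSeries.X ^ (n - k) * u i ^ k = 1 := by
  let B := PowerSeries A
  have hζ := Complex.isPrimitiveRoot_exp n hn0
  set ζ := Complex.exp (2 * Real.pi * Complex.I / n)
  let r : B[X] := (∑ k ∈ Finset.range n,
    C (PowerSeries.C (P.coeff k) * PowerSeries.X ^ (n - k)) * X ^ k) - 1
  have hrdeg : r.degree < n := by
    refine lt_of_le_of_lt (degree_sub_le _ _) (max_lt ?_ ?_)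
    · refine lt_of_le_of_lt (degree_sum_le _ _) ?_
      rw [Finset.sup_lt_iff (by exact WithBot.bot_lt_coe n)]
      intro k hk
      exact lt_of_le_of_lt (degree_C_mul_X_pow_le _ _) (by exact_mod_cast Finset.mem_range.1 hk)
    · exact lt_of_le_of_lt degree_one_le (by exact_mod_cast Nat.pos_of_ne_zero hn0)
  let f : B[X] := X ^ n + r
  have hf : f.Monic := monic_X_pow_add hrdeg
  let I : Ideal B := Ideal.span {PowerSeries.X}
  have hI : ∀ x : B, x ∈ I ↔ PowerSeries.constantCoeff x = 0 := fun x => by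
    rw [Ideal.mem_span_singleton, PowerSeries.X_dvd_iff]
  let w : Fin n → ℂ := fun i => ζ ^ (i : ℕ)
  have hw : ∀ i, w i ^ n = 1 := fun i => by
    rw [← pow_mul, mul_comm, pow_mul, hζ.pow_eq_one, one_pow]
  have hw0 : ∀ i, w i ≠ 0 := fun i h => by
    have := hw i
    rw [h, zero_pow hn0] at this
    exact zero_ne_one this
  have hev : ∀ x : B, f.eval x = x ^ n + ((∑ k ∈ Finset.range n,
      PowerSeries.C (P.coeff k) * PowerSeries.X ^ (n - k) * x ^ k) - 1) := fun x => by
    simp [f, r, eval_finsetSum]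
  have hcc : ∀ x : B, PowerSeries.constantCoeff (f.eval x)
      = PowerSeries.constantCoeff x ^ n - 1 := fun x => by
    rw [hev, map_add, map_sub, map_sum, Finset.sum_eq_zero]
    · simp [sub_eq_add_neg]
    · intro k hk
      have : n - k ≠ 0 := by have := Finset.mem_range.1 hk; omega
      simp [this]
  have hex : ∀ i : Fin n, ∃ x : B, f.IsRoot x ∧
      x - PowerSeries.C (algebraMap ℂ A (w i)) ∈ I := by
    intro i
    apply HenselianRing.is_henselian f hf
    · rw [hI, hcc]
      simp [← map_pow, hw]
    · have hd : f.derivative.eval (PowerSeries.C (algebraMap ℂ A (w i))) -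
          PowerSeries.C (algebraMap ℂ A (n * w i ^ (n - 1))) ∈ I := by
        rw [hI]
        simp only [f, r, derivative_X_pow, derivative_one, sub_zero,
          eval_add, eval_finsetSum, map_sub, map_add, map_sum]
        rw [Finset.sum_eq_zero]
        · simp
        · intro k hk
          have : n - k ≠ 0 := by have := Finset.mem_range.1 hk; omega
          rw [derivative_C_mul, eval_mul, eval_C, map_mul, map_mul, map_pow,
            PowerSeries.constantCoeff_X, zero_pow this]
          simp
      rw [Ideal.Quotient.eq.2 hd]
      have hu : (n * w i ^ (n - 1) : ℂ) ≠ 0 :=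
        mul_ne_zero (by exact_mod_cast hn0) (pow_ne_zero _ (hw0 i))
      have := (((isUnit_iff_ne_zero.2 hu).map (algebraMap ℂ A)).map
        (PowerSeries.C (R := A))).map (Ideal.Quotient.mk I)
      exact this
  choose u hu1 hu2 using hex
  have hucc : ∀ i, PowerSeries.constantCoeff (u i) = algebraMap ℂ A (w i) := fun i => by
    have := (hI _).1 (hu2 i)
    rw [map_sub, sub_eq_zero] at this
    rw [this]
    simp
  refine ⟨u, fun i j hij => ?_, fun i => ⟨w i, hucc i⟩, fun i => ?_⟩
  · rw [hucc, hucc] at hij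
    have := (algebraMap ℂ A).injective hij
    exact Fin.ext (hζ.pow_inj i.2 j.2 this)
  · have h0 : f.eval (u i) = 0 := hu1 i
    rw [hev] at h0
    rw [Finset.sum_range_succ]
    have : P.coeff n = 1 := by rw [← hn]; exact hP
    rw [this]
    simp only [map_one, Nat.sub_self, pow_zero, one_mul]
    linear_combination h0

variable (A) in
abbrev SeriesField : Type _ := FractionRing (PowerSeries A)

variable (A) in
/-- The variable `s` in the field of fractions of `A⟦s⟧`. -/
def sVar : SeriesField A := algebraMap (PowerSeries A) (SeriesField A) PowerSeries.X

theorem sVar_ne_zero : sVar A ≠ 0 := by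
  rw [sVar, Ne, IsFractionRing.to_map_eq_zero_iff]
  exact PowerSeries.X_ne_zero

/-- The embedding of `A[t]` into `Frac A⟦s⟧` with `d t = s⁻ⁿ`. -/
def seriesHom (n : ℕ) (d : A) : A[X] →+* SeriesField A :=
  eval₂RingHom ((algebraMap (PowerSeries A) (SeriesField A)).comp PowerSeries.C)
    (algebraMap (PowerSeries A) (SeriesField A) (PowerSeries.C d * PowerSeries.X ^ n))⁻¹

theorem seriesHom_injective (n : ℕ) (hn : n ≠ 0) (d : A) (hd : d ≠ 0) :
    Function.Injective (seriesHom n d) := by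
  rw [injective_iff_map_eq_zero]
  intro r hr
  set v := PowerSeries.C d * PowerSeries.X ^ n
  have hv : algebraMap (PowerSeries A) (SeriesField A) v ≠ 0 := by
    rw [Ne, IsFractionRing.to_map_eq_zero_iff]
    exact mul_ne_zero ((map_ne_zero_iff _ PowerSeries.C_injective).2 hd)
      (pow_ne_zero _ PowerSeries.X_ne_zero)
  let φ := (algebraMap (PowerSeries A) (SeriesField A)).comp PowerSeries.C
  let := invertibleOfNonzero (inv_ne_zero hv)
  have h1 : eval₂ φ (⅟(algebraMap (PowerSeries A) (SeriesField A) v)⁻¹) (reverse r) = 0 :=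
    (eval₂_reverse_eq_zero_iff φ _ r).2 hr
  rw [invOf_eq_inv, inv_inv] at h1
  have h2 : eval₂ PowerSeries.C v (reverse r) = 0 := by
    apply IsFractionRing.injective (PowerSeries A) (SeriesField A)
    rw [map_zero, ← h1, hom_eval₂]
  have h3 := congrArg PowerSeries.constantCoeff h2
  rw [hom_eval₂, map_zero] at h3
  have h4 : PowerSeries.constantCoeff v = 0 := by simp [v, hn]
  rw [h4, eval₂_at_zero] at h3
  simpa [coeff_zero_reverse] using h3

end Series

theorem eq_prod_X_sub_C_of_roots {F : Type*} [CommRing F] [IsDomain F] {n : ℕ} (p : F[X]) (hp : p.Monic)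
    (hn : p.natDegree = n) (y : Fin n → F) (hy : Function.Injective y) (h : ∀ i, p.eval (y i) = 0) :
    p = ∏ i, (X - C (y i)) := by
  refine (eq_of_monic_of_dvd_of_natDegree_le (monic_prod_of_monic _ _ fun i _ => monic_X_sub_C _)
    hp ?_ ?_)
  · have h1 : ∏ i, (X - C (y i)) = (Finset.univ.val.map y |>.map fun a => X - C a).prod := by
      rw [Multiset.map_map]
      rfl
    rw [h1]
    apply Multiset.prod_X_sub_C_dvd_iff_le_roots hp.ne_zero _ |>.2
    refine (Multiset.le_iff_subset (Finset.univ.nodup.map hy)).2 fun x hx => ?_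
    obtain ⟨i, -, rfl⟩ := Multiset.mem_map.1 hx
    exact (mem_roots hp.ne_zero).2 (h i)
  · rw [natDegree_prod_of_monic _ _ fun i _ => monic_X_sub_C _, hn]
    simp

section Shift
variable {A : Type*} [CommRing A] [IsDomain A]

/-- The polynomial `P(Y) - d t` over `A[t]`. -/
def shiftPoly (P : A[X]) (d : A) : A[X][X] := P.map C - C (C d * X)

theorem shiftPoly_monic {P : A[X]} (hP : P.Monic) (h : P.natDegree ≠ 0) (d : A) :
    (shiftPoly P d).Monic := by
  refine (hP.map C).sub_of_left (lt_of_le_of_lt degree_C_le ?_)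
  rw [hP.degree_map, ← natDegree_pos_iff_degree_pos]
  exact Nat.pos_of_ne_zero h

theorem natDegree_shiftPoly (P : A[X]) (d : A) : (shiftPoly P d).natDegree = P.natDegree := by
  rw [shiftPoly, natDegree_sub_C, natDegree_map_eq_of_injective C_injective]

variable [Algebra ℂ A]

theorem eval_shiftPoly_series (P : A[X]) (d : A) (hd : d ≠ 0) (n : ℕ) (hn : P.natDegree = n)
    (u : PowerSeries A) (hu : ∑ k ∈ Finset.range (n + 1),
        PowerSeries.C (P.coeff k) * PowerSeries.X ^ (n - k) * u ^ k = 1) :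
    ((shiftPoly P d).map (seriesHom n d)).eval
      (algebraMap (PowerSeries A) (SeriesField A) u / sVar A) = 0 := by
  have hs := sVar_ne_zero (A := A)
  have hd' : algebraMap (PowerSeries A) (SeriesField A) (PowerSeries.C d) ≠ 0 := by
    rw [Ne, IsFractionRing.to_map_eq_zero_iff]
    exact (map_ne_zero_iff _ PowerSeries.C_injective).2 hd
  have h1 : (P.map C).map (seriesHom n d) =
      P.map ((algebraMap (PowerSeries A) (SeriesField A)).comp PowerSeries.C) := by
    rw [Polynomial.map_map]
    congr 1
    ext a
    simp [seriesHom]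
  rw [shiftPoly, Polynomial.map_sub, eval_sub, h1, map_C, eval_C, eval_map,
    eval₂_eq_sum_range, hn]
  have h2 : seriesHom n d (C d * X) = 1 / sVar A ^ n := by
    simp only [seriesHom, coe_eval₂RingHom, eval₂_C, eval₂_X, RingHom.comp_apply, map_mul,
      map_pow]
    rw [sVar]
    rw [sVar] at hs
    field_simp
  rw [h2, sub_eq_zero, eq_div_iff (pow_ne_zero _ hs), ← map_one (algebraMap (PowerSeries A) (SeriesField A)), ← hu,
    map_sum, Finset.sum_mul]
  refine Finset.sum_congr rfl fun k hk => ?_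
  have hk : k ≤ n := by have := Finset.mem_range.1 hk; omega
  simp only [map_mul, map_pow, RingHom.comp_apply, div_pow]
  rw [← sVar]
  obtain ⟨m, rfl⟩ := Nat.exists_eq_add_of_le hk
  rw [Nat.add_sub_cancel_left, pow_add]
  field_simp

theorem exists_series_embedding {K E : Type*} [Field K] [Algebra A[X] K] [IsFractionRing A[X] K]
    [Field E] [Algebra K E] [Algebra A[X] E] [IsScalarTower A[X] K E]
    (P : A[X]) (hP : P.Monic) (d : A) (hd : d ≠ 0) (n : ℕ) (hn : P.natDegree = n) (hn0 : n ≠ 0)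
    [hE : IsSplittingField K E ((shiftPoly P d).map (algebraMap A[X] K))]
    (u : Fin n → PowerSeries A)
    (huinj : Function.Injective u) 
    (hu : ∀ i, ∑ k ∈ Finset.range (n + 1),
        PowerSeries.C (P.coeff k) * PowerSeries.X ^ (n - k) * u i ^ k = 1) :
    ∃ (j : E →+* SeriesField A) (y : Fin n → E), Function.Injective y ∧
      (shiftPoly P d).map (algebraMap A[X] E) = ∏ i, (X - C (y i)) ∧
      (∀ r, j (algebraMap A[X] E r) = seriesHom n d r) ∧
      ∀ i, j (y i) = algebraMap (PowerSeries A) (SeriesField A) (u i) / sVar A := by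
  have hs := sVar_ne_zero (A := A)
  let j₀ : K →+* SeriesField A := IsFractionRing.lift (seriesHom_injective n hn0 d hd)
  have hj₀ : ∀ r, j₀ (algebraMap A[X] K r) = seriesHom n d r := fun r =>
    IsFractionRing.lift_algebraMap _ _
  let := j₀.toAlgebra
  have hmonic := shiftPoly_monic hP (hn ▸ hn0) d
  let v : Fin n → SeriesField A := fun i => algebraMap (PowerSeries A) (SeriesField A) (u i) / sVar A
  have hv : Function.Injective v := fun a b hab =>
    huinj (IsFractionRing.injective (PowerSeries A) (SeriesField A) ((div_left_inj' hs).1 hab))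
  have hsp : (shiftPoly P d).map (seriesHom n d) = ∏ i, (X - C (v i)) :=
    eq_prod_X_sub_C_of_roots _ (hmonic.map _)
      (by rw [hmonic.natDegree_map, natDegree_shiftPoly, hn]) v hv
      fun i => eval_shiftPoly_series P d hd n hn (u i) (hu i)
  have hmap : ((shiftPoly P d).map (algebraMap A[X] K)).map (algebraMap K (SeriesField A)) =
      (shiftPoly P d).map (seriesHom n d) := by
    rw [Polynomial.map_map]
    congr 1
    exact RingHom.ext hj₀
  let j : E →ₐ[K] SeriesField A := IsSplittingField.lift E ((shiftPoly P d).map (algebraMap A[X] K)) (by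
    rw [hmap, hsp]
    exact Splits.prod fun i _ => Splits.X_sub_C _)
  have hjr : ∀ r, j (algebraMap A[X] E r) = seriesHom n d r := fun r => by
    rw [IsScalarTower.algebraMap_apply A[X] K E, j.commutes]
    exact hj₀ r
  have hsplE : ((shiftPoly P d).map (algebraMap A[X] E)).Splits := by
    rw [IsScalarTower.algebraMap_eq A[X] K E, ← Polynomial.map_map]
    exact hE.splits
  have hroot : ∀ i, ∃ y : E, ((shiftPoly P d).map (algebraMap A[X] E)).eval y = 0 ∧ j y = v i := by
    intro i
    have h0 : (((shiftPoly P d).map (algebraMap A[X] E)).map (j : E →+* SeriesField A)).eval (v i) = 0 := by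
      have : ((shiftPoly P d).map (algebraMap A[X] E)).map (j : E →+* SeriesField A) =
          (shiftPoly P d).map (seriesHom n d) := by
        rw [Polynomial.map_map]
        congr 1
        exact RingHom.ext hjr
      rw [this]
      exact eval_shiftPoly_series P d hd n hn (u i) (hu i)
    have h1 := hsplE.eq_prod_roots_of_monic (hmonic.map _)
    rw [h1, Polynomial.map_multiset_prod, eval_multiset_prod, Multiset.prod_eq_zero_iff] at h0
    simp only [Multiset.map_map, Multiset.mem_map, Function.comp] at h0
    obtain ⟨y, hy, h2⟩ := h0
    refine ⟨y, (mem_roots (hmonic.map _).ne_zero).1 hy, ?_⟩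
    simp only [Polynomial.map_sub, map_X, map_C, eval_sub, eval_X, eval_C] at h2
    exact (sub_eq_zero.1 h2).symm
  choose y hy1 hy2 using hroot
  have hyinj : Function.Injective y := fun a b hab => hv (by rw [← hy2, ← hy2, hab])
  exact ⟨j, y, hyinj, eq_prod_X_sub_C_of_roots _ (hmonic.map _)
    (by rw [hmonic.natDegree_map, natDegree_shiftPoly, hn]) y hyinj hy1, hjr, hy2⟩

end Shift

section Homogenized
variable {A B : Type*} [CommRing A] [Algebra ℂ A] [CommRing B] [Algebra ℂ B] {n : ℕ}

/-- The numerator `s ^ D H(u / s)` of a polynomial evaluated at series with a simple pole. -/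
def homogenizedSeries (H : MvPolynomial (Fin n) ℂ) (D : ℕ) (u : Fin n → PowerSeries A) :
    PowerSeries A :=
  ∑ m ∈ H.support, PowerSeries.C (algebraMap ℂ A (H.coeff m)) * PowerSeries.X ^ (D - m.degree) *
    ∏ i, u i ^ m i

open Classical in
/-- The sum of `homogenizedSeries` over a permutation group. -/
def groupSeries (S : Finset (Equiv.Perm (Fin n))) (H : MvPolynomial (Fin n) ℂ)
    (u : Fin n → PowerSeries A) : PowerSeries A :=
  ∑ σ ∈ S, homogenizedSeries H (n * H.totalDegree) fun i => u (σ i)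

/-- All group sums of polynomials in `u / s` are polynomials in `s⁻ⁿ`. -/
def PolynomialSums (S : Finset (Equiv.Perm (Fin n))) (u : Fin n → PowerSeries A) : Prop :=
  ∀ (H : MvPolynomial (Fin n) ℂ) (m : ℕ), PowerSeries.coeff m (groupSeries S H u) ≠ 0 →
    ∃ k, m + n * k = n * H.totalDegree

theorem map_groupSeries (φ : A →ₐ[ℂ] B) (S : Finset (Equiv.Perm (Fin n)))
    (H : MvPolynomial (Fin n) ℂ) (u : Fin n → PowerSeries A) :
    PowerSeries.map (φ : A →+* B) (groupSeries S H u) =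
      groupSeries S H fun i => PowerSeries.map (φ : A →+* B) (u i) := by
  simp [groupSeries, homogenizedSeries, map_sum, map_prod]

variable [IsDomain A]

theorem algebraMap_homogenizedSeries (hn : n ≠ 0) (H : MvPolynomial (Fin n) ℂ) (u : Fin n → PowerSeries A) :
    algebraMap (PowerSeries A) (SeriesField A) (homogenizedSeries H (n * H.totalDegree) u) =
      sVar A ^ (n * H.totalDegree) * MvPolynomial.eval₂
        (((algebraMap (PowerSeries A) (SeriesField A)).comp PowerSeries.C).comp (algebraMap ℂ A))
        (fun i => algebraMap (PowerSeries A) (SeriesField A) (u i) / sVar A) H := by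
  have hs := sVar_ne_zero (A := A)
  rw [MvPolynomial.eval₂_eq', Finset.mul_sum, homogenizedSeries, map_sum]
  refine Finset.sum_congr rfl fun m hm => ?_
  have h1 : m.degree ≤ n * H.totalDegree := by
    refine le_trans ?_ (Nat.le_mul_of_pos_left _ (Nat.pos_of_ne_zero hn))
    exact MvPolynomial.le_totalDegree hm
  obtain ⟨e, he⟩ := Nat.exists_eq_add_of_le h1
  rw [he, Nat.add_sub_cancel_left]
  simp only [map_mul, map_prod, map_pow, RingHom.comp_apply, div_pow, Finset.prod_div_distrib]
  rw [Finset.prod_pow_eq_pow_sum, ← sVar, pow_add, ← Finsupp.degree_eq_sum]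
  field_simp

variable {E : Type*} [Field E] [Algebra ℂ E] [Algebra A[X] E] [IsScalarTower ℂ A[X] E]

theorem algebraMap_groupSeries (hn : n ≠ 0) (d : A) (j : E →+* SeriesField A)
    (hj : ∀ r, j (algebraMap A[X] E r) = seriesHom n d r) (y : Fin n → E)
    (u : Fin n → PowerSeries A)
    (hjy : ∀ i, j (y i) = algebraMap (PowerSeries A) (SeriesField A) (u i) / sVar A)
    (S : Finset (Equiv.Perm (Fin n))) (H : MvPolynomial (Fin n) ℂ) :
    algebraMap (PowerSeries A) (SeriesField A) (groupSeries S H u) =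
      sVar A ^ (n * H.totalDegree) * j (∑ σ ∈ S, MvPolynomial.aeval (fun i => y (σ i)) H) := by
  rw [groupSeries, map_sum, map_sum, Finset.mul_sum]
  refine Finset.sum_congr rfl fun σ _ => ?_
  rw [algebraMap_homogenizedSeries hn, MvPolynomial.aeval_def, MvPolynomial.hom_eval₂]
  congr 2
  · ext a
    rw [RingHom.comp_apply j, IsScalarTower.algebraMap_apply ℂ A[X] E, hj, Polynomial.algebraMap_apply]
    simp [seriesHom]
  · ext i
    exact (hjy _).symm

theorem seriesHom_eq_sum (d : A) (n : ℕ) (r : A[X]) (N : ℕ) (hN : r.natDegree ≤ N) (hd : d ≠ 0) :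
    seriesHom n d r * algebraMap (PowerSeries A) (SeriesField A) (PowerSeries.C d * PowerSeries.X ^ n) ^ N =
      algebraMap (PowerSeries A) (SeriesField A) (∑ k ∈ Finset.range (N + 1),
        PowerSeries.C (r.coeff k) * (PowerSeries.C d * PowerSeries.X ^ n) ^ (N - k)) := by
  have hv : algebraMap (PowerSeries A) (SeriesField A) (PowerSeries.C d * PowerSeries.X ^ n) ≠ 0 := by
    rw [Ne, IsFractionRing.to_map_eq_zero_iff]
    exact mul_ne_zero ((map_ne_zero_iff _ PowerSeries.C_injective).2 hd)
      (pow_ne_zero _ PowerSeries.X_ne_zero)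
  rw [seriesHom, coe_eval₂RingHom, eval₂_eq_sum_range' _ (Nat.lt_succ_of_le hN), map_sum,
    Finset.sum_mul]
  simp only [map_mul (algebraMap (PowerSeries A) (SeriesField A)) (PowerSeries.C (r.coeff _)),
    map_pow (algebraMap (PowerSeries A) (SeriesField A)) (PowerSeries.C d * PowerSeries.X ^ n)]
  generalize algebraMap (PowerSeries A) (SeriesField A) (PowerSeries.C d * PowerSeries.X ^ n) = v at *
  refine Finset.sum_congr rfl fun k hk => ?_
  obtain ⟨m, rfl⟩ := Nat.exists_eq_add_of_le (Nat.lt_succ_iff.1 (Finset.mem_range.1 hk))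
  rw [Nat.add_sub_cancel_left, RingHom.comp_apply, pow_add]
  field_simp
  rw [mul_assoc, ← mul_pow, one_div, inv_mul_cancel₀ hv, one_pow, mul_one]

theorem polynomialSums_of_eq (hn : n ≠ 0) (d : A) (hd : d ≠ 0) (j : E →+* SeriesField A)
    (hj : ∀ r, j (algebraMap A[X] E r) = seriesHom n d r) (y : Fin n → E)
    (u : Fin n → PowerSeries A)
    (hjy : ∀ i, j (y i) = algebraMap (PowerSeries A) (SeriesField A) (u i) / sVar A)
    (S : Finset (Equiv.Perm (Fin n)))
    (h : ∀ H : MvPolynomial (Fin n) ℂ, ∃ r : A[X],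
      algebraMap A[X] E r = ∑ σ ∈ S, MvPolynomial.aeval (fun i => y (σ i)) H) :
    PolynomialSums S u := by
  intro H m hm
  obtain ⟨r, hr⟩ := h H
  have h1 := algebraMap_groupSeries hn d j hj y u hjy S H
  rw [← hr, hj] at h1
  set D := n * H.totalDegree
  set N := r.natDegree
  set W := groupSeries S H u
  have h2 : W * (PowerSeries.C d * PowerSeries.X ^ n) ^ N = PowerSeries.X ^ D *
      ∑ k ∈ Finset.range (N + 1),
        PowerSeries.C (r.coeff k) * (PowerSeries.C d * PowerSeries.X ^ n) ^ (N - k) := by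
    apply IsFractionRing.injective (PowerSeries A) (SeriesField A)
    rw [map_mul, map_mul, ← seriesHom_eq_sum d n r N le_rfl hd, h1, map_pow, map_pow, ← sVar,
      mul_assoc]
  have h3 := congrArg (PowerSeries.coeff (m + n * N)) h2
  have h4 : W * (PowerSeries.C d * PowerSeries.X ^ n) ^ N =
      PowerSeries.C (d ^ N) * (W * PowerSeries.X ^ (n * N)) := by
    rw [mul_pow, ← pow_mul, map_pow]; ring
  rw [h4, PowerSeries.coeff_C_mul, PowerSeries.coeff_mul_X_pow] at h3
  have h5 : PowerSeries.coeff (m + n * N) (PowerSeries.X ^ D *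
      ∑ k ∈ Finset.range (N + 1),
        PowerSeries.C (r.coeff k) * (PowerSeries.C d * PowerSeries.X ^ n) ^ (N - k)) ≠ 0 := by
    rw [← h3]
    exact mul_ne_zero (pow_ne_zero _ hd) hm
  rw [Finset.mul_sum, map_sum] at h5
  obtain ⟨k, hk, h6⟩ := Finset.exists_ne_zero_of_sum_ne_zero h5
  have h7 : (PowerSeries.X : PowerSeries A) ^ D * (PowerSeries.C (r.coeff k) *
      (PowerSeries.C d * PowerSeries.X ^ n) ^ (N - k)) =
      PowerSeries.C (r.coeff k * d ^ (N - k)) * PowerSeries.X ^ (D + n * (N - k)) := by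
    rw [mul_pow, ← pow_mul, map_mul, map_pow, pow_add]; ring
  rw [h7, PowerSeries.coeff_C_mul, PowerSeries.coeff_X_pow] at h6
  have h8 : m + n * N = D + n * (N - k) := by
    by_contra h
    simp [h] at h6
  obtain ⟨e, he⟩ := Nat.exists_eq_add_of_le (Nat.lt_succ_iff.1 (Finset.mem_range.1 hk))
  rw [he, Nat.add_sub_cancel_left, mul_add] at h8
  exact ⟨k, by omega⟩

theorem PolynomialSums.exists_eq {S : Finset (Equiv.Perm (Fin n))}
    {u : Fin n → PowerSeries A} (h : PolynomialSums S u)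
    (hn : n ≠ 0) (d : A) (hd : d ≠ 0) (j : E →+* SeriesField A)
    (hj : ∀ r, j (algebraMap A[X] E r) = seriesHom n d r) (y : Fin n → E)
    (hjy : ∀ i, j (y i) = algebraMap (PowerSeries A) (SeriesField A) (u i) / sVar A)
    (H : MvPolynomial (Fin n) ℂ) : ∃ r : A[X],
      algebraMap A[X] E r = ∑ σ ∈ S, MvPolynomial.aeval (fun i => y (σ i)) H := by
  have hs := sVar_ne_zero (A := A)
  have h1 := algebraMap_groupSeries hn d j hj y u hjy S H
  have hW := h H
  set D := n * H.totalDegree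
  set N := H.totalDegree
  set W := groupSeries S H u
  let r : A[X] := ∑ k ∈ Finset.range (N + 1), C (PowerSeries.coeff (D - n * k) W * d ^ k) * X ^ k
  have hW2 : W = ∑ k ∈ Finset.range (N + 1),
      PowerSeries.C (PowerSeries.coeff (D - n * k) W) * PowerSeries.X ^ (D - n * k) := by
    ext m
    rw [map_sum]
    simp only [PowerSeries.coeff_C_mul, PowerSeries.coeff_X_pow, mul_ite, mul_one, mul_zero]
    by_cases hm : ∃ k, m + n * k = D
    · obtain ⟨k, hk⟩ := hm
      have hkN : k ≤ N := by
        refine Nat.le_of_mul_le_mul_left (?_ : n * k ≤ n * N) (Nat.pos_of_ne_zero hn)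
        have : D = n * N := rfl
        omega
      rw [Finset.sum_eq_single_of_mem k (Finset.mem_range.2 (Nat.lt_succ_of_le hkN))]
      · have : m = D - n * k := by omega
        rw [if_pos this, this]
      · intro l hl hlk
        rw [if_neg]
        intro h
        have hl' : n * l ≤ D := Nat.mul_le_mul_left n (Nat.lt_succ_iff.1 (Finset.mem_range.1 hl))
        exact hlk (Nat.eq_of_mul_eq_mul_left (Nat.pos_of_ne_zero hn) (by omega))
    · rw [Finset.sum_eq_zero]
      · by_contra h
        exact hm (hW m h)
      · intro l hl
        have hl' : n * l ≤ D := Nat.mul_le_mul_left n (Nat.lt_succ_iff.1 (Finset.mem_range.1 hl))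
        exact if_neg fun h => hm ⟨l, by omega⟩
  refine ⟨r, j.injective ?_⟩
  rw [hj]
  refine mul_left_cancel₀ (pow_ne_zero D hs) ?_
  rw [← h1, hW2, map_sum, map_sum, Finset.mul_sum]
  refine Finset.sum_congr rfl fun k hk => ?_
  have hk' : n * k ≤ D := Nat.mul_le_mul_left n (Nat.lt_succ_iff.1 (Finset.mem_range.1 hk))
  obtain ⟨e, he⟩ := Nat.exists_eq_add_of_le hk'
  have hd' : algebraMap (PowerSeries A) (SeriesField A) (PowerSeries.C d) ≠ 0 := by
    rw [Ne, IsFractionRing.to_map_eq_zero_iff]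
    exact (map_ne_zero_iff _ PowerSeries.C_injective).2 hd
  rw [seriesHom, coe_eval₂RingHom, eval₂_mul, eval₂_C, eval₂_X_pow, RingHom.comp_apply, he, Nat.add_sub_cancel_left]
  simp only [map_mul, map_pow]
  rw [← sVar, pow_add, pow_mul, inv_pow, mul_pow]
  field_simp

theorem PolynomialSums.of_infinite {S : Finset (Equiv.Perm (Fin n))}
    {u : Fin n → PowerSeries ℂ[X]} (T : Set ℂ) (hT : T.Infinite)
    (h : ∀ a ∈ T, PolynomialSums S fun i => PowerSeries.map (evalRingHom a) (u i)) :
    PolynomialSums S u := by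
  intro H m hm
  by_contra hk
  refine hm (eq_zero_of_infinite_isRoot _ (hT.mono fun a ha => ?_))
  by_contra h0
  refine hk (h a ha H m ?_)
  have h1 := map_groupSeries (aeval a : ℂ[X] →ₐ[ℂ] ℂ) S H u
  have h2 : ((aeval a : ℂ[X] →ₐ[ℂ] ℂ) : ℂ[X] →+* ℂ) = evalRingHom a := by
    ext <;> simp
  rw [h2] at h1
  rw [← h1, PowerSeries.coeff_map]
  exact h0

end Homogenized

section Labelled
variable {R K E : Type*} [CommRing R] [Field K] [Algebra R K]
  [Field E] [Algebra K E] [Algebra R E] [IsScalarTower R K E] {n : ℕ} {q : R[X]} {y : Fin n → E}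

theorem eval_eq_zero_iff_mem_range (h : q.map (algebraMap R E) = ∏ i, (X - C (y i))) (x : E) :
    (q.map (algebraMap R E)).eval x = 0 ↔ x ∈ Set.range y := by
  rw [h, eval_prod, Finset.prod_eq_zero_iff]
  simp only [Finset.mem_univ, true_and, eval_sub, eval_X, eval_C, sub_eq_zero, Set.mem_range]
  exact exists_congr fun i => eq_comm

theorem aeval_map_eq_zero_iff (h : q.map (algebraMap R E) = ∏ i, (X - C (y i))) (x : E) :
    aeval x (q.map (algebraMap R K)) = 0 ↔ x ∈ Set.range y := by
  rw [← eval_eq_zero_iff_mem_range h, aeval_map_algebraMap, eval_map_algebraMap]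

theorem isIntegral_root (hq : q.Monic) (h : q.map (algebraMap R E) = ∏ i, (X - C (y i))) (i : Fin n) :
    IsIntegral R (y i) :=
  ⟨q, hq, by rw [← eval_map]; exact (eval_eq_zero_iff_mem_range h _).2 ⟨i, rfl⟩⟩

theorem exists_algEquiv_root (h : q.map (algebraMap R E) = ∏ i, (X - C (y i)))
    (φ : E ≃ₐ[K] E) (i : Fin n) : ∃ j, φ (y i) = y j := by
  have h1 := (aeval_map_eq_zero_iff (K := K) h (y i)).2 ⟨i, rfl⟩
  have h2 := congrArg φ h1
  rw [map_zero, ← aeval_algHom_apply, aeval_map_eq_zero_iff h] at h2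
  obtain ⟨j, hj⟩ := h2
  exact ⟨j, hj.symm⟩

theorem adjoin_range_eq_top (hq : q.Monic) [hE : IsSplittingField K E (q.map (algebraMap R K))]
    (h : q.map (algebraMap R E) = ∏ i, (X - C (y i))) : Algebra.adjoin K (Set.range y) = ⊤ := by
  rw [← hE.adjoin_rootSet]
  congr 1
  ext x
  rw [mem_rootSet, aeval_map_eq_zero_iff h]
  exact ⟨fun h => ⟨(hq.map _).ne_zero, h⟩, fun h => h.2⟩

theorem card_autPerm (hq : q.Monic) [hE : IsSplittingField K E (q.map (algebraMap R K))]
    (hy : Function.Injective y)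
    (h : q.map (algebraMap R E) = ∏ i, (X - C (y i))) :
    Nat.card (autPerm K y) = Nat.card (E ≃ₐ[K] E) := by
  obtain ⟨e⟩ := exists_autPerm_equiv y hy (adjoin_range_eq_top hq h) _ (aeval_map_eq_zero_iff (K := K) h)
  exact Nat.card_congr e.toEquiv

end Labelled

theorem isGalois_of_isSplittingField {K E : Type*} [Field K] [CharZero K] [Field E] [Algebra K E]
    (p : K[X]) [IsSplittingField K E p] : IsGalois K E := by
  have := Normal.of_isSplittingField (E := E) p
  exact { }

/-- The splitting field of `P(Y) - d t` over `ℂ(t)`. -/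
abbrev SliceField (P : ℂ[X]) (d : ℂ) : Type :=
  SplittingField ((shiftPoly P d).map (algebraMap ℂ[X] (FractionRing ℂ[X])))

instance (P : ℂ[X]) (d : ℂ) : IsScalarTower ℂ ℂ[X] (SliceField P d) := by
  refine IsScalarTower.of_algebraMap_eq fun a => ?_
  rw [IsScalarTower.algebraMap_apply ℂ (FractionRing ℂ[X]) (SliceField P d),
    IsScalarTower.algebraMap_apply ℂ[X] (FractionRing ℂ[X]) (SliceField P d),
    ← IsScalarTower.algebraMap_apply ℂ ℂ[X] (FractionRing ℂ[X])]

open Classical in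
theorem finite_card_slice_lt {K E : Type*} [Field K] [Algebra ℂ[X][X] K] [IsFractionRing ℂ[X][X] K]
    [Field E] [Algebra K E] [Algebra ℂ[X][X] E] [IsScalarTower ℂ[X][X] K E]
    (P : ℂ[X][X]) (hP : P.Monic) (d : ℂ[X]) (hd : d ≠ 0) (hn0 : P.natDegree ≠ 0)
    [hE : IsSplittingField K E ((shiftPoly P d).map (algebraMap ℂ[X][X] K))] :
    {a : ℂ | d.eval a ≠ 0 ∧ Nat.card (SliceField (P.map (evalRingHom a)) (d.eval a)
      ≃ₐ[FractionRing ℂ[X]] SliceField (P.map (evalRingHom a)) (d.eval a)) <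
      Nat.card (E ≃ₐ[K] E)}.Finite := by
  obtain ⟨n, hn⟩ : ∃ n, P.natDegree = n := ⟨_, rfl⟩
  rw [hn] at hn0
  obtain ⟨u, hu1, ⟨hu2, hu3⟩⟩ := exists_series_roots P hP n hn hn0
  have huinj : Function.Injective u := fun i j hij => hu1 i j (by rw [hij])
  let := ((algebraMap ℂ[X][X] E).comp (algebraMap ℂ ℂ[X][X])).toAlgebra
  have : IsScalarTower ℂ ℂ[X][X] E := IsScalarTower.of_algebraMap_eq fun a => rfl
  obtain ⟨j, y, hy, hprod, hj, hjy⟩ := exists_series_embedding (K := K) (E := E) P hP d hd n hn hn0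
    u huinj hu3
  by_contra hinf
  set T := {a : ℂ | d.eval a ≠ 0 ∧ Nat.card (SliceField (P.map (evalRingHom a)) (d.eval a)
      ≃ₐ[FractionRing ℂ[X]] SliceField (P.map (evalRingHom a)) (d.eval a)) <
      Nat.card (E ≃ₐ[K] E)}
  have hT : T.Infinite := hinf
  have hslice : ∀ a ∈ T, ∃ G : Subgroup (Equiv.Perm (Fin n)), Nat.card G < Nat.card (E ≃ₐ[K] E) ∧
      PolynomialSums (Finset.univ.filter (· ∈ G)) fun i => PowerSeries.map (evalRingHom a) (u i) := by
    rintro a ⟨ha, hcard⟩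
    have hPa : (P.map (evalRingHom a)).Monic := hP.map _
    have hna : (P.map (evalRingHom a)).natDegree = n := by rw [hP.natDegree_map, hn]
    let ua : Fin n → PowerSeries ℂ := fun i => PowerSeries.map (evalRingHom a) (u i)
    have huainj : Function.Injective ua := by
      intro i k hik
      apply hu1
      obtain ⟨w, hw⟩ := hu2 i
      obtain ⟨w', hw'⟩ := hu2 k
      have := congrArg (PowerSeries.coeff 0) hik
      simp only [ua, PowerSeries.coeff_map, PowerSeries.coeff_zero_eq_constantCoeff_apply, hw, hw',
        Polynomial.algebraMap_apply, coe_evalRingHom, eval_C] at this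
      rw [hw, hw']
      simpa using this
    have hua : ∀ i, ∑ k ∈ Finset.range (n + 1), PowerSeries.C ((P.map (evalRingHom a)).coeff k) *
        PowerSeries.X ^ (n - k) * ua i ^ k = 1 := by
      intro i
      have := congrArg (PowerSeries.map (evalRingHom a)) (hu3 i)
      simpa [map_sum] using this
    obtain ⟨ja, ya, hya, hproda, hja, hjya⟩ := exists_series_embedding (K := FractionRing ℂ[X])
      (E := SliceField (P.map (evalRingHom a)) (d.eval a)) _ hPa (d.eval a) ha n hna hn0 ua huainj hua
    have hmon := shiftPoly_monic hPa (hna ▸ hn0) (d.eval a)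
    have := isGalois_of_isSplittingField (K := FractionRing ℂ[X])
      (E := SliceField (P.map (evalRingHom a)) (d.eval a))
      ((shiftPoly (P.map (evalRingHom a)) (d.eval a)).map (algebraMap ℂ[X] (FractionRing ℂ[X])))
    refine ⟨autPerm (FractionRing ℂ[X]) ya, ?_, ?_⟩
    · rwa [card_autPerm hmon hya hproda]
    · refine polynomialSums_of_eq hn0 (d.eval a) ha ja hja ya ua hjya _ fun H => ?_
      obtain ⟨r, hr⟩ := exists_sum_eq (K := FractionRing ℂ[X]) hya
        (isIntegral_root hmon hproda) (exists_algEquiv_root hproda)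
        (Finset.univ.filter (· ∈ autPerm (FractionRing ℂ[X]) ya)) (by simp)
        (MvPolynomial.map (algebraMap ℂ ℂ[X]) H)
      refine ⟨r, hr.trans (Finset.sum_congr rfl fun σ _ => ?_)⟩
      rw [MvPolynomial.aeval_map_algebraMap]
  choose! G hG1 hG2 using hslice
  obtain ⟨G', hG'⟩ : ∃ G', (T ∩ G ⁻¹' {G'}).Infinite := by
    by_contra h
    push Not at h
    refine hT ((Set.finite_iUnion h).subset fun a ha => ?_)
    exact Set.mem_iUnion.2 ⟨G a, ha, rfl⟩
  have hsums : PolynomialSums (Finset.univ.filter (· ∈ G')) u := by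
    refine PolynomialSums.of_infinite _ hG' ?_
    rintro a ⟨ha, rfl⟩
    exact hG2 a ha
  have hle : autPerm K y ≤ G' := by
    refine autPerm_le_of_sum_mem_range hy G' (Finset.univ.filter (· ∈ G')) (by simp) ?_ fun H => ?_
    · intro φ a
      rw [IsScalarTower.algebraMap_apply ℂ ℂ[X][X] E, IsScalarTower.algebraMap_apply ℂ[X][X] K E,
        φ.commutes]
    · obtain ⟨r, hr⟩ := hsums.exists_eq hn0 d hd j hj y hjy H
      exact ⟨algebraMap _ K r, by rw [← hr, ← IsScalarTower.algebraMap_apply]⟩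
  obtain ⟨a, ha, hGa⟩ := hG'.nonempty
  have h1 := hG1 a ha
  rw [show G a = G' from hGa, ← card_autPerm (shiftPoly_monic hP (hn ▸ hn0) d) hy hprod] at h1
  exact absurd (Nat.card_le_card_of_injective _ (Subgroup.inclusion_injective hle)) (not_le.2 h1)

section Labellings

/-- The polynomial `f + ε g - t`. -/
def fibPoly (f g : ℂ[X]) (b : ℂ × ℂ) : ℂ[X] := f + C b.2 * g - C b.1

/-- A labelling `μ` of the `n` points of the fiber over `b = (t, ε)`. -/
structure IsLab (f g : ℂ[X]) (b : ℂ × ℂ) (μ : Fin (defDeg f g) → ℂ) : Prop where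
  lead : leadC f g b.2 ≠ 0
  inj : Function.Injective μ
  root : ∀ i, f.eval (μ i) + b.2 * g.eval (μ i) = b.1

variable {f g : ℂ[X]} {b : ℂ × ℂ} {μ : Fin (defDeg f g) → ℂ}

theorem eval_fibPoly (w : ℂ) : (fibPoly f g b).eval w = f.eval w + b.2 * g.eval w - b.1 := by
  simp [fibPoly]

theorem eval_derivative_fibPoly (w : ℂ) :
    (fibPoly f g b).derivative.eval w = f.derivative.eval w + b.2 * g.derivative.eval w := by
  simp [fibPoly]

theorem coeff_fibPoly (hn : defDeg f g ≠ 0) :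
    (fibPoly f g b).coeff (defDeg f g) = leadC f g b.2 := by
  simp [fibPoly, leadC, coeff_C, hn]

theorem natDegree_fibPoly_le : (fibPoly f g b).natDegree ≤ defDeg f g := by
  refine (natDegree_sub_le _ _).trans (max_le ?_ (by simp))
  refine (natDegree_add_le _ _).trans (max_le (le_max_left _ _) ?_)
  exact (natDegree_C_mul_le _ _).trans (le_max_right _ _)

theorem natDegree_fibPoly (hn : defDeg f g ≠ 0) (hc : leadC f g b.2 ≠ 0) :
    (fibPoly f g b).natDegree = defDeg f g :=
  natDegree_eq_of_le_of_coeff_ne_zero natDegree_fibPoly_le (by rwa [coeff_fibPoly hn])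

theorem leadingCoeff_fibPoly (hn : defDeg f g ≠ 0) (hc : leadC f g b.2 ≠ 0) :
    (fibPoly f g b).leadingCoeff = leadC f g b.2 := by
  rw [leadingCoeff, natDegree_fibPoly hn hc, coeff_fibPoly hn]

theorem IsLab.fibPoly_eq (h : IsLab f g b μ) (hn : defDeg f g ≠ 0) :
    fibPoly f g b = C (leadC f g b.2) * ∏ i, (X - C (μ i)) := by
  have hc := h.lead
  have h1 : C (leadC f g b.2)⁻¹ * fibPoly f g b = ∏ i, (X - C (μ i)) := by
    apply eq_prod_X_sub_C_of_roots _ _ _ μ h.inj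
    · intro i
      rw [eval_mul, eval_fibPoly, h.root, sub_self, mul_zero]
    · rw [Monic, leadingCoeff_mul, leadingCoeff_C, leadingCoeff_fibPoly hn hc, inv_mul_cancel₀ hc]
    · rw [natDegree_C_mul (inv_ne_zero hc), natDegree_fibPoly hn hc]
  rw [← h1, ← mul_assoc, ← C_mul, mul_inv_cancel₀ hc, C_1, one_mul]

theorem IsLab.exists_eq (h : IsLab f g b μ) (hn : defDeg f g ≠ 0) {w : ℂ}
    (hw : f.eval w + b.2 * g.eval w = b.1) : ∃ i, μ i = w := by
  have h1 : (fibPoly f g b).eval w = 0 := by rw [eval_fibPoly, hw, sub_self]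
  rw [h.fibPoly_eq hn, eval_mul, eval_C, eval_prod] at h1
  obtain ⟨i, -, hi⟩ := Finset.prod_eq_zero_iff.1 ((mul_eq_zero.1 h1).resolve_left h.lead)
  refine ⟨i, ?_⟩
  simpa [sub_eq_zero, eq_comm] using hi

theorem IsLab.derivative_ne_zero (h : IsLab f g b μ) (hn : defDeg f g ≠ 0) (i : Fin (defDeg f g)) :
    f.derivative.eval (μ i) + b.2 * g.derivative.eval (μ i) ≠ 0 := by
  rw [← eval_derivative_fibPoly, h.fibPoly_eq hn, derivative_C_mul, eval_mul, eval_C]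
  refine mul_ne_zero h.lead ?_
  have hs : (∏ i, (X - C (μ i))).Separable := separable_prod_X_sub_C_iff.2 h.inj
  exact hs.eval₂_derivative_ne_zero (RingHom.id ℂ) (by
    rw [← eval, eval_prod]
    exact Finset.prod_eq_zero (Finset.mem_univ i) (by simp))

theorem IsLab.notMem_sigmaFin (h : IsLab f g b μ) (hn : defDeg f g ≠ 0) : b ∉ sigmaFin f g := by
  rintro (hc | ⟨w, hw, hw'⟩)
  · exact h.lead hc
  · obtain ⟨i, rfl⟩ := h.exists_eq hn hw
    exact h.derivative_ne_zero hn i hw'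

theorem exists_isLab (hn : defDeg f g ≠ 0) (hb : b ∉ sigmaFin f g) : ∃ μ, IsLab f g b μ := by
  have hc : leadC f g b.2 ≠ 0 := fun h => hb (Or.inl h)
  have hne : fibPoly f g b ≠ 0 := fun h => hn (by rw [← natDegree_fibPoly hn hc, h, natDegree_zero])
  have hnd : (fibPoly f g b).roots.Nodup := by
    rw [Multiset.nodup_iff_count_le_one]
    intro w
    rw [count_roots]
    by_contra hlt
    have h1 := (one_lt_rootMultiplicity_iff_isRoot hne).1 (not_le.1 hlt)
    refine hb (Or.inr ⟨w, ?_, ?_⟩)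
    · have := h1.1
      rwa [IsRoot, eval_fibPoly, sub_eq_zero] at this
    · rw [← eval_derivative_fibPoly (b := b)]
      exact h1.2
  have hcard : (fibPoly f g b).roots.toFinset.card = defDeg f g := by
    rw [Multiset.toFinset_card_of_nodup hnd, ← natDegree_fibPoly hn hc]
    exact (IsAlgClosed.splits _).natDegree_eq_card_roots.symm
  let e := (Finset.equivFinOfCardEq hcard).symm
  refine ⟨fun i => e i, hc, fun i j hij => e.injective (Subtype.ext hij), fun i => ?_⟩
  have := (mem_roots hne).1 (Multiset.mem_toFinset.1 (e i).2)
  rwa [IsRoot, eval_fibPoly, sub_eq_zero] at this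

theorem IsLab.comp_perm (h : IsLab f g b μ) (σ : Equiv.Perm (Fin (defDeg f g))) :
    IsLab f g b fun i => μ (σ i) :=
  ⟨h.lead, h.inj.comp σ.injective, fun _ => h.root _⟩

theorem IsLab.exists_perm (h : IsLab f g b μ) (hn : defDeg f g ≠ 0) {ν : Fin (defDeg f g) → ℂ}
    (h' : IsLab f g b ν) : ∃ σ : Equiv.Perm (Fin (defDeg f g)), ν = fun i => μ (σ i) := by
  choose s hs using fun i => h.exists_eq hn (h'.root i)
  have hinj : Function.Injective s := fun i j hij => h'.inj (by rw [← hs, ← hs, hij])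
  exact ⟨Equiv.ofBijective s (Finite.injective_iff_bijective.1 hinj), funext fun i => (hs i).symm⟩

end Labellings

section Covering

/-- The map `H(z, ε) = (f(z) + ε g(z), ε)`. -/
def defMap (f g : ℂ[X]) (x : ℂ × ℂ) : ℂ × ℂ := (f.eval x.1 + x.2 * g.eval x.1, x.2)

variable {f g : ℂ[X]}

theorem continuous_defMap : Continuous (defMap f g) := by
  unfold defMap
  have := f.continuous
  have := g.continuous
  fun_prop

theorem continuous_leadC : Continuous (leadC f g) := by
  unfold leadC
  fun_prop

theorem exists_openPartialHomeomorph (w ε : ℂ)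
    (h : f.derivative.eval w + ε * g.derivative.eval w ≠ 0) :
    ∃ φ : OpenPartialHomeomorph (ℂ × ℂ) (ℂ × ℂ), (w, ε) ∈ φ.source ∧ ⇑φ = defMap f g := by
  set a := f.derivative.eval w + ε * g.derivative.eval w
  let L : (ℂ × ℂ) ≃L[ℂ] (ℂ × ℂ) := ContinuousLinearEquiv.equivOfInverse
    (((a • ContinuousLinearMap.fst ℂ ℂ ℂ) + (g.eval w • ContinuousLinearMap.snd ℂ ℂ ℂ)).prod
      (ContinuousLinearMap.snd ℂ ℂ ℂ))
    (((a⁻¹ • ContinuousLinearMap.fst ℂ ℂ ℂ) - ((a⁻¹ * g.eval w) • ContinuousLinearMap.snd ℂ ℂ ℂ)).prod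
      (ContinuousLinearMap.snd ℂ ℂ ℂ))
    (fun x => by ext <;> simp; field_simp; ring)
    (fun x => by ext <;> simp; field_simp; ring)
  have hF : HasStrictFDerivAt (defMap f g) (L : (ℂ × ℂ) →L[ℂ] ℂ × ℂ) (w, ε) := by
    have h1 : HasStrictFDerivAt (fun x : ℂ × ℂ => f.eval x.1)
        (f.derivative.eval w • ContinuousLinearMap.fst ℂ ℂ ℂ) (w, ε) := by
      have h := (f.hasStrictDerivAt w).comp_hasStrictFDerivAt (w, ε)
        (hasStrictFDerivAt_fst (𝕜 := ℂ) (p := ((w, ε) : ℂ × ℂ)))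
      exact h
    have h2 : HasStrictFDerivAt (fun x : ℂ × ℂ => g.eval x.1)
        (g.derivative.eval w • ContinuousLinearMap.fst ℂ ℂ ℂ) (w, ε) := by
      have h := (g.hasStrictDerivAt w).comp_hasStrictFDerivAt (w, ε)
        (hasStrictFDerivAt_fst (𝕜 := ℂ) (p := ((w, ε) : ℂ × ℂ)))
      exact h
    have h3 := (h1.add (hasStrictFDerivAt_snd.mul h2)).prodMk
      (hasStrictFDerivAt_snd (𝕜 := ℂ) (p := ((w, ε) : ℂ × ℂ)))
    refine h3.congr_fderiv ?_
    ext <;> simp [L, a]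
  exact ⟨hF.toOpenPartialHomeomorph _, hF.mem_toOpenPartialHomeomorph_source,
    hF.toOpenPartialHomeomorph_coe⟩

open Topology Filter in
theorem IsLab.exists_local_section {b : ℂ × ℂ} {μ : Fin (defDeg f g) → ℂ} (h : IsLab f g b μ)
    (hn : defDeg f g ≠ 0) :
    ∃ ζ : ℂ × ℂ → Fin (defDeg f g) → ℂ, ζ b = μ ∧
      ∀ᶠ x in 𝓝 b, ContinuousAt ζ x ∧ IsLab f g x (ζ x) := by
  choose φ hφ1 hφ2 using fun i => exists_openPartialHomeomorph _ _ (h.derivative_ne_zero hn i)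
  have hb : ∀ i, b = φ i (μ i, b.2) := fun i => by
    rw [hφ2, defMap]
    exact Prod.ext (h.root i).symm rfl
  have hbt : ∀ i, b ∈ (φ i).target := fun i => by
    have := (φ i).map_source (hφ1 i)
    rwa [← hb i] at this
  let ζ : ℂ × ℂ → Fin (defDeg f g) → ℂ := fun x i => ((φ i).symm x).1
  have hζb : ζ b = μ := funext fun i => by
    have h1 : (φ i).symm b = (μ i, b.2) := by
      conv_lhs => rw [hb i]
      exact (φ i).left_inv (hφ1 i)
    simp only [ζ, h1]
  have h1 : ∀ᶠ x in 𝓝 b, ∀ i, x ∈ (φ i).target :=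
    eventually_all.2 fun i => (φ i).open_target.mem_nhds (hbt i)
  have hcont : ∀ x, (∀ i, x ∈ (φ i).target) → ContinuousAt ζ x := fun x hx =>
    continuousAt_pi.2 fun i => continuous_fst.continuousAt.comp ((φ i).continuousAt_symm (hx i))
  have h2 : ∀ᶠ x in 𝓝 b, leadC f g x.2 ≠ 0 :=
    (continuous_leadC.comp continuous_snd).continuousAt.eventually_ne h.lead
  have h3 : ∀ᶠ x in 𝓝 b, ∀ i j, i ≠ j → ζ x i ≠ ζ x j := by
    refine eventually_all.2 fun i => eventually_all.2 fun j => ?_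
    by_cases hij : i = j
    · exact Eventually.of_forall fun _ h => absurd hij h
    · have hc := hcont b hbt
      have h4 : ContinuousAt (fun x => ζ x i - ζ x j) b :=
        (continuousAt_pi.1 hc i).sub (continuousAt_pi.1 hc j)
      have h5 : ζ b i - ζ b j ≠ 0 := by
        rw [hζb]
        exact sub_ne_zero.2 fun h' => hij (h.inj h')
      filter_upwards [h4.eventually_ne h5] with x hx _
      exact sub_ne_zero.1 hx
  refine ⟨ζ, hζb, ?_⟩
  filter_upwards [h1, h2, h3] with x hx1 hx2 hx3
  refine ⟨hcont x hx1, hx2, fun i j hij => by_contra fun hne => hx3 i j hne hij, fun i => ?_⟩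
  have h4 := (φ i).right_inv (hx1 i)
  rw [hφ2] at h4
  have h5 := congrArg Prod.fst h4
  have h6 := congrArg Prod.snd h4
  simp only [defMap] at h5 h6
  rw [h6] at h5
  exact h5

theorem isOpen_compl_sigmaFin (hn : defDeg f g ≠ 0) : IsOpen (sigmaFin f g)ᶜ := by
  rw [isOpen_iff_mem_nhds]
  intro b hb
  obtain ⟨μ, hμ⟩ := exists_isLab hn hb
  obtain ⟨ζ, -, h⟩ := hμ.exists_local_section hn
  filter_upwards [h] with x hx
  exact hx.2.notMem_sigmaFin hn

/-- A bound for the points of the fiber. -/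
def fibBound (f g : ℂ[X]) (b : ℂ × ℂ) : ℝ :=
  1 + (∑ k ∈ Finset.range (defDeg f g), (‖f.coeff k‖ + ‖b.2‖ * ‖g.coeff k‖) + ‖b.1‖) / ‖leadC f g b.2‖

theorem norm_le_fibBound (hn : defDeg f g ≠ 0) {b : ℂ × ℂ} (hc : leadC f g b.2 ≠ 0) {w : ℂ}
    (hw : f.eval w + b.2 * g.eval w = b.1) : ‖w‖ ≤ fibBound f g b := by
  have hc' : 0 < ‖leadC f g b.2‖ := norm_pos_iff.2 hc
  set S := ∑ k ∈ Finset.range (defDeg f g), (‖f.coeff k‖ + ‖b.2‖ * ‖g.coeff k‖)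
  have hS : 0 ≤ S := Finset.sum_nonneg fun k _ => by positivity
  rw [fibBound]
  rcases le_total ‖w‖ 1 with h1 | h1
  · have : 0 ≤ (S + ‖b.1‖) / ‖leadC f g b.2‖ := by positivity
    linarith
  obtain ⟨m, hm⟩ := Nat.exists_eq_succ_of_ne_zero hn
  have h2 : leadC f g b.2 * w ^ (m + 1) = b.1 - ∑ k ∈ Finset.range (defDeg f g),
      (f.coeff k + b.2 * g.coeff k) * w ^ k := by
    rw [← hw, eval_eq_sum_range' (lt_of_le_of_lt (le_max_left _ _) (Nat.lt_succ_self (defDeg f g))),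
      eval_eq_sum_range' (lt_of_le_of_lt (le_max_right f.natDegree _) (Nat.lt_succ_self (defDeg f g))),
      Finset.sum_range_succ, Finset.sum_range_succ]
    simp only [add_mul, Finset.sum_add_distrib, mul_assoc, ← Finset.mul_sum, leadC]
    rw [← Nat.succ_eq_add_one, ← hm]
    ring
  have h3 : ‖leadC f g b.2‖ * ‖w‖ ^ (m + 1) ≤ (S + ‖b.1‖) * ‖w‖ ^ m := by
    rw [← norm_pow, ← norm_mul, h2]
    refine (norm_sub_le _ _).trans ?_
    have h4 : ‖∑ k ∈ Finset.range (defDeg f g), (f.coeff k + b.2 * g.coeff k) * w ^ k‖ ≤ S * ‖w‖ ^ m := by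
      rw [Finset.sum_mul]
      refine norm_sum_le_of_le _ fun k hk => ?_
      rw [norm_mul, norm_pow]
      have hk : k ≤ m := by have := Finset.mem_range.1 hk; omega
      refine mul_le_mul ((norm_add_le _ _).trans (by rw [norm_mul])) (pow_le_pow_right₀ h1 hk)
        (by positivity) (by positivity)
    have h5 : ‖b.1‖ ≤ ‖b.1‖ * ‖w‖ ^ m := le_mul_of_one_le_right (norm_nonneg _) (one_le_pow₀ h1)
    linarith
  have h6 : ‖leadC f g b.2‖ * ‖w‖ ≤ S + ‖b.1‖ := by
    refine le_of_mul_le_mul_right ?_ (pow_pos (lt_of_lt_of_le one_pos h1) m)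
    rw [mul_assoc, ← pow_succ']
    exact h3
  have h7 : ‖w‖ ≤ (S + ‖b.1‖) / ‖leadC f g b.2‖ := by
    rw [le_div_iff₀ hc']
    linarith
  linarith

theorem continuousAt_fibBound {b : ℂ × ℂ} (hc : leadC f g b.2 ≠ 0) : ContinuousAt (fibBound f g) b := by
  unfold fibBound
  have h1 : ContinuousAt (fun b : ℂ × ℂ => ‖leadC f g b.2‖) b :=
    (continuous_leadC.comp continuous_snd).norm.continuousAt
  refine continuousAt_const.add (ContinuousAt.div ?_ h1 (norm_ne_zero_iff.2 hc))
  fun_prop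

end Covering

section Lifting

variable {f g : ℂ[X]}

theorem IsLab.defMap_eq {b : ℂ × ℂ} {μ : Fin (defDeg f g) → ℂ} (h : IsLab f g b μ) (i) :
    defMap f g (μ i, b.2) = b := Prod.ext (h.root i) rfl

open Topology Filter in
theorem isCoveringMapOn_defMap (hn : defDeg f g ≠ 0) :
    IsCoveringMapOn (defMap f g) (sigmaFin f g)ᶜ := by
  intro b hb
  obtain ⟨μ, hμ⟩ := exists_isLab hn hb
  obtain ⟨ζ, -, hev⟩ := hμ.exists_local_section hn
  obtain ⟨V, hVsub, hVo, hbV⟩ := eventually_nhds_iff.1 hev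
  have hζ : ∀ i, ContinuousOn (fun x => ζ x i) V := fun i x hx =>
    ((continuousAt_pi.1 (hVsub x hx).1 i)).continuousWithinAt
  have hlab : ∀ x ∈ V, IsLab f g x (ζ x) := fun x hx => (hVsub x hx).2
  have hHV : IsOpen (defMap f g ⁻¹' V) := hVo.preimage continuous_defMap
  let U : Fin (defDeg f g) → Set (ℂ × ℂ) := fun i =>
    {x | defMap f g x ∈ V ∧ x.1 = ζ (defMap f g x) i}
  have hU : ∀ i, IsOpen (U i) := by
    intro i
    have h1 : U i = ⋂ j : Fin (defDeg f g), (defMap f g ⁻¹' V ∩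
        (fun x => if j = i then 1 else x.1 - ζ (defMap f g x) j) ⁻¹' {0}ᶜ) := by
      ext x
      simp only [U, Set.mem_iInter, Set.mem_inter_iff, Set.mem_preimage, Set.mem_compl_iff,
        Set.mem_singleton_iff, Set.mem_ofPred_eq]
      constructor
      · rintro ⟨hx, hxi⟩ j
        refine ⟨hx, ?_⟩
        split_ifs with hj
        · exact one_ne_zero
        · rw [hxi, sub_eq_zero]
          exact fun h => hj ((hlab _ hx).inj h).symm
      · intro h
        have hx := (h i).1
        refine ⟨hx, ?_⟩
        obtain ⟨j, hj⟩ := (hlab _ hx).exists_eq hn (w := x.1) rfl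
        have h2 := (h j).2
        split_ifs at h2 with hji
        · rw [← hji, hj]
        · exact absurd (sub_eq_zero.2 hj.symm) h2
    rw [h1]
    refine isOpen_iInter_of_finite fun j => ?_
    refine ContinuousOn.isOpen_inter_preimage ?_ hHV isOpen_compl_singleton
    split_ifs
    · exact continuousOn_const
    · exact continuousOn_fst.sub ((hζ j).comp continuous_defMap.continuousOn fun x hx => hx)
  have : Nonempty (Fin (defDeg f g)) := ⟨⟨0, Nat.pos_of_ne_zero hn⟩⟩
  have hs : ∀ i, ∀ x ∈ V, (ζ x i, x.2) ∈ U i := fun i x hx => by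
    have := (hlab x hx).defMap_eq i
    refine ⟨?_, ?_⟩
    · rwa [this]
    · rw [this]
  have hsV : ∀ i, ContinuousOn (fun x => (ζ x i, x.2)) V := fun i =>
    (hζ i).prodMk continuousOn_snd
  have key : IsEvenlyCovered (defMap f g) b (Fin (defDeg f g)) := by
    refine IsEvenlyCovered.of_trivialization
      (t := IsOpen.trivializationDiscrete U V hVo (fun i W hW => ?_) ?_ ?_ ?_ ?_) ?_
    · refine ⟨fun h => (h.preimage continuous_defMap).inter (hU i), fun h => ?_⟩
      convert! (hsV i).isOpen_inter_preimage hVo h using 1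
      ext x
      simp only [Set.mem_inter_iff, Set.mem_preimage]
      constructor
      · intro hx
        rw [(hlab x (hW hx)).defMap_eq i]
        exact ⟨hW hx, hx, hs i x (hW hx)⟩
      · rintro ⟨h1, h2, -⟩
        rwa [(hlab x h1).defMap_eq i] at h2
    · intro i x hx y hy hxy
      have hxy2 := congrArg Prod.snd hxy
      refine Prod.ext ?_ hxy2
      rw [hx.2, hy.2, hxy]
    · intro i x hx
      exact ⟨_, hs i x hx, (hlab x hx).defMap_eq i⟩
    · intro i j hij
      refine Set.disjoint_left.2 fun x hx hy => hij ?_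
      exact (hlab _ hx.1).inj (hx.2.symm.trans hy.2)
    · intro x hx
      obtain ⟨j, hj⟩ := (hlab _ hx).exists_eq hn (w := x.1) rfl
      exact Set.mem_iUnion.2 ⟨j, hx, hj.symm⟩
    · exact hbV
  exact key.to_isEvenlyCovered_preimage

variable {A : Type*} [TopologicalSpace A]

theorem lab_lift_unique [PreconnectedSpace A] (hn : defDeg f g ≠ 0) {φ : A → ℂ × ℂ}
    {m m' : A → Fin (defDeg f g) → ℂ} (hm : Continuous m)
    (hm' : Continuous m') (hl : ∀ a, IsLab f g (φ a) (m a)) (hl' : ∀ a, IsLab f g (φ a) (m' a))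
    (a₀ : A) (h0 : m a₀ = m' a₀) : m = m' := by
  have hcl : IsClosed {a | m a = m' a} := isClosed_eq hm hm'
  have hop : IsOpen {a | m a = m' a} := by
    have h1 : {a | m a = m' a} = ⋂ i, ⋂ j, {a | i ≠ j → m a i ≠ m' a j} := by
      ext a
      simp only [Set.mem_iInter, Set.mem_ofPred_eq]
      constructor
      · intro h i j hij hne
        rw [h] at hne
        exact hij ((hl' a).inj hne)
      · intro h
        funext i
        obtain ⟨j, hj⟩ := (hl' a).exists_eq hn ((hl a).root i)
        by_contra hne
        refine h i j (fun hij => hne ?_) hj.symm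
        rw [← hj, hij]
    rw [h1]
    refine isOpen_iInter_of_finite fun i => isOpen_iInter_of_finite fun j => ?_
    by_cases hij : i = j
    · simp [hij]
    · simp only [ne_eq, hij, not_false_eq_true, forall_const]
      exact isOpen_ne_fun ((continuous_apply i).comp hm) ((continuous_apply j).comp hm')
  have huniv : {a | m a = m' a} = Set.univ := IsClopen.eq_univ ⟨hcl, hop⟩ ⟨a₀, h0⟩
  exact funext fun a => Set.eq_univ_iff_forall.1 huniv a

theorem exists_lab_lift [SimplyConnectedSpace A] [LocallyPathConnectedSpace A]
    (hn : defDeg f g ≠ 0) {φ : A → ℂ × ℂ} (hφ : Continuous φ) (hΩ : ∀ a, φ a ∉ sigmaFin f g)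
    (a₀ : A) {μ : Fin (defDeg f g) → ℂ} (hμ : IsLab f g (φ a₀) μ) :
    ∃ m : A → Fin (defDeg f g) → ℂ, Continuous m ∧ m a₀ = μ ∧ ∀ a, IsLab f g (φ a) (m a) := by
  have hcov := isCoveringMapOn_defMap (f := f) (g := g) hn
  choose F hF hFu using fun i => hcov.existsUnique_continuousMap_lifts (⟨φ, hφ⟩ : C(A, ℂ × ℂ))
    (a₀ := a₀) (e₀ := (μ i, (φ a₀).2)) (hμ.defMap_eq i) hΩ
  have h2 : ∀ i a, defMap f g (F i a) = φ a := fun i a => congrFun (hF i).2 a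
  have hsnd : ∀ i a, (F i a).2 = (φ a).2 := fun i a => by
    have := congrArg Prod.snd (h2 i a)
    exact this
  refine ⟨fun a i => (F i a).1, continuous_pi fun i => continuous_fst.comp (F i).continuous,
    funext fun i => by simp only [(hF i).1], fun a => ⟨fun h => hΩ a (Or.inl h), ?_, ?_⟩⟩
  · intro i j hij
    have h3 : F i a = F j a := Prod.ext hij (by rw [hsnd, hsnd])
    have : PreconnectedSpace A := inferInstance
    have h4 : F i = F j := by
      have := (hcov.existsUnique_continuousMap_lifts (⟨φ, hφ⟩ : C(A, ℂ × ℂ))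
        (a₀ := a) (e₀ := F i a) (h2 i a) hΩ).unique ⟨rfl, (hF i).2⟩ ⟨h3.symm, (hF j).2⟩
      exact this
    have h5 := congrArg Prod.fst (congrArg (fun G : C(A, ℂ × ℂ) => G a₀) h4)
    beta_reduce at h5
    rw [(hF i).1, (hF j).1] at h5
    exact hμ.inj h5
  · intro i
    have := congrArg Prod.fst (h2 i a)
    rw [defMap, hsnd] at this
    exact this

end Lifting

section Connectedness

variable {f g : ℂ[X]}

theorem finite_leadC_eq_zero (h : ∃ ε, leadC f g ε ≠ 0) :
    {ε | leadC f g ε = 0}.Finite := by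
  obtain ⟨ε₀, h0⟩ := h
  set p : ℂ[X] := C (f.coeff (defDeg f g)) + X * C (g.coeff (defDeg f g)) with hp
  have he : ∀ ε, p.eval ε = leadC f g ε := fun ε => by
    simp only [p, leadC, eval_add, eval_mul, eval_C, eval_X]
  have hp0 : p ≠ 0 := fun h => h0 (by rw [← he, h, eval_zero])
  refine (p.roots.toFinset.finite_toSet).subset fun ε hε => ?_
  simp only [Finset.mem_coe, Multiset.mem_toFinset, mem_roots hp0, IsRoot, he]
  exact hε

theorem finite_slice_sigmaFin (hn : defDeg f g ≠ 0) {ε : ℂ} (hc : leadC f g ε ≠ 0) :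
    {t | (t, ε) ∈ sigmaFin f g}.Finite := by
  set p := fibPoly f g (0, ε)
  have hp : p.natDegree = defDeg f g := natDegree_fibPoly hn hc
  have hp0 : p.derivative ≠ 0 := by
    intro h
    have := derivative_eq_zero.1 h
    omega
  refine ((p.derivative.roots.toFinset.finite_toSet).image
    (fun w => f.eval w + ε * g.eval w)).subset ?_
  rintro t (h | ⟨w, hw, hw'⟩)
  · exact absurd h hc
  · refine ⟨w, ?_, hw⟩
    simp only [Finset.mem_coe, Multiset.mem_toFinset, mem_roots hp0, IsRoot]
    rw [eval_derivative_fibPoly]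
    exact hw'

theorem exists_notMem_sigmaFin (hn : defDeg f g ≠ 0) {ε : ℂ} (hc : leadC f g ε ≠ 0) :
    ∃ t, (t, ε) ∉ sigmaFin f g :=
  (finite_slice_sigmaFin hn hc).infinite_compl.nonempty

theorem joinedIn_slice (hn : defDeg f g ≠ 0) {ε t t' : ℂ} (h : (t, ε) ∉ sigmaFin f g)
    (h' : (t', ε) ∉ sigmaFin f g) : JoinedIn {b | b ∉ sigmaFin f g ∧ b.2 = ε} (t, ε) (t', ε) := by
  have hc : leadC f g ε ≠ 0 := fun hc => h (Or.inl hc)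
  have h1 := ((finite_slice_sigmaFin hn hc).countable.isPathConnected_compl_of_one_lt_rank
    (by rw [Complex.rank_real_complex]; norm_num)).joinedIn t h t' h'
  refine (h1.map (f := fun t => (t, ε)) (by fun_prop)).mono ?_
  rintro _ ⟨s, hs, rfl⟩
  exact ⟨hs, rfl⟩

open Topology Filter in
theorem joinedIn_compl_sigmaFin (hn : defDeg f g ≠ 0) {b b' : ℂ × ℂ} (h : b ∉ sigmaFin f g)
    (h' : b' ∉ sigmaFin f g) : JoinedIn (sigmaFin f g)ᶜ b b' := by
  have hslice : ∀ {ε t t' : ℂ}, (t, ε) ∉ sigmaFin f g → (t', ε) ∉ sigmaFin f g →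
      JoinedIn (sigmaFin f g)ᶜ (t, ε) (t', ε) := fun h h' =>
    (joinedIn_slice hn h h').mono fun x hx => hx.1
  let P : ℂ → ℂ → Prop := fun ε ε' => ∀ t t', (t, ε) ∉ sigmaFin f g → (t', ε') ∉ sigmaFin f g →
    JoinedIn (sigmaFin f g)ᶜ (t, ε) (t', ε')
  have hfin := finite_leadC_eq_zero (f := f) (g := g) ⟨b.2, fun hc => h (Or.inl hc)⟩
  have hconn : IsPreconnected {ε | leadC f g ε = 0}ᶜ :=
    (hfin.countable.isConnected_compl_of_one_lt_rank
      (by rw [Complex.rank_real_complex]; norm_num)).isPreconnected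
  refine hconn.induction₂ P ?_ ?_ ?_ (x := b.2) (y := b'.2) (fun hc => h (Or.inl hc))
    (fun hc => h' (Or.inl hc)) b.1 b'.1 h h'
  · intro ε hε
    obtain ⟨s, hs⟩ := exists_notMem_sigmaFin hn hε
    obtain ⟨r, hr, hball⟩ := Metric.isOpen_iff.1 (isOpen_compl_sigmaFin hn) (s, ε) hs
    refine eventually_nhdsWithin_of_eventually_nhds ?_
    filter_upwards [Metric.ball_mem_nhds ε hr] with ε' hε' t t' ht ht'
    have hmem : (s, ε') ∈ Metric.ball (s, ε) r := by
      simpa [Prod.dist_eq, hr] using hε'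
    have h1 : JoinedIn (sigmaFin f g)ᶜ (s, ε) (s, ε') :=
      (((convex_ball (s, ε) r).isPathConnected ⟨_, hmem⟩).joinedIn _ (Metric.mem_ball_self hr) _
        hmem).mono hball
    exact (hslice ht hs).trans (h1.trans (hslice (hball hmem) ht'))
  · intro x y z _ hy _ hxy hyz t t' ht ht'
    obtain ⟨s, hs⟩ := exists_notMem_sigmaFin hn hy
    exact (hxy t s ht hs).trans (hyz s t' hs ht')
  · intro x y _ _ hxy t t' ht ht'
    exact (hxy t' t ht' ht).symm

end Connectedness

section LabelMonodromy

variable (f g : ℂ[X]) (T : Set (ℂ × ℂ))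

/-- The space of labelled fibers over the points of `T`. -/
def LabSpace : Set ((ℂ × ℂ) × (Fin (defDeg f g) → ℂ)) := {x | IsLab f g x.1 x.2 ∧ x.1 ∈ T}

variable {f g T}

theorem JoinedIn.labSpace_perm {b b' : ℂ × ℂ} {μ μ' : Fin (defDeg f g) → ℂ}
    (h : JoinedIn (LabSpace f g T) (b, μ) (b', μ')) (σ : Equiv.Perm (Fin (defDeg f g))) :
    JoinedIn (LabSpace f g T) (b, fun i => μ (σ i)) (b', fun i => μ' (σ i)) := by
  refine (h.map (f := fun x => (x.1, fun i => x.2 (σ i))) (by fun_prop)).mono ?_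
  rintro _ ⟨x, hx, rfl⟩
  exact ⟨hx.1.comp_perm σ, hx.2⟩

/-- The monodromy group of the labelled fiber `μ` over `b`, for the closed paths in `T`. -/
def labMonodromy {b : ℂ × ℂ} {μ : Fin (defDeg f g) → ℂ} (h : (b, μ) ∈ LabSpace f g T) :
    Subgroup (Equiv.Perm (Fin (defDeg f g))) where
  carrier := {σ | JoinedIn (LabSpace f g T) (b, μ) (b, fun i => μ (σ i))}
  one_mem' := JoinedIn.refl h
  mul_mem' := fun {σ τ} hσ hτ => JoinedIn.trans hτ (JoinedIn.labSpace_perm hσ τ)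
  inv_mem' := fun {σ} hσ => by
    have := (JoinedIn.labSpace_perm hσ σ⁻¹).symm
    simpa using this

theorem labMonodromy_mono {T' : Set (ℂ × ℂ)} (hT : T ⊆ T') {b : ℂ × ℂ}
    {μ : Fin (defDeg f g) → ℂ} (h : (b, μ) ∈ LabSpace f g T) (h' : (b, μ) ∈ LabSpace f g T') :
    labMonodromy h ≤ labMonodromy h' := fun _ hσ =>
  JoinedIn.mono hσ fun _ hx => ⟨hx.1, hT hx.2⟩

theorem labMonodromy_le_of_joinedIn {b b' : ℂ × ℂ} {μ μ' : Fin (defDeg f g) → ℂ}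
    (h : JoinedIn (LabSpace f g T) (b, μ) (b', μ')) :
    labMonodromy h.source_mem ≤ labMonodromy h.target_mem := fun σ hσ =>
  h.symm.trans (JoinedIn.trans hσ (h.labSpace_perm σ))

theorem labMonodromy_eq_of_joinedIn {b b' : ℂ × ℂ} {μ μ' : Fin (defDeg f g) → ℂ}
    (h : JoinedIn (LabSpace f g T) (b, μ) (b', μ')) :
    labMonodromy h.source_mem = labMonodromy h.target_mem :=
  le_antisymm (labMonodromy_le_of_joinedIn h) (labMonodromy_le_of_joinedIn h.symm)

theorem exists_joinedIn_labSpace (hn : defDeg f g ≠ 0) {b b' : ℂ × ℂ}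
    (h : JoinedIn {b | b ∉ sigmaFin f g ∧ b ∈ T} b b') {μ : Fin (defDeg f g) → ℂ}
    (hμ : IsLab f g b μ) : ∃ μ', JoinedIn (LabSpace f g T) (b, μ) (b', μ') := by
  let p := h.somePath
  have hp : ∀ s, p.extend s ∉ sigmaFin f g ∧ p.extend s ∈ T := fun s => by
    have := p.extend_range ▸ Set.mem_range_self (f := p.extend) s
    obtain ⟨x, hx⟩ := this
    rw [← hx]
    exact h.somePath_mem x
  obtain ⟨m, hm, hm0, hml⟩ := exists_lab_lift hn (φ := p.extend) p.continuous_extend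
    (fun s => (hp s).1) 0 (μ := μ) (by rwa [p.extend_zero])
  refine ⟨m 1, JoinedIn.ofLine (f := fun s => (p.extend s, m s)) ?_ ?_ ?_ ?_⟩
  · exact (p.continuous_extend.prodMk hm).continuousOn
  · simp [hm0]
  · simp
  · rintro _ ⟨s, -, rfl⟩
    exact ⟨hml s, (hp s).2⟩

end LabelMonodromy

section Fibers

variable {f g : ℂ[X]}

/-- The enumeration of the fiber given by a labelling. -/
def IsLab.fiberEquiv {b : ℂ × ℂ} {μ : Fin (defDeg f g) → ℂ} (h : IsLab f g b μ)
    (hn : defDeg f g ≠ 0) : Fin (defDeg f g) ≃ theFiber f g b.1 b.2 :=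
  Equiv.ofBijective (fun i => ⟨μ i, h.root i⟩)
    ⟨fun i j hij => h.inj (congrArg Subtype.val hij), fun w => by
      obtain ⟨i, hi⟩ := h.exists_eq hn w.2
      exact ⟨i, Subtype.ext hi⟩⟩

theorem lab_lift_eq {A : Type*} [TopologicalSpace A] [PreconnectedSpace A] (hn : defDeg f g ≠ 0)
    {φ : A → ℂ × ℂ} {m : A → Fin (defDeg f g) → ℂ} (hm : Continuous m)
    (hml : ∀ a, IsLab f g (φ a) (m a)) {l : A → ℂ} (hl : Continuous l)
    (hr : ∀ a, f.eval (l a) + (φ a).2 * g.eval (l a) = (φ a).1) (a₀ : A) {i : Fin (defDeg f g)}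
    (h0 : l a₀ = m a₀ i) (a : A) : l a = m a i := by
  have hcl : ∀ j, IsClosed {a | l a = m a j} := fun j =>
    isClosed_eq hl ((continuous_apply j).comp hm)
  have hop : IsOpen {a | l a = m a i} := by
    have h1 : {a | l a = m a i} = (⋃ j : {j // j ≠ i}, {a | l a = m a j})ᶜ := by
      ext a
      simp only [Set.mem_compl_iff, Set.mem_iUnion, Set.mem_ofPred_eq, not_exists]
      constructor
      · intro h j h'
        exact j.2 ((hml a).inj (h'.symm.trans h))
      · intro h
        obtain ⟨j, hj⟩ := (hml a).exists_eq hn (hr a)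
        by_cases hji : j = i
        · rw [← hji, hj]
        · exact absurd hj.symm (h ⟨j, hji⟩)
    rw [h1]
    exact (isClosed_iUnion_of_finite fun j : {j // j ≠ i} => hcl j).isOpen_compl
  have huniv := IsClopen.eq_univ ⟨hcl i, hop⟩ ⟨a₀, h0⟩
  exact Set.eq_univ_iff_forall.1 huniv a

/-- Lifts of a closed path starting at all points of the fiber yield a closed path of labellings. -/
theorem mem_labMonodromy_of_lifts (hn : defDeg f g ≠ 0) {T : Set (ℂ × ℂ)} {b : ℂ × ℂ}
    {μ : Fin (defDeg f g) → ℂ} (h : (b, μ) ∈ LabSpace f g T) (σ : Equiv.Perm (Fin (defDeg f g)))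
    (φ : ℝ → ℂ × ℂ) (hφ : ContinuousOn φ (Set.Icc 0 1)) (h0 : φ 0 = b) (h1 : φ 1 = b)
    (hT : ∀ s ∈ Set.Icc (0 : ℝ) 1, φ s ∈ T) (hΩ : ∀ s ∈ Set.Icc (0 : ℝ) 1, φ s ∉ sigmaFin f g)
    (hlift : ∀ i, ∃ l : ℝ → ℂ, ContinuousOn l (Set.Icc 0 1) ∧ l 0 = μ i ∧ l 1 = μ (σ i) ∧
      ∀ s ∈ Set.Icc (0 : ℝ) 1, f.eval (l s) + (φ s).2 * g.eval (l s) = (φ s).1) :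
    σ ∈ labMonodromy h := by
  have h01 : (0 : ℝ) ≤ 1 := zero_le_one
  let q : ℝ → ℝ := fun s => Set.projIcc 0 1 h01 s
  have hq : ∀ s, q s ∈ Set.Icc (0 : ℝ) 1 := fun s => (Set.projIcc 0 1 h01 s).2
  have hqc : Continuous q := continuous_subtype_val.comp continuous_projIcc
  have hq0 : q 0 = 0 := by simp [q]
  have hq1 : q 1 = 1 := by simp [q]
  have hφc : Continuous fun s => φ (q s) := hφ.comp_continuous hqc hq
  obtain ⟨m, hm, hm0, hml⟩ := exists_lab_lift hn (φ := fun s => φ (q s)) hφc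
    (fun s => hΩ _ (hq s)) 0 (μ := μ) (by rw [hq0, h0]; exact h.1)
  have hm1 : m 1 = fun i => μ (σ i) := by
    funext i
    obtain ⟨l, hl, hl0, hl1, hlr⟩ := hlift i
    have := lab_lift_eq hn hm hml (l := fun s => l (q s)) (hl.comp_continuous hqc hq)
      (fun s => hlr _ (hq s)) 0 (i := i) (by rw [hq0, hl0, hm0]) 1
    rw [← this, hq1, hl1]
  refine JoinedIn.ofLine (f := fun s => (φ (q s), m s)) (hφc.prodMk hm).continuousOn ?_ ?_ ?_
  · simp [hq0, h0, hm0]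
  · simp [hq1, h1, hm1]
  · rintro _ ⟨s, -, rfl⟩
    exact ⟨hml s, hT _ (hq s)⟩

/-- A closed path of labellings. -/
theorem exists_lifts_of_mem_labMonodromy {T : Set (ℂ × ℂ)} {b : ℂ × ℂ}
    {μ : Fin (defDeg f g) → ℂ} (h : (b, μ) ∈ LabSpace f g T) {σ : Equiv.Perm (Fin (defDeg f g))}
    (hσ : σ ∈ labMonodromy h) : ∃ (φ : ℝ → ℂ × ℂ) (m : ℝ → Fin (defDeg f g) → ℂ),
      Continuous φ ∧ Continuous m ∧ φ 0 = b ∧ φ 1 = b ∧ m 0 = μ ∧ m 1 = (fun i => μ (σ i)) ∧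
      ∀ s, IsLab f g (φ s) (m s) ∧ φ s ∈ T := by
  let p := JoinedIn.somePath hσ
  have hp : ∀ s, p.extend s ∈ LabSpace f g T := fun s => by
    have := p.extend_range ▸ Set.mem_range_self (f := p.extend) s
    obtain ⟨x, hx⟩ := this
    rw [← hx]
    exact JoinedIn.somePath_mem hσ x
  refine ⟨fun s => (p.extend s).1, fun s => (p.extend s).2, continuous_fst.comp p.continuous_extend,
    continuous_snd.comp p.continuous_extend, ?_, ?_, ?_, ?_, hp⟩ <;> simp

theorem notMem_sigmaSet_iff {t ε : ℂ} :
    ((t : OnePoint ℂ), ε) ∉ sigmaSet f g ↔ (t, ε) ∉ sigmaFin f g := by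
  simp [sigmaSet]

theorem mem_map_permMapHom {X Y : Type*} (e : X ≃ Y) (H : Subgroup (Equiv.Perm X))
    (σ : Equiv.Perm Y) : σ ∈ H.map (permMapHom e) ↔ (e.trans σ).trans e.symm ∈ H := by
  constructor
  · rintro ⟨τ, hτ, rfl⟩
    have h1 : (e.trans (permMapHom e τ)).trans e.symm = τ := by
      ext x
      simp [permMapHom]
    rwa [h1]
  · intro h
    refine ⟨_, h, ?_⟩
    ext y
    simp [permMapHom]

theorem monodromyGroup_eq (hn : defDeg f g ≠ 0) {b : ℂ × ℂ} {μ : Fin (defDeg f g) → ℂ}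
    (h : (b, μ) ∈ LabSpace f g Set.univ) :
    MonodromyGroup f g b.1 b.2 = (labMonodromy h).map (permMapHom (h.1.fiberEquiv hn)) := by
  set e : Fin (defDeg f g) ≃ theFiber f g b.1 b.2 := h.1.fiberEquiv hn
  have he : ∀ i, (e i : ℂ) = μ i := fun i => rfl
  have hσe : ∀ (σ : Equiv.Perm (theFiber f g b.1 b.2)) i,
      (σ (e i) : ℂ) = μ (((e.trans σ).trans e.symm) i) := fun σ i => by
    rw [← he]
    simp
  have hn' : 0 < defDeg f g := Nat.pos_of_ne_zero hn
  rw [MonodromyGroup]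
  convert Subgroup.closure_eq _ using 2
  ext σ
  rw [SetLike.mem_coe, mem_map_permMapHom]
  constructor
  · rintro ⟨γ, hγ, hγ0, hγ1, hγΩ, hγl⟩
    choose l hl hl0 hl1 hlr using hγl
    let x₀ := e ⟨0, hn'⟩
    let φ : ℝ → ℂ × ℂ := fun s => (f.eval (l x₀ s) + (γ s).2 * g.eval (l x₀ s), (γ s).2)
    have hφγ : ∀ s ∈ Set.Icc (0 : ℝ) 1, (((φ s).1 : OnePoint ℂ), (φ s).2) = γ s := fun s hs =>
      Prod.ext (hlr x₀ s hs) rfl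
    have hinj : ∀ {x y : ℂ × ℂ}, ((x.1 : OnePoint ℂ), x.2) = ((y.1 : OnePoint ℂ), y.2) → x = y :=
      fun {x y} hxy => by
        simp only [Prod.mk.injEq, OnePoint.coe_eq_coe] at hxy
        exact Prod.ext hxy.1 hxy.2
    refine mem_labMonodromy_of_lifts hn h _ φ ?_ (hinj ?_) (hinj ?_) (fun _ _ => Set.mem_univ _) ?_ ?_
    · have h1 : ContinuousOn (fun s => (γ s).2) (Set.Icc 0 1) := continuous_snd.comp_continuousOn hγ
      exact ((f.continuous.comp_continuousOn (hl x₀)).add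
        (h1.mul (g.continuous.comp_continuousOn (hl x₀)))).prodMk h1
    · rw [hφγ 0 (by simp), hγ0]
    · rw [hφγ 1 (by simp), hγ1]
    · intro s hs
      have := hγΩ s hs
      rw [← hφγ s hs, notMem_sigmaSet_iff] at this
      exact this
    · intro i
      refine ⟨l (e i), hl _, hl0 _, ?_, fun s hs => ?_⟩
      · rw [hl1, hσe]
      · have := (hlr (e i) s hs).trans (hlr x₀ s hs).symm
        exact OnePoint.coe_eq_coe.1 this
  · intro hσ
    obtain ⟨φ, m, hφ, hm, hφ0, hφ1, hm0, hm1, hφm⟩ := exists_lifts_of_mem_labMonodromy h hσ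
    refine ⟨fun s => (((φ s).1 : OnePoint ℂ), (φ s).2), ?_, by simp [hφ0], by simp [hφ1], ?_, ?_⟩
    · exact ((OnePoint.continuous_coe.comp (continuous_fst.comp hφ)).prodMk
        (continuous_snd.comp hφ)).continuousOn
    · intro s _
      rw [notMem_sigmaSet_iff]
      exact (hφm s).1.notMem_sigmaFin hn
    · intro x
      obtain ⟨i, rfl⟩ := e.surjective x
      refine ⟨fun s => m s i, ((continuous_apply i).comp hm).continuousOn, ?_, ?_, fun s _ => ?_⟩
      · exact congrFun hm0 i
      · exact (congrFun hm1 i).trans (hσe σ i).symm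
      · exact congrArg _ ((hφm s).1.root i)

theorem notMem_polyCrit_iff {t ε : ℂ} (hc : leadC f g ε ≠ 0) :
    t ∉ polyCrit (f + C ε * g) ↔ (t, ε) ∉ sigmaFin f g := by
  simp [polyCrit, sigmaFin, hc]

theorem sliceMonodromyGroup_eq (hn : defDeg f g ≠ 0) {b : ℂ × ℂ} {μ : Fin (defDeg f g) → ℂ}
    (h : (b, μ) ∈ LabSpace f g {x | x.2 = b.2}) :
    SliceMonodromyGroup f g b.2 b.1 = (labMonodromy h).map (permMapHom (h.1.fiberEquiv hn)) := by
  set e : Fin (defDeg f g) ≃ theFiber f g b.1 b.2 := h.1.fiberEquiv hn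
  have he : ∀ i, (e i : ℂ) = μ i := fun i => rfl
  have hσe : ∀ (σ : Equiv.Perm (theFiber f g b.1 b.2)) i,
      (σ (e i) : ℂ) = μ (((e.trans σ).trans e.symm) i) := fun σ i => by
    rw [← he]
    simp
  rw [SliceMonodromyGroup]
  convert Subgroup.closure_eq _ using 2
  ext σ
  rw [SetLike.mem_coe, mem_map_permMapHom]
  constructor
  · rintro ⟨γ, hγ, hγ0, hγ1, hγΩ, hγl⟩
    choose l hl hl0 hl1 hlr using hγl
    refine mem_labMonodromy_of_lifts hn h _ (fun s => (γ s, b.2)) (hγ.prodMk continuousOn_const)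
      (Prod.ext hγ0 rfl) (Prod.ext hγ1 rfl) (fun _ _ => rfl)
      (fun s hs => (notMem_polyCrit_iff h.1.lead).1 (hγΩ s hs)) fun i => ?_
    refine ⟨l (e i), hl _, hl0 _, ?_, hlr (e i)⟩
    rw [hl1, hσe]
  · intro hσ
    obtain ⟨φ, m, hφ, hm, hφ0, hφ1, hm0, hm1, hφm⟩ := exists_lifts_of_mem_labMonodromy h hσ
    have h2 : ∀ s, (φ s).2 = b.2 := fun s => (hφm s).2
    refine ⟨fun s => (φ s).1, (continuous_fst.comp hφ).continuousOn, by simp [hφ0], by simp [hφ1],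
      fun s _ => ?_, fun x => ?_⟩
    · rw [notMem_polyCrit_iff h.1.lead, ← h2 s]
      exact (hφm s).1.notMem_sigmaFin hn
    · obtain ⟨i, rfl⟩ := e.surjective x
      refine ⟨fun s => m s i, ((continuous_apply i).comp hm).continuousOn, ?_, ?_, fun s _ => ?_⟩
      · exact congrFun hm0 i
      · exact (congrFun hm1 i).trans (hσe σ i).symm
      · rw [← h2 s]
        exact (hφm s).1.root i

end Fibers

section DeformationPolynomial

variable (f g : ℂ[X])

/-- The polynomial `f + ε g` over `ℂ[ε]`. -/
def defFamily : ℂ[X][X] := f.map C + C X * g.map C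

/-- The leading coefficient of `f + ε g` as a polynomial in `ε`. -/
def leadPoly : ℂ[X] := C (f.coeff (defDeg f g)) + X * C (g.coeff (defDeg f g))

/-- The monic polynomial whose roots are the roots of `f + ε g` multiplied by `c(ε)`. -/
def monicFamily : ℂ[X][X] := integralNormalization (defFamily f g)

/-- Evaluation at the point `x = (t, ε)`. -/
def evalPoint (x : ℂ × ℂ) : ℂ[X][X] →ₐ[ℂ] ℂ where
  toRingHom := eval₂RingHom (evalRingHom x.2) x.1
  commutes' a := by
    rw [IsScalarTower.algebraMap_apply ℂ ℂ[X] ℂ[X][X]]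
    simp

variable {f g}

theorem evalPoint_apply (x : ℂ × ℂ) (r : ℂ[X][X]) :
    evalPoint x r = r.eval₂ (evalRingHom x.2) x.1 := rfl

theorem continuous_evalPoint (r : ℂ[X][X]) : Continuous fun x : ℂ × ℂ => evalPoint x r := by
  simp only [evalPoint_apply, eval₂_eq_sum, Polynomial.sum, coe_evalRingHom]
  refine continuous_finsetSum _ fun i _ => ?_
  exact ((r.coeff i).continuous.comp continuous_snd).mul (continuous_fst.pow i)

theorem eval_leadPoly (ε : ℂ) : (leadPoly f g).eval ε = leadC f g ε := by
  simp only [leadPoly, leadC, eval_add, eval_mul, eval_C, eval_X]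

theorem coeff_defFamily (k : ℕ) : (defFamily f g).coeff k = C (f.coeff k) + X * C (g.coeff k) := by
  simp [defFamily]

theorem leadPoly_ne_zero {ε : ℂ} (hc : leadC f g ε ≠ 0) : leadPoly f g ≠ 0 := fun h =>
  hc (by rw [← eval_leadPoly, h, eval_zero])

theorem natDegree_defFamily {ε : ℂ} (hc : leadC f g ε ≠ 0) :
    (defFamily f g).natDegree = defDeg f g := by
  refine natDegree_eq_of_le_of_coeff_ne_zero ?_ ?_
  · refine (natDegree_add_le _ _).trans (max_le ?_ ?_)
    · exact natDegree_map_le.trans (le_max_left _ _)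
    · exact (natDegree_C_mul_le _ _).trans (natDegree_map_le.trans (le_max_right _ _))
  · rw [coeff_defFamily]
    exact leadPoly_ne_zero hc

theorem leadingCoeff_defFamily {ε : ℂ} (hc : leadC f g ε ≠ 0) :
    (defFamily f g).leadingCoeff = leadPoly f g := by
  rw [leadingCoeff, natDegree_defFamily hc, coeff_defFamily, leadPoly]

theorem monic_monicFamily {ε : ℂ} (hc : leadC f g ε ≠ 0) : (monicFamily f g).Monic := by
  refine monic_integralNormalization fun h => leadPoly_ne_zero hc ?_
  rw [← leadingCoeff_defFamily hc, h, leadingCoeff_zero]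

theorem natDegree_monicFamily {ε : ℂ} (hc : leadC f g ε ≠ 0) :
    (monicFamily f g).natDegree = defDeg f g := by
  rw [monicFamily, natDegree_eq_of_degree_eq degree_integralNormalization, natDegree_defFamily hc]

theorem eval_map_defFamily (ε w : ℂ) :
    (defFamily f g).eval₂ (evalRingHom ε) w = f.eval w + ε * g.eval w := by
  rw [← eval_map]
  have h : (evalRingHom ε).comp (C : ℂ →+* ℂ[X]) = RingHom.id ℂ := by
    ext <;> simp
  simp [defFamily, Polynomial.map_map, h]

theorem eval_map_monicFamily (hn : defDeg f g ≠ 0) {ε : ℂ} (hc : leadC f g ε ≠ 0) (w : ℂ) :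
    ((monicFamily f g).map (evalRingHom ε)).eval (leadC f g ε * w) =
      (leadC f g ε) ^ (defDeg f g - 1) * (f.eval w + ε * g.eval w) := by
  have h := integralNormalization_eval₂_leadingCoeff_mul (p := defFamily f g)
    (by rw [natDegree_defFamily hc]; omega) (evalRingHom ε) w
  rw [leadingCoeff_defFamily hc, natDegree_defFamily hc, coe_evalRingHom, eval_leadPoly,
    eval_map_defFamily, ← eval_map] at h
  exact h

theorem map_shiftPoly {A B : Type*} [CommRing A] [CommRing B] (ψ : A →+* B) (P : A[X]) (d : A) :
    (shiftPoly P d).map (mapRingHom ψ) = shiftPoly (P.map ψ) (ψ d) := by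
  have h : (mapRingHom ψ).comp (C : A →+* A[X]) = (C : B →+* B[X]).comp ψ := by
    ext <;> simp
  simp [shiftPoly, Polynomial.map_map, h]

variable (f g) in
/-- The equation of the roots multiplied by `c(ε)`, over `ℂ[ε][t]`. -/
abbrev defEquation : ℂ[X][X][X] := shiftPoly (monicFamily f g) (leadPoly f g ^ (defDeg f g - 1))

variable (f g) in
/-- The equation of the roots multiplied by `c(ε)`, over `ℂ[t]`, for fixed `ε`. -/
abbrev sliceEquation (ε : ℂ) : ℂ[X][X] :=
  shiftPoly ((monicFamily f g).map (evalRingHom ε)) ((leadPoly f g ^ (defDeg f g - 1)).eval ε)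

theorem map_defEquation (ε : ℂ) :
    (defEquation f g).map (mapRingHom (evalRingHom ε)) = sliceEquation f g ε :=
  map_shiftPoly _ _ _

theorem map_evalPoint_eq (x : ℂ × ℂ) : (defEquation f g).map (evalPoint x : ℂ[X][X] →+* ℂ) =
    (sliceEquation f g x.2).map (evalRingHom x.1) := by
  rw [← map_defEquation, Polynomial.map_map]
  congr 1
  ext r <;> simp [evalPoint]

theorem IsLab.map_sliceEquation (hn : defDeg f g ≠ 0) {b : ℂ × ℂ} {μ : Fin (defDeg f g) → ℂ}
    (h : IsLab f g b μ) : (sliceEquation f g b.2).map (evalRingHom b.1) =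
      ∏ i, (X - C (leadC f g b.2 * μ i)) := by
  have hm := monic_monicFamily (f := f) (g := g) h.lead
  have hd := natDegree_monicFamily (f := f) (g := g) h.lead
  have hm' : ((monicFamily f g).map (evalRingHom b.2)).Monic := hm.map _
  have hd' : ((monicFamily f g).map (evalRingHom b.2)).natDegree = defDeg f g := by
    rw [hm.natDegree_map, hd]
  have hq : (sliceEquation f g b.2).Monic := shiftPoly_monic hm' (by rwa [hd']) _
  refine eq_prod_X_sub_C_of_roots _ (hq.map _) ?_ _ (fun i j hij => h.inj ?_) fun i => ?_
  · rw [hq.natDegree_map, natDegree_shiftPoly, hd']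
  · exact mul_left_cancel₀ h.lead hij
  · have h1 := eval_map_monicFamily hn h.lead (μ i)
    rw [h.root] at h1
    rw [sliceEquation, shiftPoly, Polynomial.map_sub, eval_sub, Polynomial.map_map]
    have h2 : (evalRingHom b.1).comp (C : ℂ →+* ℂ[X]) = RingHom.id ℂ := by ext <;> simp
    rw [h2, Polynomial.map_id, h1]
    simp [eval_leadPoly]

end DeformationPolynomial

section Specialization

theorem IsSpec.eq_of_eq {R E ι : Type*} [CommRing R] [Field E] [Algebra R E] {b : R →+* ℂ}
    {y : ι → E} {μ : ι → ℂ} (h : IsSpec b y μ) {i j : ι} (hij : y i = y j) : μ i = μ j := by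
  have := h (MvPolynomial.X i - MvPolynomial.X j) (by simp [hij])
  simpa [sub_eq_zero] using this

variable {R K E : Type*} [CommRing R] [Algebra ℂ R] [IsDomain R] [IsIntegrallyClosed R] [Field K] [Algebra R K]
  [IsFractionRing R K] [Field E] [Algebra K E] [Algebra R E] [IsScalarTower R K E] {f g : ℂ[X]}

theorem exists_perm_of_prod_eq {n : ℕ} {μ ν : Fin n → ℂ} (hμ : Function.Injective μ)
    (h : ∏ i, (X - C (μ i)) = ∏ i, (X - C (ν i))) :
    ∃ τ : Equiv.Perm (Fin n), ν = fun i => μ (τ i) := by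
  have hs : (∏ i, (X - C (ν i))).Separable := h ▸ separable_prod_X_sub_C_iff.2 hμ
  have hν := separable_prod_X_sub_C_iff.1 hs
  have hex : ∀ i, ∃ j, μ j = ν i := fun i => by
    have h1 : (∏ j, (X - C (μ j))).eval (ν i) = 0 := by
      rw [h, eval_prod]
      exact Finset.prod_eq_zero (Finset.mem_univ i) (by simp)
    rw [eval_prod] at h1
    obtain ⟨j, -, hj⟩ := Finset.prod_eq_zero_iff.1 h1
    exact ⟨j, by simpa [sub_eq_zero, eq_comm] using hj⟩
  choose s hs using hex
  have hinj : Function.Injective s := fun i j hij => hν (by rw [← hs, ← hs, hij])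
  exact ⟨Equiv.ofBijective s (Finite.injective_iff_bijective.1 hinj), funext fun i => (hs i).symm⟩

/-- The roots of `q`, labelled compatibly with a labelling of the roots of a specialization. -/
theorem exists_roots_isSpec {n : ℕ} (q : R[X]) (hq : q.Monic)
    [hE : IsSplittingField K E (q.map (algebraMap R K))] (b : R →ₐ[ℂ] ℂ) {μ : Fin n → ℂ}
    (hμ : Function.Injective μ) (h : q.map (b : R →+* ℂ) = ∏ i, (X - C (μ i))) :
    ∃ y : Fin n → E, Function.Injective y ∧ q.map (algebraMap R E) = ∏ i, (X - C (y i)) ∧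
      IsSpec (b : R →+* ℂ) y μ := by
  have hn : q.natDegree = n := by
    rw [← hq.natDegree_map (b : R →+* ℂ), h, natDegree_finsetProd_X_sub_C_eq_card]
    simp
  have hsp : (q.map (algebraMap R E)).Splits := by
    have := hE.splits
    rwa [Polynomial.map_map, ← IsScalarTower.algebraMap_eq] at this
  have hcard : (q.map (algebraMap R E)).roots.card = n := by
    rw [← hsp.natDegree_eq_card_roots, hq.natDegree_map, hn]
  obtain ⟨y₀, hy₀⟩ : ∃ y₀ : Fin n → E, q.map (algebraMap R E) = ∏ i, (X - C (y₀ i)) := by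
    have hl : (q.map (algebraMap R E)).roots.toList.length = n := by rw [Multiset.length_toList, hcard]
    refine ⟨fun i => (q.map (algebraMap R E)).roots.toList.get (i.cast hl.symm), ?_⟩
    conv_lhs => rw [hsp.eq_prod_roots_of_monic (hq.map _),
      ← Multiset.coe_toList (q.map (algebraMap R E)).roots, Multiset.map_coe, Multiset.prod_coe]
    rw [← List.prod_ofFn]
    congr 1
    apply List.ext_getElem <;> simp [hcard]
  have hbs : Function.Surjective (b : R →+* ℂ) := fun a =>
    ⟨algebraMap ℂ R a, by simp⟩
  have hinj : Function.Injective (algebraMap R E) := by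
    rw [IsScalarTower.algebraMap_eq R K E]
    exact (algebraMap K E).injective.comp (IsFractionRing.injective R K)
  obtain ⟨ν, hν⟩ := exists_isSpec y₀ hinj (isIntegral_root hq hy₀) (b : R →+* ℂ) hbs
  have h1 := hν.map_eq_prod q hy₀
  obtain ⟨τ, hτ⟩ := exists_perm_of_prod_eq hμ (h.symm.trans h1)
  have hspec : IsSpec (b : R →+* ℂ) (fun i => y₀ (τ.symm i)) μ := fun Q hQ => by
    have h2 := hν (MvPolynomial.rename τ.symm Q) (by rwa [MvPolynomial.aeval_rename])
    rw [MvPolynomial.eval₂_rename, hτ] at h2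
    convert h2 using 2
    ext i
    simp
  refine ⟨fun i => y₀ (τ.symm i), fun i j hij => hμ (hspec.eq_of_eq hij), ?_, hspec⟩
  rw [hy₀]
  exact (Equiv.prod_comp τ.symm fun i => X - C (y₀ i)).symm

end Specialization

section SpecPath
variable {f g : ℂ[X]} {T : Set (ℂ × ℂ)}

/-- A compatibility between labelled roots and labelled fibers is preserved along paths. -/
theorem isSpec_of_joinedIn_labSpace {R : Type*} (K : Type*) {E : Type*} [CommRing R] [Algebra ℂ R] [IsDomain R] [IsIntegrallyClosed R] [Field K]
  [Algebra R K] [IsFractionRing R K] [Field E] [Algebra K E] [Algebra R E] [IsScalarTower R K E]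
  [FiniteDimensional K E] [IsGalois K E]
    (q : R[X]) (hq : q.Monic) {y : Fin (defDeg f g) → E}
    (hy : Function.Injective y) (h : q.map (algebraMap R E) = ∏ i, (X - C (y i)))
    (β : ℂ × ℂ → (R →ₐ[ℂ] ℂ)) (hβ : ∀ r, Continuous fun x => β x r)
    (hβq : ∀ b μ, IsLab f g b μ → b ∈ T →
      q.map (β b : R →+* ℂ) = ∏ i, (X - C (leadC f g b.2 * μ i)))
    {b b' : ℂ × ℂ} {μ μ' : Fin (defDeg f g) → ℂ}
    (hj : JoinedIn (LabSpace f g T) (b, μ) (b', μ'))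
    (h0 : IsSpec (β b : R →+* ℂ) y fun i => leadC f g b.2 * μ i) :
    IsSpec (β b' : R →+* ℂ) y fun i => leadC f g b'.2 * μ' i := by
  let p := hj.somePath
  have hp : ∀ s, p s ∈ LabSpace f g T := hj.somePath_mem
  have hyint := isIntegral_root hq h
  have hinj : Function.Injective (algebraMap R E) := by
    rw [IsScalarTower.algebraMap_eq R K E]
    exact (algebraMap K E).injective.comp (IsFractionRing.injective R K)
  have hsurj : ∀ x, Function.Surjective (β x : R →+* ℂ) := fun x a => ⟨algebraMap ℂ R a, by simp⟩
  have hm : ∀ s, Function.Injective fun i => leadC f g (p s).1.2 * (p s).2 i := fun s i j hij =>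
    (hp s).1.inj (mul_left_cancel₀ (hp s).1.lead hij)
  have key := isSpec_of_path (K := K) hy hyint (exists_algEquiv_root h) (fun s => β (p s).1)
    (fun r => (hβ r).comp (by fun_prop)) (fun s i => leadC f g (p s).1.2 * (p s).2 i)
    (by
      have := continuous_leadC (f := f) (g := g)
      fun_prop) hm
    (fun s => by
      obtain ⟨ν, hν⟩ := exists_isSpec y hinj hyint (β (p s).1 : R →+* ℂ) (hsurj _)
      have h1 := hν.map_eq_prod q h
      obtain ⟨τ, hτ⟩ := exists_perm_of_prod_eq (hm s)
        ((hβq _ _ (hp s).1 (hp s).2).symm.trans h1)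
      exact ⟨τ, hτ ▸ hν⟩) 0 1 (by simpa [p] using h0)
  simpa [p] using key

theorem labMonodromy_le_autPerm {R : Type*} (K : Type*) {E : Type*} [CommRing R] [Algebra ℂ R] [IsDomain R] [IsIntegrallyClosed R] [Field K]
  [Algebra R K] [IsFractionRing R K] [Field E] [Algebra K E] [Algebra R E] [IsScalarTower R K E]
  [FiniteDimensional K E] [IsGalois K E]
    (q : R[X]) (hq : q.Monic) {y : Fin (defDeg f g) → E}
    (hy : Function.Injective y) (h : q.map (algebraMap R E) = ∏ i, (X - C (y i)))
    (β : ℂ × ℂ → (R →ₐ[ℂ] ℂ)) (hβ : ∀ r, Continuous fun x => β x r)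
    (hβq : ∀ b μ, IsLab f g b μ → b ∈ T →
      q.map (β b : R →+* ℂ) = ∏ i, (X - C (leadC f g b.2 * μ i)))
    {b : ℂ × ℂ} {μ : Fin (defDeg f g) → ℂ} (hb : (b, μ) ∈ LabSpace f g T)
    (h0 : IsSpec (β b : R →+* ℂ) y fun i => leadC f g b.2 * μ i) :
    labMonodromy hb ≤ autPerm K y := fun σ hσ =>
  mem_autPerm_of_isSpec hy (isIntegral_root hq h) (exists_algEquiv_root h) (β b) _
    (fun _ _ hij => hb.1.inj (mul_left_cancel₀ hb.1.lead hij)) σ h0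
    (isSpec_of_joinedIn_labSpace K q hq hy h β hβ hβq hσ h0)

end SpecPath

section PolynomialGrowth
open Set Filter Topology

theorem exists_polynomial_of_growth (k : ℕ) : ∀ {u : ℂ → ℂ}, Differentiable ℂ u →
    ∀ c : ℝ, (∀ z, ‖u z‖ ≤ c * (1 + ‖z‖) ^ k) → ∃ P : ℂ[X], ∀ z, P.eval z = u z := by
  induction k with
  | zero =>
    intro u hu c hc
    obtain ⟨a, ha⟩ := hu.exists_const_forall_eq_of_bounded (isBounded_iff_forall_norm_le.2
      ⟨c, by rintro _ ⟨z, rfl⟩; simpa using hc z⟩)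
    exact ⟨C a, fun z => by simp [ha]⟩
  | succ k ih =>
    intro u hu c hc
    have hc0 : 0 ≤ c := by simpa using (norm_nonneg _).trans (hc 0)
    have hv : Differentiable ℂ (dslope u 0) := by
      rw [← differentiableOn_univ] at hu ⊢
      exact (Complex.differentiableOn_dslope univ_mem).2 hu
    obtain ⟨m, hm⟩ := (isCompact_closedBall (0 : ℂ) 1).exists_bound_of_continuousOn
      hv.continuous.continuousOn
    obtain ⟨P, hP⟩ := ih hv (max m (4 * c)) fun z => by
      have h1 : (1 : ℝ) ≤ (1 + ‖z‖) ^ k := one_le_pow₀ (by linarith [norm_nonneg z])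
      rcases le_total ‖z‖ 1 with hz | hz
      · calc ‖dslope u 0 z‖ ≤ m := hm z (by simpa using hz)
          _ ≤ max m (4 * c) := le_max_left _ _
          _ ≤ _ := le_mul_of_one_le_right ((by positivity : 0 ≤ 4 * c).trans (le_max_right _ _)) h1
      · have hz0 : z ≠ 0 := norm_pos_iff.1 (by linarith)
        rw [dslope_of_ne _ hz0, slope_def_field, norm_div, sub_zero, div_le_iff₀ (by linarith)]
        have h2 : ‖u 0‖ ≤ c := by simpa using hc 0
        have h3 : c ≤ c * (1 + ‖z‖) ^ (k + 1) :=
          le_mul_of_one_le_right hc0 (one_le_pow₀ (by linarith))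
        calc ‖u z - u 0‖ ≤ ‖u z‖ + ‖u 0‖ := norm_sub_le _ _
          _ ≤ 2 * (c * (1 + ‖z‖) ^ (k + 1)) := by linarith [hc z]
          _ = (2 * c * (1 + ‖z‖) ^ k) * (1 + ‖z‖) := by ring
          _ ≤ (2 * c * (1 + ‖z‖) ^ k) * (2 * ‖z‖) := by gcongr; linarith
          _ = (4 * c) * (1 + ‖z‖) ^ k * ‖z‖ := by ring
          _ ≤ _ := by gcongr; exact le_max_right _ _
    refine ⟨C (u 0) + X * P, fun z => ?_⟩
    have := sub_smul_dslope u 0 z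
    simp only [sub_zero, smul_eq_mul] at this
    simp [hP, this]

theorem exists_polynomial_of_differentiableAt_off_finite (S : Finset ℂ) (N : ℂ → ℂ)
    (hd : ∀ t ∉ S, DifferentiableAt ℂ N t) (k : ℕ) (c : ℝ)
    (hc : ∀ t, ‖N t‖ ≤ c * (1 + ‖t‖) ^ k) :
    ∃ P : ℂ[X], ∀ t, P.eval t = (∏ s ∈ S, (X - C s)).eval t ^ 2 * N t := by
  set D : ℂ[X] := ∏ s ∈ S, (X - C s)
  have hc0 : 0 ≤ c := by simpa using (norm_nonneg _).trans (hc 0)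
  obtain ⟨a, l, hal⟩ : ∃ (a : ℝ) (l : ℕ), ∀ t, ‖D.eval t‖ ≤ a * (1 + ‖t‖) ^ l := by
    refine ⟨∑ i ∈ Finset.range (D.natDegree + 1), ‖D.coeff i‖, D.natDegree, fun t => ?_⟩
    rw [eval_eq_sum_range, Finset.sum_mul]
    refine (norm_sum_le _ _).trans (Finset.sum_le_sum fun i hi => ?_)
    rw [norm_mul, norm_pow]
    gcongr
    calc ‖t‖ ^ i ≤ (1 + ‖t‖) ^ i := by gcongr; linarith
      _ ≤ _ := pow_le_pow_right₀ (by linarith [norm_nonneg t]) (Nat.lt_succ_iff.1 (Finset.mem_range.1 hi))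
  refine exists_polynomial_of_growth (l * 2 + k) (fun t => ?_) (a ^ 2 * c) fun t => ?_
  · by_cases ht : t ∈ S
    · have hDt : D.eval t = 0 := by
        rw [eval_prod]
        exact Finset.prod_eq_zero ht (by simp)
      obtain ⟨Q, hQ⟩ := dvd_iff_isRoot.2 hDt
      refine HasDerivAt.differentiableAt (f' := 0) ?_
      rw [hasDerivAt_iff_isLittleO]
      have hb : (fun s => Q.eval s ^ 2 * N s) =O[𝓝 t] (fun _ => (1 : ℂ)) := by
        have h1 : (fun s => Q.eval s ^ 2) =O[𝓝 t] (fun _ => (1 : ℂ)) :=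
          (Q.continuous.pow 2).continuousAt.tendsto.isBigO_one ℂ
        have h2 : N =O[𝓝 t] (fun _ => (1 : ℂ)) := by
          have h3 : (fun s : ℂ => c * (1 + ‖s‖) ^ k) =O[𝓝 t] (fun _ => (1 : ℂ)) :=
            (Continuous.continuousAt (by fun_prop)).tendsto.isBigO_one ℂ
          refine Asymptotics.IsBigO.trans (Asymptotics.IsBigO.of_bound 1 (.of_forall fun s => ?_)) h3
          rw [one_mul]
          exact (hc s).trans (le_abs_self _)
        simpa using h1.mul h2
      have h4 : (fun s : ℂ => (s - t) ^ 2) =o[𝓝 t] (fun s => s - t) := by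
        have : Tendsto (fun s : ℂ => s - t) (𝓝 t) (𝓝 0) := by
          have : Continuous fun s : ℂ => s - t := by fun_prop
          simpa using this.tendsto t
        simpa [pow_two] using ((Asymptotics.isLittleO_one_iff ℂ).2 this).mul_isBigO
          (Asymptotics.isBigO_refl (fun s : ℂ => s - t) (𝓝 t))
      refine ((h4.mul_isBigO hb).congr (fun s => ?_) fun s => by simp)
      rw [hDt, hQ, eval_mul]
      simp
      ring
    · exact ((D.differentiable t).pow 2).mul (hd t ht)
  · rw [norm_mul, norm_pow]
    calc ‖D.eval t‖ ^ 2 * ‖N t‖ ≤ (a * (1 + ‖t‖) ^ l) ^ 2 * (c * (1 + ‖t‖) ^ k) := by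
          gcongr
          · exact hal t
          · exact hc t
      _ = _ := by ring

end PolynomialGrowth

section SliceTrace
open Set Filter Topology

theorem MvPolynomial.exists_norm_eval_le {ι : Type*} (H : MvPolynomial ι ℂ) :
    ∃ (c : ℝ) (k : ℕ), 0 ≤ c ∧ ∀ (v : ι → ℂ) (r : ℝ), 1 ≤ r → (∀ i, ‖v i‖ ≤ r) →
      ‖MvPolynomial.eval v H‖ ≤ c * r ^ k := by
  induction H using MvPolynomial.induction_on with
  | C a => exact ⟨‖a‖, 0, norm_nonneg _, fun v r _ _ => by simp⟩
  | add p q hp hq =>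
    obtain ⟨c, k, hc, h⟩ := hp
    obtain ⟨d, l, hd, h'⟩ := hq
    refine ⟨c + d, k + l, by positivity, fun v r hr hv => ?_⟩
    rw [map_add, add_mul]
    refine (norm_add_le _ _).trans (add_le_add ((h v r hr hv).trans ?_) ((h' v r hr hv).trans ?_))
    · gcongr <;> omega
    · gcongr <;> omega
  | mul_X p i hp =>
    obtain ⟨c, k, hc, h⟩ := hp
    refine ⟨c, k + 1, hc, fun v r hr hv => ?_⟩
    rw [map_mul, MvPolynomial.eval_X, norm_mul, pow_succ, ← mul_assoc]
    exact mul_le_mul (h v r hr hv) (hv i) (norm_nonneg _) (by positivity)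

theorem MvPolynomial.differentiableAt_eval {ι : Type*} (H : MvPolynomial ι ℂ) {v : ℂ → ι → ℂ} {t : ℂ}
    (hv : ∀ i, DifferentiableAt ℂ (fun s => v s i) t) :
    DifferentiableAt ℂ (fun s => MvPolynomial.eval (v s) H) t := by
  induction H using MvPolynomial.induction_on with
  | C a => simp
  | add p q hp hq =>
    simp only [map_add]
    exact hp.fun_add hq
  | mul_X p i hp =>
    simp only [map_mul, MvPolynomial.eval_X]
    exact hp.fun_mul (hv i)

variable {f g : ℂ[X]}

/-- Near a regular value `t`, a labelling of the fiber extends to a differentiable labelling. -/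
theorem IsLab.exists_differentiable_section (hn : defDeg f g ≠ 0) {t ε : ℂ} {μ : Fin (defDeg f g) → ℂ}
    (h : IsLab f g (t, ε) μ) : ∃ ζ : ℂ → Fin (defDeg f g) → ℂ,
      (∀ i, DifferentiableAt ℂ (fun s => ζ s i) t) ∧ ζ t = μ ∧ ∀ᶠ s in 𝓝 t,
        JoinedIn (LabSpace f g {x | x.2 = ε}) ((t, ε), μ) ((s, ε), ζ s) := by
  obtain ⟨ζ, hζ, hev⟩ := h.exists_local_section hn
  have hcont : Continuous fun s : ℂ => (s, ε) := by fun_prop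
  have hev' : ∀ᶠ s in 𝓝 t, ContinuousAt ζ (s, ε) ∧ IsLab f g (s, ε) (ζ (s, ε)) :=
    hcont.continuousAt.eventually hev
  refine ⟨fun s => ζ (s, ε), fun i => ?_, hζ, ?_⟩
  · have h0 : ContinuousAt (fun s => ζ (s, ε) i) t :=
      (continuous_apply i).continuousAt.comp
        (hev'.self_of_nhds.1.comp (f := fun s : ℂ => (s, ε)) hcont.continuousAt)
    have h1 := h.derivative_ne_zero hn i
    refine (HasDerivAt.of_local_left_inverse (f := fun w => f.eval w + ε * g.eval w)
      (f' := f.derivative.eval (μ i) + ε * g.derivative.eval (μ i)) h0 ?_ h1 ?_).differentiableAt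
    · rw [hζ]
      exact (f.hasDerivAt _).add ((g.hasDerivAt _).const_mul ε)
    · filter_upwards [hev'] with s hs
      exact hs.2.root i
  · obtain ⟨r, hr, hball⟩ := Metric.eventually_nhds_iff_ball.1 hev'
    filter_upwards [Metric.ball_mem_nhds t hr] with s hs
    have hj : JoinedIn (Metric.ball t r) t s :=
      ((convex_ball t r).isPathConnected ⟨t, Metric.mem_ball_self hr⟩).joinedIn _
        (Metric.mem_ball_self hr) _ hs
    have h2 := hj.map_continuousOn (f := fun s => ((s, ε), ζ (s, ε))) fun x hx =>
      (ContinuousAt.prodMk (by fun_prop)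
        ((hball x hx).1.comp (f := fun s : ℂ => (s, ε)) hcont.continuousAt)).continuousWithinAt
    simp only [hζ] at h2
    refine h2.mono ?_
    rintro _ ⟨x, hx, rfl⟩
    exact ⟨(hball x hx).2, rfl⟩

theorem exists_linear_bound (f g : ℂ[X]) (ε : ℂ) : ∃ A : ℝ, 1 ≤ A ∧ ∀ t, ‖leadC f g ε‖ * fibBound f g (t, ε) ≤
    A * (1 + ‖t‖) := by
  set S := ∑ k ∈ Finset.range (defDeg f g), (‖f.coeff k‖ + ‖ε‖ * ‖g.coeff k‖)
  have hS : 0 ≤ S := Finset.sum_nonneg fun k _ => by positivity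
  refine ⟨1 + ‖leadC f g ε‖ + S, by linarith [norm_nonneg (leadC f g ε)], fun t => ?_⟩
  have : ‖leadC f g ε‖ * fibBound f g (t, ε) ≤ ‖leadC f g ε‖ + (S + ‖t‖) := by
    rw [fibBound]
    rcases eq_or_ne (leadC f g ε) 0 with h | h
    · simp [h]; positivity
    · have := norm_pos_iff.2 h
      refine le_of_eq ?_
      field_simp
      rfl
  nlinarith [norm_nonneg t, norm_nonneg (leadC f g ε)]

open Classical in
/-- Sums of a polynomial in the labelled roots over the slice monodromy group are polynomials up
to a polynomial denominator. -/
theorem exists_polynomial_sum_slice (hn : defDeg f g ≠ 0) {b : ℂ × ℂ} {μ : Fin (defDeg f g) → ℂ}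
    (hb : (b, μ) ∈ LabSpace f g {x | x.2 = b.2}) (H : MvPolynomial (Fin (defDeg f g)) ℂ) :
    ∃ D P : ℂ[X], D ≠ 0 ∧ ∀ (t : ℂ) (ν : Fin (defDeg f g) → ℂ),
      JoinedIn (LabSpace f g {x | x.2 = b.2}) (b, μ) ((t, b.2), ν) →
      P.eval t = D.eval t ^ 2 * ∑ σ ∈ Finset.univ.filter (· ∈ labMonodromy hb),
        MvPolynomial.eval (fun i => leadC f g b.2 * ν (σ i)) H := by
  obtain ⟨t₀, ε⟩ := b
  dsimp only at hb ⊢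
  set T : Set (ℂ × ℂ) := {x | x.2 = ε}
  set S := Finset.univ.filter (· ∈ labMonodromy hb)
  set c := leadC f g ε
  have hc : c ≠ 0 := hb.1.lead
  have hreach : ∀ t, (t, ε) ∉ sigmaFin f g → ∃ ν, JoinedIn (LabSpace f g T) ((t₀, ε), μ) ((t, ε), ν) :=
    fun t ht => exists_joinedIn_labSpace hn (joinedIn_slice hn (hb.1.notMem_sigmaFin hn) ht) hb.1
  let F : (Fin (defDeg f g) → ℂ) → ℂ := fun ν =>
    ∑ σ ∈ S, MvPolynomial.eval (fun i => c * ν (σ i)) H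
  have hF : ∀ t ν ν', JoinedIn (LabSpace f g T) ((t₀, ε), μ) ((t, ε), ν) →
      JoinedIn (LabSpace f g T) ((t₀, ε), μ) ((t, ε), ν') → F ν' = F ν := by
    intro t ν ν' h h'
    obtain ⟨τ, rfl⟩ := IsLab.exists_perm (f := f) (g := g) h.target_mem.1 hn h'.target_mem.1
    have hτ : τ ∈ labMonodromy hb := h'.trans (h.symm.labSpace_perm τ)
    refine Finset.sum_bij' (fun σ _ => τ * σ) (fun σ _ => τ⁻¹ * σ) ?_ ?_ ?_ ?_ ?_
    · intro σ hσ
      simp only [S, Finset.mem_filter, Finset.mem_univ, true_and] at hσ ⊢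
      exact mul_mem hτ hσ
    · intro σ hσ
      simp only [S, Finset.mem_filter, Finset.mem_univ, true_and] at hσ ⊢
      exact mul_mem (inv_mem hτ) hσ
    · intro σ _; simp
    · intro σ _; simp
    · intro σ _; rfl
  choose! ν hν using hreach
  let N : ℂ → ℂ := fun t => if (t, ε) ∉ sigmaFin f g then F (ν t) else 0
  have hfin := finite_slice_sigmaFin hn hc
  obtain ⟨A, hA1, hA⟩ := exists_linear_bound f g ε
  obtain ⟨d, k, hd, hH⟩ := H.exists_norm_eval_le
  obtain ⟨P, hP⟩ := exists_polynomial_of_differentiableAt_off_finite hfin.toFinset N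
    (fun t ht => by
      have ht' : (t, ε) ∉ sigmaFin f g := by simpa using ht
      obtain ⟨ζ, hζd, hζt, hζ⟩ := IsLab.exists_differentiable_section (f := f) (g := g) hn
        (hν t ht').target_mem.1
      have h1 : DifferentiableAt ℂ (fun s => F (ζ s)) t :=
        DifferentiableAt.fun_sum fun σ _ => H.differentiableAt_eval fun i =>
          (hζd (σ i)).const_mul c
      refine h1.congr_of_eventuallyEq ?_
      filter_upwards [hζ] with s hs
      have hs' : (s, ε) ∉ sigmaFin f g := hs.target_mem.1.notMem_sigmaFin hn
      simp only [N, if_pos hs']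
      exact hF s _ _ ((hν t ht').trans hs) (hν s hs'))
    k (S.card * (d * A ^ k)) (fun t => by
      by_cases ht : (t, ε) ∉ sigmaFin f g
      · simp only [N, if_pos ht]
        calc ‖F (ν t)‖ ≤ ∑ σ ∈ S, d * (A * (1 + ‖t‖)) ^ k := by
              refine (norm_sum_le _ _).trans (Finset.sum_le_sum fun σ _ => hH _ _ ?_ fun i => ?_)
              · nlinarith [norm_nonneg t]
              · rw [norm_mul]
                refine le_trans ?_ (hA t)
                gcongr
                exact norm_le_fibBound hn hc ((hν t ht).target_mem.1.root _)
          _ = _ := by rw [Finset.sum_const, nsmul_eq_mul, mul_pow]; ring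
      · simp only [N, if_neg ht, norm_zero]
        positivity)
  refine ⟨∏ s ∈ hfin.toFinset, (X - C s), P,
    Finset.prod_ne_zero_iff.2 fun s _ => X_sub_C_ne_zero s, fun t ν' hν' => ?_⟩
  have ht : (t, ε) ∉ sigmaFin f g := hν'.target_mem.1.notMem_sigmaFin hn
  rw [hP t]
  simp only [N, if_pos ht]
  rw [hF t ν' (ν t) hν' (hν t ht)]

end SliceTrace

section SliceGalois
variable {f g : ℂ[X]}

theorem coe_polynomial_aeval_eq (t : ℂ) : ((aeval t : ℂ[X] →ₐ[ℂ] ℂ) : ℂ[X] →+* ℂ) = evalRingHom t := by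
  ext <;> simp

theorem monic_sliceEquation (hn : defDeg f g ≠ 0) {ε : ℂ} (hc : leadC f g ε ≠ 0) :
    (sliceEquation f g ε).Monic := by
  have hm := monic_monicFamily (f := f) (g := g) hc
  refine shiftPoly_monic (hm.map _) ?_ _
  rwa [hm.natDegree_map, natDegree_monicFamily hc]

theorem autPerm_le_labMonodromy_slice (hn : defDeg f g ≠ 0) {b : ℂ × ℂ} {μ : Fin (defDeg f g) → ℂ}
    (hb : (b, μ) ∈ LabSpace f g {x | x.2 = b.2}) {K E : Type*} [Field K] [Algebra ℂ[X] K]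
    [IsFractionRing ℂ[X] K] [Field E] [Algebra K E] [Algebra ℂ[X] E] [IsScalarTower ℂ[X] K E]
    [Algebra ℂ E] [IsScalarTower ℂ ℂ[X] E] [FiniteDimensional K E] [IsGalois K E]
    {y : Fin (defDeg f g) → E} (hy : Function.Injective y)
    (h : (sliceEquation f g b.2).map (algebraMap ℂ[X] E) = ∏ i, (X - C (y i)))
    (h0 : IsSpec (evalRingHom b.1) y fun i => leadC f g b.2 * μ i) :
    autPerm K y ≤ labMonodromy hb := by
  classical
  have hq := monic_sliceEquation hn hb.1.lead
  set c := leadC f g b.2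
  refine autPerm_le_of_sum_mem_range hy (labMonodromy hb)
    (Finset.univ.filter (· ∈ labMonodromy hb)) (by simp) (fun φ a => ?_) fun H => ?_
  · rw [IsScalarTower.algebraMap_apply ℂ ℂ[X] E, IsScalarTower.algebraMap_apply ℂ[X] K E, φ.commutes]
  obtain ⟨D, P, hD, hP⟩ := exists_polynomial_sum_slice hn hb H
  set S := Finset.univ.filter (· ∈ labMonodromy hb)
  let Q : MvPolynomial (Fin (defDeg f g)) ℂ[X] := MvPolynomial.C (D ^ 2) *
    ∑ σ ∈ S, MvPolynomial.rename σ (MvPolynomial.map (algebraMap ℂ ℂ[X]) H) - MvPolynomial.C P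
  have hQ : MvPolynomial.aeval y Q = 0 := by
    have hfin := finite_slice_sigmaFin (f := f) (g := g) hn hb.1.lead
    refine aeval_eq_zero_of_isSpec (K := K) hy (isIntegral_root hq h) (exists_algEquiv_root h) Q
      {β | ∃ t, (t, b.2) ∉ sigmaFin f g ∧ β = evalRingHom t} (fun r hr => ?_) ?_
    · refine eq_zero_of_infinite_isRoot r (hfin.infinite_compl.mono fun t ht => ?_)
      exact hr _ ⟨t, ht, rfl⟩
    · rintro _ ⟨t, ht, rfl⟩
      obtain ⟨ν, hν⟩ := exists_joinedIn_labSpace (T := {x | x.2 = b.2}) hn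
        (joinedIn_slice (t := b.1) hn (hb.1.notMem_sigmaFin hn) ht) hb.1
      have h1 := isSpec_of_joinedIn_labSpace K _ hq hy h (fun x => (aeval x.1 : ℂ[X] →ₐ[ℂ] ℂ))
        (fun r => r.continuous_aeval.comp continuous_fst) (fun b' μ' hl hT => by
          have hT' : b'.2 = b.2 := hT
          rw [coe_polynomial_aeval_eq, ← hT']
          exact hl.map_sliceEquation hn) hν (by rwa [coe_polynomial_aeval_eq])
      rw [coe_polynomial_aeval_eq] at h1
      refine ⟨_, h1, ?_⟩
      have h2 : ∀ σ : Equiv.Perm (Fin (defDeg f g)),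
          MvPolynomial.eval₂ (evalRingHom t) (fun i => leadC f g b.2 * ν i)
            (MvPolynomial.rename σ (MvPolynomial.map (algebraMap ℂ ℂ[X]) H)) =
          MvPolynomial.eval (fun i => leadC f g b.2 * ν (σ i)) H := fun σ => by
        have h3 : (evalRingHom t).comp (algebraMap ℂ ℂ[X]) = RingHom.id ℂ := by ext; simp
        rw [MvPolynomial.eval₂_rename, MvPolynomial.eval₂_map, h3]
        rfl
      simp only [Q, MvPolynomial.eval₂_sub, MvPolynomial.eval₂_mul, MvPolynomial.eval₂_C,
        MvPolynomial.eval₂_sum, h2]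
      rw [sub_eq_zero]
      simpa using (hP t ν hν).symm
  have hDE : algebraMap ℂ[X] E (D ^ 2) ≠ 0 := by
    rw [IsScalarTower.algebraMap_apply ℂ[X] K E, Ne, FaithfulSMul.algebraMap_eq_zero_iff K E,
      IsFractionRing.to_map_eq_zero_iff]
    exact pow_ne_zero _ hD
  refine ⟨algebraMap ℂ[X] K P / algebraMap ℂ[X] K (D ^ 2), ?_⟩
  rw [map_div₀, ← IsScalarTower.algebraMap_apply, ← IsScalarTower.algebraMap_apply, div_eq_iff hDE]
  simp only [Q, map_sub, map_mul, MvPolynomial.algHom_C, map_sum, MvPolynomial.aeval_rename,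
    MvPolynomial.aeval_map_algebraMap, sub_eq_zero] at hQ
  rw [← hQ, mul_comm]
  rfl

theorem card_slice_le (hn : defDeg f g ≠ 0) {b : ℂ × ℂ} {μ : Fin (defDeg f g) → ℂ}
    (hb : (b, μ) ∈ LabSpace f g {x | x.2 = b.2}) :
    Nat.card (SliceField ((monicFamily f g).map (evalRingHom b.2))
      ((leadPoly f g ^ (defDeg f g - 1)).eval b.2) ≃ₐ[FractionRing ℂ[X]]
      SliceField ((monicFamily f g).map (evalRingHom b.2))
      ((leadPoly f g ^ (defDeg f g - 1)).eval b.2)) ≤ Nat.card (labMonodromy hb) := by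
  have hq := monic_sliceEquation hn hb.1.lead
  set E := SliceField ((monicFamily f g).map (evalRingHom b.2))
      ((leadPoly f g ^ (defDeg f g - 1)).eval b.2)
  have : IsGalois (FractionRing ℂ[X]) E :=
    isGalois_of_isSplittingField ((sliceEquation f g b.2).map (algebraMap ℂ[X] (FractionRing ℂ[X])))
  have := IsSplittingField.finiteDimensional E
    ((sliceEquation f g b.2).map (algebraMap ℂ[X] (FractionRing ℂ[X])))
  have hμ : Function.Injective fun i => leadC f g b.2 * μ i := fun i j hij =>
    hb.1.inj (mul_left_cancel₀ hb.1.lead hij)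
  obtain ⟨y, hy, h, h0⟩ := exists_roots_isSpec (K := FractionRing ℂ[X]) (E := E)
    (sliceEquation f g b.2) hq (aeval b.1) hμ
    (by rw [coe_polynomial_aeval_eq]; exact hb.1.map_sliceEquation hn)
  rw [coe_polynomial_aeval_eq] at h0
  rw [← card_autPerm (K := FractionRing ℂ[X]) hq hy h]
  exact Nat.card_le_card_of_injective _ (Subgroup.inclusion_injective
    (autPerm_le_labMonodromy_slice (K := FractionRing ℂ[X]) hn hb hy h h0))

end SliceGalois

section DeformationGalois
variable {f g : ℂ[X]}

theorem monic_defEquation (hn : defDeg f g ≠ 0) {ε : ℂ} (hc : leadC f g ε ≠ 0) :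
    (defEquation f g).Monic :=
  shiftPoly_monic (monic_monicFamily hc) (by rwa [natDegree_monicFamily hc]) _

section Field
variable {K E : Type*} [Field K] [CharZero K] [Algebra ℂ[X][X] K] [IsFractionRing ℂ[X][X] K]
  [Field E] [Algebra K E] [Algebra ℂ[X][X] E] [IsScalarTower ℂ[X][X] K E]

theorem exists_labMonodromy_le_autPerm (hn : defDeg f g ≠ 0) {b : ℂ × ℂ} {μ : Fin (defDeg f g) → ℂ}
    (hb : (b, μ) ∈ LabSpace f g Set.univ)
    [IsSplittingField K E ((defEquation f g).map (algebraMap ℂ[X][X] K))] :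
    ∃ y : Fin (defDeg f g) → E, Function.Injective y ∧
      (defEquation f g).map (algebraMap ℂ[X][X] E) = ∏ i, (X - C (y i)) ∧
      labMonodromy hb ≤ autPerm K y := by
  have hq := monic_defEquation hn hb.1.lead
  have : IsGalois K E := isGalois_of_isSplittingField ((defEquation f g).map (algebraMap ℂ[X][X] K))
  have := IsSplittingField.finiteDimensional E ((defEquation f g).map (algebraMap ℂ[X][X] K))
  have hβq : ∀ b μ, IsLab f g b μ → b ∈ (Set.univ : Set (ℂ × ℂ)) →
      (defEquation f g).map (evalPoint b : ℂ[X][X] →+* ℂ) =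
        ∏ i, (X - C (leadC f g b.2 * μ i)) := fun b μ hl _ => by
    rw [map_evalPoint_eq, hl.map_sliceEquation hn]
  obtain ⟨y, hy, h, h0⟩ := exists_roots_isSpec (K := K) (E := E) (defEquation f g) hq (evalPoint b)
    (fun i j hij => hb.1.inj (mul_left_cancel₀ hb.1.lead hij)) (hβq b μ hb.1 trivial)
  exact ⟨y, hy, h, labMonodromy_le_autPerm K _ hq hy h evalPoint continuous_evalPoint hβq hb h0⟩

theorem finite_card_labMonodromy_lt (K E : Type*) [Field K] [CharZero K] [Algebra ℂ[X][X] K]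
    [IsFractionRing ℂ[X][X] K] [Field E] [Algebra K E] [Algebra ℂ[X][X] E] [IsScalarTower ℂ[X][X] K E]
    (hn : defDeg f g ≠ 0) {ε : ℂ} (hc : leadC f g ε ≠ 0)
    [IsSplittingField K E ((defEquation f g).map (algebraMap ℂ[X][X] K))] :
    ∃ Z : Set ℂ, Z.Finite ∧ ∀ (b : ℂ × ℂ) (μ : Fin (defDeg f g) → ℂ)
      (hb : (b, μ) ∈ LabSpace f g {x | x.2 = b.2}), b.2 ∉ Z →
        Nat.card (E ≃ₐ[K] E) ≤ Nat.card (labMonodromy hb) := by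
  refine ⟨_, finite_card_slice_lt (K := K) (E := E) (monicFamily f g) (monic_monicFamily hc)
    (leadPoly f g ^ (defDeg f g - 1)) (pow_ne_zero _ (leadPoly_ne_zero hc))
    (by rwa [natDegree_monicFamily hc]), fun b μ hb hZ => ?_⟩
  refine le_trans ?_ (card_slice_le hn hb)
  by_contra! hlt
  refine hZ ⟨?_, hlt⟩
  rw [eval_pow, eval_leadPoly]
  exact pow_ne_zero _ hb.1.lead

theorem exists_joinedIn_generic (hn : defDeg f g ≠ 0) {b : ℂ × ℂ} {μ : Fin (defDeg f g) → ℂ}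
    (hb : IsLab f g b μ) {t ε : ℂ} (h : (t, ε) ∉ sigmaFin f g) :
    ∃ ν, JoinedIn (LabSpace f g Set.univ) (b, μ) ((t, ε), ν) :=
  exists_joinedIn_labSpace hn ((joinedIn_compl_sigmaFin hn (hb.notMem_sigmaFin hn) h).mono
    fun _ hx => ⟨hx, trivial⟩) hb

/-- The monodromy group is the Galois group. -/
theorem nonempty_labMonodromy_mulEquiv (K E : Type*) [Field K] [CharZero K] [Algebra ℂ[X][X] K]
    [IsFractionRing ℂ[X][X] K] [Field E] [Algebra K E] [Algebra ℂ[X][X] E] [IsScalarTower ℂ[X][X] K E]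
    (hn : defDeg f g ≠ 0) {b : ℂ × ℂ} {μ : Fin (defDeg f g) → ℂ}
    (hb : (b, μ) ∈ LabSpace f g Set.univ)
    [IsSplittingField K E ((defEquation f g).map (algebraMap ℂ[X][X] K))] :
    Nonempty (labMonodromy hb ≃* (E ≃ₐ[K] E)) := by
  have hq := monic_defEquation hn hb.1.lead
  obtain ⟨y, hy, h, hle⟩ := exists_labMonodromy_le_autPerm (K := K) (E := E) hn hb
  obtain ⟨Z, hZ, hcard⟩ := finite_card_labMonodromy_lt K E hn hb.1.lead
  obtain ⟨ε, hε⟩ := (hZ.union (finite_leadC_eq_zero ⟨_, hb.1.lead⟩)).infinite_compl.nonempty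
  have hε' : ε ∉ Z ∧ leadC f g ε ≠ 0 := by simpa [not_or] using hε
  obtain ⟨t, ht⟩ := exists_notMem_sigmaFin (f := f) (g := g) hn hε'.2
  obtain ⟨ν, hν⟩ := exists_joinedIn_generic hn hb.1 ht
  have hsl : ((t, ε), ν) ∈ LabSpace f g {x : ℂ × ℂ | x.2 = (t, ε).2} := ⟨hν.target_mem.1, rfl⟩
  have h1 : Nat.card (labMonodromy hsl) ≤ Nat.card (labMonodromy hb) := by
    rw [labMonodromy_eq_of_joinedIn hν]
    exact Nat.card_le_card_of_injective _ (Subgroup.inclusion_injective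
      (labMonodromy_mono (Set.subset_univ _) hsl hν.target_mem))
  have h2 : labMonodromy hb = autPerm K y := by
    refine SetLike.coe_injective (Set.eq_of_subset_of_ncard_le hle ?_ (Set.toFinite _))
    have h3 := ((card_autPerm (K := K) hq hy h).le.trans (hcard _ _ hsl hε'.1)).trans h1
    exact h3
  rw [h2]
  exact exists_autPerm_equiv y hy (adjoin_range_eq_top hq h) _ (aeval_map_eq_zero_iff (K := K) h)

/-- For all but finitely many `ε`, the slice monodromy group is as large as the full one. -/
theorem finite_card_slice_lt_card (K E : Type*) [Field K] [CharZero K] [Algebra ℂ[X][X] K]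
    [IsFractionRing ℂ[X][X] K] [Field E] [Algebra K E] [Algebra ℂ[X][X] E] [IsScalarTower ℂ[X][X] K E]
    (hn : defDeg f g ≠ 0) {b₀ : ℂ × ℂ} {μ₀ : Fin (defDeg f g) → ℂ}
    (hb₀ : (b₀, μ₀) ∈ LabSpace f g Set.univ)
    [IsSplittingField K E ((defEquation f g).map (algebraMap ℂ[X][X] K))] :
    ∃ Z : Set ℂ, Z.Finite ∧ ∀ (b : ℂ × ℂ) (μ : Fin (defDeg f g) → ℂ)
      (hb : (b, μ) ∈ LabSpace f g {x | x.2 = b.2}), b.2 ∉ Z →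
        Nat.card (labMonodromy hb₀) ≤ Nat.card (labMonodromy hb) := by
  obtain ⟨e⟩ := nonempty_labMonodromy_mulEquiv K E hn hb₀
  rw [Nat.card_congr e.toEquiv]
  exact finite_card_labMonodromy_lt K E hn hb₀.1.lead

end Field

end DeformationGalois

section RationalFunctionField
variable {f g : ℂ[X]}

theorem isSplittingField_of_comp_eq {K E : Type*} [Field K] [Field E] [Algebra K E] {p q : K[X]}
    {c k : K} (hc : c ≠ 0) (hq : q ≠ 0) (h : q.comp (C c * X) = C k * p)
    [hp : IsSplittingField K E p] : IsSplittingField K E q := by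
  have h' : q = (C k * p).comp (C c⁻¹ * X) := by
    rw [← h, comp_assoc]
    simp [← mul_assoc, ← C_mul, hc]
  have hroot : ∀ x : E, aeval x p = 0 → aeval (algebraMap K E c * x) q = 0 := fun x hx => by
    have := congrArg (aeval x) h
    rw [aeval_comp] at this
    simpa [hx] using this
  refine ⟨?_, ?_⟩
  · rw [h', Polynomial.map_comp, Polynomial.map_mul, Polynomial.map_C]
    refine Splits.comp_of_natDegree_le_one ?_ ?_
    · exact (Splits.C _).mul hp.splits
    · rw [Polynomial.map_mul, map_C, map_X]
      exact natDegree_C_mul_le _ _ |>.trans natDegree_X_le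
  · rw [eq_top_iff, ← hp.adjoin_rootSet, Algebra.adjoin_le_iff]
    intro x hx
    have h1 : algebraMap K E c * x ∈ Algebra.adjoin K (q.rootSet E) :=
      Algebra.subset_adjoin ((mem_rootSet).2 ⟨hq, hroot x (mem_rootSet.1 hx).2⟩)
    have h2 : x = c⁻¹ • (algebraMap K E c * x) := by
      rw [← Algebra.smul_def, smul_smul, inv_mul_cancel₀ hc, one_smul]
    rw [h2]
    exact Subalgebra.smul_mem _ h1 _

/-- `ℂ[ε][t]` and `ℂ[t, ε]` are isomorphic. -/
def polyEquiv : ℂ[X][X] ≃+* MvPolynomial (Fin 2) ℂ :=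
  RingEquiv.ofRingHom (eval₂RingHom (eval₂RingHom MvPolynomial.C (MvPolynomial.X 1)) (MvPolynomial.X 0))
    (MvPolynomial.eval₂Hom (C.comp C) ![X, C X])
    (by ext i <;> [simp; fin_cases i <;> simp]) (by ext <;> simp)

theorem nonempty_labMonodromy_mulEquiv_gal (hn : defDeg f g ≠ 0) {b : ℂ × ℂ}
    {μ : Fin (defDeg f g) → ℂ} (hb : (b, μ) ∈ LabSpace f g Set.univ) :
    Nonempty (labMonodromy hb ≃* (defPoly f g).Gal) := by
  let : Algebra ℂ[X][X] Kte :=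
    ((algebraMap (MvPolynomial (Fin 2) ℂ) Kte).comp (polyEquiv : ℂ[X][X] →+* _)).toAlgebra
  have halg : ∀ r, algebraMap ℂ[X][X] Kte r = algebraMap (MvPolynomial (Fin 2) ℂ) Kte (polyEquiv r) :=
    fun _ => rfl
  have : IsFractionRing ℂ[X][X] Kte := by
    have h := IsLocalization.isLocalization_of_base_ringEquiv
      (nonZeroDivisors (MvPolynomial (Fin 2) ℂ)) Kte polyEquiv.symm
    rw [MulEquivClass.map_nonZeroDivisors] at h
    exact h
  have hlc := hb.1.lead
  set ψ : ℂ[X] →+* Kte := (algebraMap ℂ[X][X] Kte).comp C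
  have hψinj : Function.Injective ψ := (IsFractionRing.injective ℂ[X][X] Kte).comp C_injective
  have hψX : ψ X = eVar := by
    simp [ψ, halg, polyEquiv, eVar]
  have hψC : ψ.comp C = cEmb := by
    ext a
    simp [ψ, halg, polyEquiv, cEmb]
  have hX : algebraMap ℂ[X][X] Kte X = tVar := by
    simp [halg, polyEquiv, tVar]
  have hF : (defFamily f g).map ψ = f.map cEmb + C eVar * g.map cEmb := by
    simp [defFamily, Polynomial.map_map, hψC, hψX]
  have hc : ψ (leadPoly f g) ≠ 0 := (map_ne_zero_iff ψ hψinj).2 (leadPoly_ne_zero hlc)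
  have hcomp : ((defEquation f g).map (algebraMap ℂ[X][X] Kte)).comp (C (ψ (leadPoly f g)) * X) =
      C (ψ (leadPoly f g) ^ (defDeg f g - 1)) * defPoly f g := by
    have h1 := integralNormalization_eval₂_leadingCoeff_mul (p := defFamily f g)
      (by rw [natDegree_defFamily hlc]; omega) ((C : Kte →+* Kte[X]).comp ψ) X
    rw [leadingCoeff_defFamily hlc, natDegree_defFamily hlc, ← eval₂_map, ← eval₂_map, hF,
      eval₂_C_X] at h1
    have h2 : (defEquation f g).map (algebraMap ℂ[X][X] Kte) = (monicFamily f g).map ψ -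
        C (ψ (leadPoly f g) ^ (defDeg f g - 1) * tVar) := by
      rw [defEquation, shiftPoly, Polynomial.map_sub, Polynomial.map_map, map_C, map_mul, hX]
      simp [ψ]
    rw [h2, sub_comp, C_comp, comp, monicFamily]
    rw [RingHom.comp_apply] at h1
    rw [h1, defPoly]
    simp
    ring
  have := isSplittingField_of_comp_eq (E := (defPoly f g).SplittingField) hc
    ((monic_defEquation hn hlc).map _).ne_zero hcomp
  exact nonempty_labMonodromy_mulEquiv Kte (defPoly f g).SplittingField hn hb

theorem finite_card_labMonodromy_slice_lt (hn : defDeg f g ≠ 0) {b₀ : ℂ × ℂ}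
    {μ₀ : Fin (defDeg f g) → ℂ} (hb₀ : (b₀, μ₀) ∈ LabSpace f g Set.univ) :
    ∃ Z : Set ℂ, Z.Finite ∧ ∀ (b : ℂ × ℂ) (μ : Fin (defDeg f g) → ℂ)
      (hb : (b, μ) ∈ LabSpace f g {x | x.2 = b.2}), b.2 ∉ Z →
        Nat.card (labMonodromy hb₀) ≤ Nat.card (labMonodromy hb) := by
  let K := FractionRing ℂ[X][X]
  let E := ((defEquation f g).map (algebraMap ℂ[X][X] K)).SplittingField
  have : CharZero K := charZero_of_injective_algebraMap (IsFractionRing.injective ℂ[X][X] K)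
  exact finite_card_slice_lt_card K E hn hb₀

end RationalFunctionField

section Motion
open Filter Topology

theorem exists_separation (T : Finset ℂ) :
    ∃ ρ : ℝ, 0 < ρ ∧ ∀ τ ∈ T, ∀ τ' ∈ T, τ ≠ τ' → ρ ≤ dist τ τ' := by
  have h : ∀ᶠ ρ : ℝ in 𝓝[>] 0, ∀ τ ∈ T, ∀ τ' ∈ T, τ ≠ τ' → ρ ≤ dist τ τ' := by
    rw [Filter.eventually_all_finset]
    intro τ _
    rw [Filter.eventually_all_finset]
    intro τ' _
    by_cases hne : τ = τ'
    · simp [hne]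
    · filter_upwards [nhdsWithin_le_nhds (eventually_lt_nhds (dist_pos.2 hne))] with ρ hρ _
      exact hρ.le
  obtain ⟨ρ, hρ, hpos⟩ := (h.and self_mem_nhdsWithin).exists
  exact ⟨ρ, hpos, hρ⟩

/-- The Lipschitz bump of radius `ρ` around `τ`. -/
def bump (ρ : ℝ) (τ t : ℂ) : ℝ := max 0 (1 - dist t τ / ρ)

theorem continuous_bump (ρ : ℝ) (τ : ℂ) : Continuous (bump ρ τ) := by
  unfold bump
  fun_prop

theorem bump_self (ρ : ℝ) (τ : ℂ) : bump ρ τ τ = 1 := by simp [bump]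

theorem bump_eq_zero {ρ : ℝ} (hρ : 0 < ρ) {τ t : ℂ} (h : ρ ≤ dist t τ) : bump ρ τ t = 0 := by
  rw [bump, max_eq_left]
  have := (one_le_div hρ).2 h
  linarith

theorem abs_bump_sub_bump_le {ρ : ℝ} (hρ : 0 < ρ) (τ t t' : ℂ) :
    |bump ρ τ t - bump ρ τ t'| ≤ ‖t - t'‖ / ρ := by
  unfold bump
  rw [max_comm, max_comm 0]
  refine (abs_max_sub_max_le_abs _ _ _).trans ?_
  rw [show 1 - dist t τ / ρ - (1 - dist t' τ / ρ) = (dist t' τ - dist t τ) / ρ by ring, abs_div,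
    abs_of_pos hρ]
  gcongr
  rw [abs_sub_comm, ← dist_eq_norm]
  exact abs_dist_sub_le _ _ _

/-- A continuous motion of the plane which starts from the identity and moves the points of a
finite set along prescribed continuous functions. -/
theorem exists_motion (T : Finset ℂ) (φ : ℂ → ℂ → ℂ) (ε₁ : ℂ) (h1 : ∀ τ ∈ T, φ τ ε₁ = τ)
    (hφ : ∀ τ ∈ T, ∀ᶠ ε in 𝓝 ε₁, ContinuousAt (φ τ) ε) :
    ∃ Ψ : ℂ → ℂ → ℂ, (∀ t, Ψ ε₁ t = t) ∧ ∀ᶠ ε in 𝓝 ε₁,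
      (∀ t, ContinuousAt (Function.uncurry Ψ) (ε, t)) ∧ (∃ e : ℂ ≃ₜ ℂ, ∀ t, e t = Ψ ε t) ∧
      ∀ τ ∈ T, Ψ ε τ = φ τ ε := by
  obtain ⟨ρ, hρ, hsep⟩ := exists_separation T
  refine ⟨fun ε t => t + ∑ τ ∈ T, (bump ρ τ t : ℂ) * (φ τ ε - τ), fun t => ?_, ?_⟩
  · beta_reduce
    rw [Finset.sum_eq_zero fun τ hτ => ?_, add_zero]
    rw [h1 τ hτ, sub_self, mul_zero]
  have hsmall : ∀ᶠ ε in 𝓝 ε₁, ∑ τ ∈ T, ‖φ τ ε - τ‖ / ρ < 1 / 2 := by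
    have hc : ContinuousAt (fun ε => ∑ τ ∈ T, ‖φ τ ε - τ‖ / ρ) ε₁ :=
      tendsto_finsetSum _ fun τ hτ =>
        (((hφ τ hτ).self_of_nhds.sub continuousAt_const).norm.div_const ρ)
    refine hc.eventually_lt_const ?_
    beta_reduce
    rw [Finset.sum_eq_zero fun τ hτ => ?_]
    · norm_num
    · rw [h1 τ hτ, sub_self, norm_zero, zero_div]
  filter_upwards [hsmall, (Filter.eventually_all_finset T).2 hφ] with ε hs hcont
  refine ⟨fun t => ?_, ?_, fun τ hτ => ?_⟩
  · refine continuousAt_snd.add (tendsto_finsetSum _ fun τ hτ => ?_)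
    refine ContinuousAt.mul (f := fun p : ℂ × ℂ => ((bump ρ τ p.2 : ℝ) : ℂ))
      (g := fun p : ℂ × ℂ => φ τ p.1 - τ) ?_ ?_
    · exact (Complex.continuous_ofReal.comp ((continuous_bump ρ τ).comp
        continuous_snd)).continuousAt
    · exact (ContinuousAt.comp (f := Prod.fst) (x := (ε, t)) (hcont τ hτ) continuousAt_fst).sub
        continuousAt_const
  · have hA : ApproximatesLinearOn (fun t : ℂ => t + ∑ τ ∈ T, (bump ρ τ t : ℂ) * (φ τ ε - τ))
        ((ContinuousLinearEquiv.refl ℂ ℂ : ℂ ≃L[ℂ] ℂ) : ℂ →L[ℂ] ℂ) Set.univ (1 / 2) := by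
      intro x _ y _
      have : x + ∑ τ ∈ T, (bump ρ τ x : ℂ) * (φ τ ε - τ) -
          (y + ∑ τ ∈ T, (bump ρ τ y : ℂ) * (φ τ ε - τ)) -
          ((ContinuousLinearEquiv.refl ℂ ℂ : ℂ ≃L[ℂ] ℂ) : ℂ →L[ℂ] ℂ) (x - y) =
          ∑ τ ∈ T, ((bump ρ τ x - bump ρ τ y : ℝ) : ℂ) * (φ τ ε - τ) := by
        simp only [Complex.ofReal_sub, sub_mul, Finset.sum_sub_distrib]
        simp
        ring
      rw [this]
      refine (norm_sum_le _ _).trans ?_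
      calc ∑ τ ∈ T, ‖((bump ρ τ x - bump ρ τ y : ℝ) : ℂ) * (φ τ ε - τ)‖
          ≤ ∑ τ ∈ T, (‖φ τ ε - τ‖ / ρ) * ‖x - y‖ := by
            refine Finset.sum_le_sum fun τ _ => ?_
            rw [norm_mul, Complex.norm_real, Real.norm_eq_abs]
            calc _ ≤ (‖x - y‖ / ρ) * ‖φ τ ε - τ‖ := by
                  gcongr
                  exact abs_bump_sub_bump_le hρ _ _ _
              _ = _ := by ring
        _ ≤ _ := by
            rw [← Finset.sum_mul]
            gcongr
            simpa using hs.le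
    refine ⟨hA.toHomeomorph _ (Or.inr ?_), fun t => rfl⟩
    rw [ContinuousLinearEquiv.refl_symm, ContinuousLinearEquiv.coe_refl,
      ContinuousLinearMap.nnnorm_id]
    norm_num
  · change τ + ∑ τ' ∈ T, (bump ρ τ' τ : ℂ) * (φ τ' ε - τ') = _
    rw [Finset.sum_eq_single_of_mem τ hτ fun τ' hτ' hne => by
      rw [bump_eq_zero hρ (hsep τ hτ τ' hτ' hne.symm)]; simp, bump_self]
    simp

end Motion

section Branches
open Filter Topology

variable {f g : ℂ[X]}

theorem defDeg_derivative : defDeg (derivative f) (derivative g) = defDeg f g - 1 := by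
  unfold defDeg
  rw [natDegree_derivative, natDegree_derivative]
  omega

theorem leadC_derivative (hn : defDeg f g ≠ 0) (ε : ℂ) :
    leadC (derivative f) (derivative g) ε = defDeg f g * leadC f g ε := by
  obtain ⟨k, hk⟩ := Nat.exists_eq_succ_of_ne_zero hn
  rw [leadC, leadC, defDeg_derivative, coeff_derivative, coeff_derivative, hk]
  simp only [Nat.succ_eq_add_one, Nat.add_sub_cancel]
  push_cast
  ring

theorem eventually_norm_le_of_critical (hn : defDeg f g ≠ 0) {ε₁ : ℂ} (hc : leadC f g ε₁ ≠ 0) :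
    ∃ R, ∀ᶠ ε in 𝓝 ε₁, ∀ w, f.derivative.eval w + ε * g.derivative.eval w = 0 → ‖w‖ ≤ R := by
  have hev : ∀ᶠ ε in 𝓝 ε₁, leadC f g ε ≠ 0 :=
    continuous_leadC.continuousAt.eventually_ne hc
  have hn' : (defDeg f g : ℂ) ≠ 0 := Nat.cast_ne_zero.2 hn
  by_cases hn1 : defDeg (derivative f) (derivative g) = 0
  · refine ⟨0, ?_⟩
    filter_upwards [hev] with ε hε w hw
    have h0 : (derivative f).natDegree = 0 ∧ (derivative g).natDegree = 0 := by
      unfold defDeg at hn1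
      omega
    have h1 := leadC_derivative hn ε
    rw [eq_C_of_natDegree_eq_zero h0.1, eq_C_of_natDegree_eq_zero h0.2, eval_C, eval_C] at hw
    rw [leadC, hn1, hw] at h1
    exact absurd h1.symm (mul_ne_zero hn' hε)
  · have hc' : leadC (derivative f) (derivative g) ε₁ ≠ 0 := by
      rw [leadC_derivative hn]
      exact mul_ne_zero hn' hc
    have h2 : ContinuousAt (fun ε : ℂ => fibBound (derivative f) (derivative g) (0, ε)) ε₁ :=
      ContinuousAt.comp (f := fun ε : ℂ => ((0 : ℂ), ε)) (continuousAt_fibBound hc') (by fun_prop)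
    refine ⟨fibBound (derivative f) (derivative g) (0, ε₁) + 1, ?_⟩
    filter_upwards [hev, h2.eventually_lt_const (lt_add_one _)] with ε hε hlt w hw
    refine (norm_le_fibBound (b := (0, ε)) hn1 ?_ hw).trans hlt.le
    rw [leadC_derivative hn]
    exact mul_ne_zero hn' hε

/-- Away from `p₂(Σ₀)` the curve `Σ` is locally a finite union of graphs. -/
theorem exists_branches (hn : defDeg f g ≠ 0) {ε₁ : ℂ} (hc : leadC f g ε₁ ≠ 0)
    (hS : ε₁ ∉ Prod.snd '' sigmaZero f g) :
    ∃ (T : Finset ℂ) (φ : ℂ → ℂ → ℂ), (∀ τ ∈ T, φ τ ε₁ = τ) ∧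
      (∀ τ ∈ T, ∀ᶠ ε in 𝓝 ε₁, ContinuousAt (φ τ) ε) ∧ (∀ t, (t, ε₁) ∈ sigmaFin f g ↔ t ∈ T) ∧
      ∀ᶠ ε in 𝓝 ε₁, ∀ t, (t, ε) ∈ sigmaFin f g ↔ ∃ τ ∈ T, t = φ τ ε := by
  have hfin := finite_slice_sigmaFin hn hc
  have hT : ∀ t, (t, ε₁) ∈ sigmaFin f g ↔ t ∈ hfin.toFinset := fun t => by simp
  have hex : ∀ τ ∈ hfin.toFinset, ∃ (V : Set ℂ) (φ : ℂ → ℂ) (U : Set (ℂ × ℂ)),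
        IsOpen V ∧ ε₁ ∈ V ∧ (∀ x ∈ V, AnalyticAt ℂ φ x) ∧ φ ε₁ = τ ∧
        IsOpen U ∧ (τ, ε₁) ∈ U ∧
        sigmaFin f g ∩ U = {q : ℂ × ℂ | q.2 ∈ V ∧ q.1 = φ q.2} ∩ U := by
    intro τ hτ
    by_contra hcon
    exact hS ⟨(τ, ε₁), ⟨(hT τ).2 hτ, hcon⟩, rfl⟩
  set T := hfin.toFinset
  choose! V φ U hV hεV hφ hφ1 hU hτU hgraph using hex
  have hmem : ∀ τ ∈ T, ∀ᶠ q : ℂ × ℂ in 𝓝 (τ, ε₁), q ∈ sigmaFin f g ↔ q.1 = φ τ q.2 := by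
    intro τ hτ
    filter_upwards [(hU τ hτ).mem_nhds (hτU τ hτ),
      continuousAt_snd.preimage_mem_nhds ((hV τ hτ).mem_nhds (hεV τ hτ))] with q hq hqV
    have := Set.ext_iff.1 (hgraph τ hτ) q
    simp only [Set.mem_inter_iff, hq, and_true, Set.mem_ofPred_eq] at this
    rw [this]
    exact ⟨fun h => h.2, fun h => ⟨hqV, h⟩⟩
  have hcont1 : ∀ τ ∈ T, ContinuousAt (φ τ) ε₁ := fun τ hτ =>
    (hφ τ hτ ε₁ (hεV τ hτ)).continuousAt
  refine ⟨T, φ, hφ1, fun τ hτ => ?_, hT, ?_⟩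
  · filter_upwards [(hV τ hτ).mem_nhds (hεV τ hτ)] with ε hε
    exact (hφ τ hτ ε hε).continuousAt
  have hA : ∀ᶠ ε in 𝓝 ε₁, ∀ τ ∈ T, (φ τ ε, ε) ∈ sigmaFin f g := by
    rw [Filter.eventually_all_finset]
    intro τ hτ
    have h1 : Tendsto (fun ε => (φ τ ε, ε)) (𝓝 ε₁) (𝓝 (τ, ε₁)) := by
      have := (hcont1 τ hτ).prodMk continuousAt_id
      rwa [ContinuousAt, hφ1 τ hτ] at this
    filter_upwards [h1.eventually (hmem τ hτ)] with ε hε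
    exact hε.2 rfl
  obtain ⟨R, hR⟩ := eventually_norm_le_of_critical hn hc
  have hB : ∀ᶠ ε in 𝓝 ε₁, ∀ w ∈ Metric.closedBall (0 : ℂ) R,
      f.derivative.eval w + ε * g.derivative.eval w = 0 →
        ∃ τ ∈ T, f.eval w + ε * g.eval w = φ τ ε := by
    refine (isCompact_closedBall _ _).eventually_forall_of_forall_eventually fun w _ => ?_
    by_cases hw : f.derivative.eval w + ε₁ * g.derivative.eval w = 0
    · have hτ : f.eval w + ε₁ * g.eval w ∈ T := (hT _).1 (Or.inr ⟨w, rfl, hw⟩)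
      have h1 : Tendsto (fun z : ℂ × ℂ => (f.eval z.2 + z.1 * g.eval z.2, z.1)) (𝓝 (ε₁, w))
          (𝓝 (f.eval w + ε₁ * g.eval w, ε₁)) := by
        have : Continuous fun z : ℂ × ℂ => (f.eval z.2 + z.1 * g.eval z.2, z.1) := by fun_prop
        exact this.tendsto (ε₁, w)
      filter_upwards [h1.eventually (hmem _ hτ)] with z hz hz'
      exact ⟨_, hτ, hz.1 (Or.inr ⟨z.2, rfl, hz'⟩)⟩
    · have h1 : ContinuousAt (fun z : ℂ × ℂ => f.derivative.eval z.2 + z.1 * g.derivative.eval z.2)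
          (ε₁, w) := by fun_prop
      filter_upwards [h1.eventually_ne hw] with z hz hz'
      exact absurd hz' hz
  filter_upwards [hA, hB, hR, continuous_leadC.continuousAt.eventually_ne hc] with ε hAε hBε hRε hcε t
  constructor
  · rintro (h | ⟨w, hw, hw'⟩)
    · exact absurd h hcε
    · obtain ⟨τ, hτ, h⟩ := hBε w (by simpa using hRε w hw') hw'
      exact ⟨τ, hτ, hw.symm.trans h⟩
  · rintro ⟨τ, hτ, rfl⟩
    exact hAε τ hτ

/-- Over a neighbourhood of a point outside `p₂(Σ₀)` the pairs `(ℂ, Σ_ε)` form a trivial family. -/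
theorem exists_trivialization (hn : defDeg f g ≠ 0) {ε₁ : ℂ} (hc : leadC f g ε₁ ≠ 0)
    (hS : ε₁ ∉ Prod.snd '' sigmaZero f g) :
    ∃ Ψ : ℂ → ℂ → ℂ, (∀ t, Ψ ε₁ t = t) ∧ ∀ᶠ ε in 𝓝 ε₁,
      (∀ t, ContinuousAt (Function.uncurry Ψ) (ε, t)) ∧ (∃ e : ℂ ≃ₜ ℂ, ∀ t, e t = Ψ ε t) ∧
      ∀ t, (Ψ ε t, ε) ∈ sigmaFin f g ↔ (t, ε₁) ∈ sigmaFin f g := by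
  obtain ⟨T, φ, h1, hcont, hT, hev⟩ := exists_branches hn hc hS
  obtain ⟨Ψ, hΨ1, hΨ⟩ := exists_motion T φ ε₁ h1 hcont
  refine ⟨Ψ, hΨ1, ?_⟩
  filter_upwards [hΨ, hev] with ε ⟨hεc, ⟨e, he⟩, hεT⟩ hε
  refine ⟨hεc, ⟨e, he⟩, fun t => ?_⟩
  rw [hε, hT]
  constructor
  · rintro ⟨τ, hτ, h⟩
    rw [← hεT τ hτ, ← he, ← he] at h
    rwa [e.injective h]
  · intro ht
    exact ⟨t, ht, hεT t ht⟩

end Branches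

section Transport
open Filter Topology

variable {f g : ℂ[X]}

/-- Outside `p₂(Σ₀)` loops in a nearby slice can be transported to the given slice. -/
theorem eventually_labMonodromy_le (hn : defDeg f g ≠ 0) {t₁ ε₁ : ℂ}
    {μ₁ : Fin (defDeg f g) → ℂ} (h : ((t₁, ε₁), μ₁) ∈ LabSpace f g {x | x.2 = ε₁})
    (hS : ε₁ ∉ Prod.snd '' sigmaZero f g) :
    ∀ᶠ ε in 𝓝 ε₁, ∃ (t : ℂ) (ν : Fin (defDeg f g) → ℂ)
      (hb : ((t, ε), ν) ∈ LabSpace f g {x | x.2 = ε}), labMonodromy hb ≤ labMonodromy h := by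
  obtain ⟨Ψ, hΨ1, hev⟩ := exists_trivialization hn h.1.lead hS
  obtain ⟨δ, hδ, hball⟩ := Metric.eventually_nhds_iff_ball.1 hev
  filter_upwards [Metric.ball_mem_nhds ε₁ hδ] with ε hε
  let p : ℝ → ℂ := fun s => ε₁ + ((Set.projIcc (0 : ℝ) 1 zero_le_one s : ℝ) : ℂ) * (ε - ε₁)
  have hp : Continuous p := by
    have : Continuous fun s : ℝ => ((Set.projIcc (0 : ℝ) 1 zero_le_one s : ℝ) : ℂ) :=
      Complex.continuous_ofReal.comp (continuous_subtype_val.comp continuous_projIcc)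
    exact continuous_const.add (this.mul continuous_const)
  have hp0 : p 0 = ε₁ := by simp [p]
  have hp1 : p 1 = ε := by simp [p]
  have hpb : ∀ s, p s ∈ Metric.ball ε₁ δ := by
    intro s
    rw [Metric.mem_ball, dist_eq_norm] at hε ⊢
    have h01 := (Set.projIcc (0 : ℝ) 1 zero_le_one s).2
    simp only [p, add_sub_cancel_left, norm_mul, Complex.norm_real, Real.norm_eq_abs,
      abs_of_nonneg h01.1]
    exact (mul_le_of_le_one_left (norm_nonneg _) h01.2).trans_lt hε
  have hcont : ∀ {X : Type} [TopologicalSpace X] {q : X → ℝ} {α : X → ℂ}, Continuous q →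
      Continuous α → Continuous fun x => (Ψ (p (q x)) (α x), p (q x)) := by
    intro X _ q α hq hα
    have hpq : Continuous fun x => p (q x) := hp.comp hq
    refine Continuous.prodMk (continuous_iff_continuousAt.2 fun x => ?_) hpq
    exact ContinuousAt.comp (f := fun x => (p (q x), α x)) ((hball _ (hpb (q x))).1 (α x))
      (hpq.prodMk hα).continuousAt
  have hΩ : ∀ s t, (Ψ (p s) t, p s) ∉ sigmaFin f g ↔ (t, ε₁) ∉ sigmaFin f g :=
    fun s t => not_congr ((hball _ (hpb s)).2.2 t)
  obtain ⟨e, he⟩ := (hball ε hε).2.1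
  have ht₁ : (t₁, ε₁) ∉ sigmaFin f g := h.1.notMem_sigmaFin hn
  obtain ⟨N, hN, hN0, hNl⟩ := exists_lab_lift (A := ℝ) hn
    (φ := fun s => (Ψ (p s) t₁, p s)) (hcont continuous_id continuous_const)
    (fun s => (hΩ s t₁).2 ht₁) 0 (μ := μ₁) (by rw [hp0, hΨ1]; exact h.1)
  have hN1 : IsLab f g (Ψ ε t₁, ε) (N 1) := by
    have := hNl 1
    rwa [hp1] at this
  refine ⟨Ψ ε t₁, N 1, ⟨hN1, rfl⟩, fun σ hσ => ?_⟩
  obtain ⟨φ, m, hφ, hm, hφ0, hφ1, hm0, hm1, hφm⟩ := exists_lifts_of_mem_labMonodromy _ hσ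
  have hφ2 : ∀ r, (φ r).2 = ε := fun r => (hφm r).2
  let α : ℝ → ℂ := fun r => e.symm (φ r).1
  have hα : Continuous α := e.symm.continuous.comp (continuous_fst.comp hφ)
  have hΨα : ∀ r, (Ψ ε (α r), ε) = φ r := by
    intro r
    rw [← he, e.apply_symm_apply, ← hφ2 r]
  have hαend : ∀ r, φ r = (Ψ ε t₁, ε) → α r = t₁ := by
    intro r hr
    simp only [α, hr]
    rw [← he, e.symm_apply_apply]
  have hα0 := hαend 0 hφ0
  have hα1 := hαend 1 hφ1
  have hαΩ : ∀ r, (α r, ε₁) ∉ sigmaFin f g := by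
    intro r
    have := (hΩ 1 (α r)).1
    rw [hp1, hΨα] at this
    exact this ((hφm r).1.notMem_sigmaFin hn)
  obtain ⟨M, hM, hM1, hMl⟩ := exists_lab_lift (A := ℝ × ℝ) hn
    (φ := fun x => (Ψ (p x.1) (α x.2), p x.1)) (hcont continuous_fst (hα.comp continuous_snd))
    (fun x => (hΩ x.1 _).2 (hαΩ x.2)) (1, 0) (μ := N 1) (by
      simpa only [hp1, hα0] using hN1)
  have hMr : (fun r => M (1, r)) = m := by
    refine lab_lift_unique hn (φ := φ) (hM.comp (by fun_prop)) hm (fun r => ?_)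
      (fun r => (hφm r).1) 0 ?_
    · have := hMl (1, r)
      simpa only [hp1, hΨα] using this
    · rw [hM1, hm0]
  have hM0 : (fun s => M (s, 0)) = N := by
    refine lab_lift_unique hn (φ := fun s => (Ψ (p s) t₁, p s)) (hM.comp (by fun_prop)) hN
      (fun s => ?_) hNl 1 hM1
    have := hMl (s, 0)
    simpa only [hα0] using this
  have hMσ : (fun s => M (s, 1)) = fun s i => N s (σ i) := by
    refine lab_lift_unique hn (φ := fun s => (Ψ (p s) t₁, p s)) (hM.comp (by fun_prop))
      (continuous_pi fun i => (continuous_apply (σ i)).comp hN)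
      (fun s => ?_) (fun s => (hNl s).comp_perm σ) 1 ?_
    · have := hMl (s, 1)
      simpa only [hα1] using this
    · rw [congrFun hMr 1, hm1]
  refine JoinedIn.ofLine (f := fun r => ((α r, ε₁), M (0, r))) ?_ ?_ ?_ ?_
  · exact ((hα.prodMk continuous_const).prodMk (hM.comp (by fun_prop))).continuousOn
  · rw [hα0, congrFun hM0 0, hN0]
  · rw [hα1, congrFun hMσ 0, hN0]
  · rintro _ ⟨r, -, rfl⟩
    have := hMl (0, r)
    refine ⟨?_, rfl⟩
    simpa only [hp0, hΨ1] using this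

end Transport

section Conclusion
open Filter Topology

variable {f g : ℂ[X]}

theorem permMapHom_trans {X Y Z : Type*} (e : X ≃ Y) (e' : Y ≃ Z) :
    permMapHom (e.trans e') = (permMapHom e').comp (permMapHom e) := rfl

theorem permMapHom_injective {X Y : Type*} (e : X ≃ Y) : Function.Injective (permMapHom e) := by
  intro σ τ h
  ext x
  have := Equiv.congr_fun h (e x)
  simpa [permMapHom] using this

theorem map_permMapHom_symm_trans {X Y Z : Type*} (e₁ : X ≃ Y) (e₀ : X ≃ Z)
    (K : Subgroup (Equiv.Perm X)) :
    (K.map (permMapHom e₁)).map (permMapHom (e₁.symm.trans e₀)) = K.map (permMapHom e₀) := by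
  rw [Subgroup.map_map, ← permMapHom_trans, ← Equiv.trans_assoc, Equiv.self_trans_symm,
    Equiv.refl_trans]

theorem isEmpty_theFiber (hn : defDeg f g = 0) {t ε : ℂ} (h : (t, ε) ∉ sigmaFin f g) :
    IsEmpty (theFiber f g t ε) := by
  refine ⟨fun x => h (Or.inr ⟨x.1, x.2, ?_⟩)⟩
  have h0 : f.natDegree = 0 ∧ g.natDegree = 0 := by
    unfold defDeg at hn
    omega
  rw [show derivative f = 0 from derivative_eq_zero.2 h0.1,
    show derivative g = 0 from derivative_eq_zero.2 h0.2]
  simp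

theorem subsingleton_gal_defPoly (hn : defDeg f g = 0) : Subsingleton (defPoly f g).Gal := by
  have h0 : f.natDegree = 0 ∧ g.natDegree = 0 := by
    unfold defDeg at hn
    omega
  have : defPoly f g = C (cEmb (f.coeff 0) + eVar * cEmb (g.coeff 0) - tVar) := by
    rw [defPoly, eq_C_of_natDegree_eq_zero h0.1, eq_C_of_natDegree_eq_zero h0.2]
    simp
  rw [this]
  infer_instance

/-- Outside `p₂(Σ₀)` the monodromy in a slice is already the full monodromy. -/
theorem labMonodromy_slice_eq (hn : defDeg f g ≠ 0) {t₁ ε₁ : ℂ} {μ₁ : Fin (defDeg f g) → ℂ}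
    (h : ((t₁, ε₁), μ₁) ∈ LabSpace f g Set.univ)
    (h' : ((t₁, ε₁), μ₁) ∈ LabSpace f g {x | x.2 = ε₁})
    (hS : ε₁ ∉ Prod.snd '' sigmaZero f g) : labMonodromy h' = labMonodromy h := by
  have hle : labMonodromy h' ≤ labMonodromy h := labMonodromy_mono (Set.subset_univ _) h' h
  obtain ⟨Z, hZ, hcard⟩ := finite_card_labMonodromy_slice_lt hn h
  obtain ⟨ε, hε, t, ν, hb, hlt⟩ : ∃ ε ∉ Z, ∃ (t : ℂ) (ν : Fin (defDeg f g) → ℂ)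
      (hb : ((t, ε), ν) ∈ LabSpace f g {x | x.2 = ε}), labMonodromy hb ≤ labMonodromy h' := by
    obtain ⟨s, hs, hh_s⟩ := (hZ.countable.dense_compl ℝ).inter_nhds_nonempty
      (eventually_labMonodromy_le hn h' hS)
    exact ⟨s, hs, hh_s⟩
  have h1 : Nat.card (labMonodromy h) ≤ Nat.card (labMonodromy h') :=
    (hcard _ _ hb hε).trans (Nat.card_mono (Set.toFinite _) hlt)
  exact SetLike.coe_injective (Set.eq_of_subset_of_ncard_le hle h1 (Set.toFinite _))

end Conclusion

/-!
STATEMENT 4 (Corollary on `G` and `G_ε`).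

(i) For every `ε₁` with `c(ε₁) ≠ 0`, `G_{ε₁}` is a subgroup of `G` up to
conjugation (i.e. after identifying the two fibers by some bijection).
(ii) For every `ε₁ ∉ p₂(Σ₀)`, `G_{ε₁}` equals `G` up to conjugation.
(iii) `G` is (isomorphic to) the Galois group of the Galois extension of
`ℂ(t,ε)` by the `n` preimages `z₁(t,ε),…,zₙ(t,ε)`, i.e. the Galois group of
`f(z) + ε g(z) - t` over `ℂ(t,ε)`.
-/
theorem slice_monodromy_subgroup_and_galois
    (f g : Polynomial ℂ) (t₀ ε₀ : ℂ)
    (hbase : ((t₀ : OnePoint ℂ), ε₀) ∉ sigmaSet f g) :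
    (∀ ε₁ t₁ : ℂ, leadC f g ε₁ ≠ 0 → ((t₁ : OnePoint ℂ), ε₁) ∉ sigmaSet f g →
      ∃ e : theFiber f g t₁ ε₁ ≃ theFiber f g t₀ ε₀,
        (SliceMonodromyGroup f g ε₁ t₁).map (permMapHom e)
          ≤ MonodromyGroup f g t₀ ε₀) ∧
    (∀ ε₁ t₁ : ℂ, ε₁ ∉ Prod.snd '' sigmaZero f g →
        ((t₁ : OnePoint ℂ), ε₁) ∉ sigmaSet f g →
      ∃ e : theFiber f g t₁ ε₁ ≃ theFiber f g t₀ ε₀,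
        (SliceMonodromyGroup f g ε₁ t₁).map (permMapHom e)
          = MonodromyGroup f g t₀ ε₀) ∧
    Nonempty ((MonodromyGroup f g t₀ ε₀) ≃* (defPoly f g).Gal) := by
  rw [notMem_sigmaSet_iff] at hbase
  by_cases hn : defDeg f g = 0
  · have := isEmpty_theFiber hn hbase
    have := subsingleton_gal_defPoly hn
    refine ⟨fun ε₁ t₁ _ h => ?_, fun ε₁ t₁ _ h => ?_, ?_⟩
    · have := isEmpty_theFiber hn (notMem_sigmaSet_iff.1 h)
      exact ⟨Equiv.equivOfIsEmpty _ _, (Subsingleton.elim _ _).le⟩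
    · have := isEmpty_theFiber hn (notMem_sigmaSet_iff.1 h)
      exact ⟨Equiv.equivOfIsEmpty _ _, Subsingleton.elim _ _⟩
    · exact ⟨⟨⟨fun _ => 1, fun _ => 1, fun _ => Subsingleton.elim _ _,
        fun _ => Subsingleton.elim _ _⟩, fun _ _ => Subsingleton.elim _ _⟩⟩
  obtain ⟨μ₀, hμ₀⟩ := exists_isLab hn hbase
  have h₀ : ((t₀, ε₀), μ₀) ∈ LabSpace f g Set.univ := ⟨hμ₀, Set.mem_univ _⟩
  have key : ∀ ε₁ t₁ : ℂ, ((t₁ : OnePoint ℂ), ε₁) ∉ sigmaSet f g →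
      ∃ (μ₁ : Fin (defDeg f g) → ℂ) (h : ((t₁, ε₁), μ₁) ∈ LabSpace f g Set.univ)
        (h' : ((t₁, ε₁), μ₁) ∈ LabSpace f g {x | x.2 = ε₁})
        (e : theFiber f g t₁ ε₁ ≃ theFiber f g t₀ ε₀),
        (SliceMonodromyGroup f g ε₁ t₁).map (permMapHom e) =
          (labMonodromy h').map (permMapHom (hμ₀.fiberEquiv hn)) ∧
        labMonodromy h₀ = labMonodromy h := by
    intro ε₁ t₁ h
    obtain ⟨μ₁, hj⟩ := exists_joinedIn_generic hn hμ₀ (notMem_sigmaSet_iff.1 h)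
    refine ⟨μ₁, hj.target_mem, ⟨hj.target_mem.1, rfl⟩,
      (hj.target_mem.1.fiberEquiv hn).symm.trans (hμ₀.fiberEquiv hn), ?_,
      labMonodromy_eq_of_joinedIn hj⟩
    rw [← map_permMapHom_symm_trans (hj.target_mem.1.fiberEquiv hn) (hμ₀.fiberEquiv hn)]
    exact congrArg _ (sliceMonodromyGroup_eq hn (b := (t₁, ε₁)) (μ := μ₁)
      ⟨hj.target_mem.1, rfl⟩)
  have hG : MonodromyGroup f g t₀ ε₀ = (labMonodromy h₀).map (permMapHom (hμ₀.fiberEquiv hn)) :=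
    monodromyGroup_eq hn h₀
  refine ⟨fun ε₁ t₁ _ h => ?_, fun ε₁ t₁ hS h => ?_, ?_⟩
  · obtain ⟨μ₁, h₁, h₁', e, he, hM⟩ := key ε₁ t₁ h
    refine ⟨e, ?_⟩
    rw [he, hG, hM]
    exact Subgroup.map_mono (labMonodromy_mono (Set.subset_univ _) h₁' h₁)
  · obtain ⟨μ₁, h₁, h₁', e, he, hM⟩ := key ε₁ t₁ h
    refine ⟨e, ?_⟩
    rw [he, hG, hM, labMonodromy_slice_eq hn h₁ h₁' hS]
  · rw [hG]
    obtain ⟨E⟩ := nonempty_labMonodromy_mulEquiv_gal hn h₀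
    exact ⟨((labMonodromy h₀).equivMapOfInjective _ (permMapHom_injective _)).symm.trans E⟩

end
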